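/- Under the standing assumptions of Section 4 of the paper, together with the requirements that idempotent morphisms in C split and that d̂₁ := ê₁∘d₁ and d̂₂ := ê₂∘d₂ are regular epimorphisms, the category of A-modules (objects: modules (V,v) over the semigroup A; morphisms: module morphisms) carries a monoidal structure in which the monoidal product of (V,v) and (W,w) is the A-module (V∘W, b) of Proposition 4.8 and the monoidal unit is the A-module (L, p∘n₂) of Proposition 4.4, and such that the functor U of Theorem 4.3, sending an A-module to its underlying L-bicomodule and acting as the identity on morphisms, is strict monoidal with respect to the monoidal structure on L-bicomodules whose tensor product of bicomodules V, W is the splitting V∘W of the idempotent s and whose unit is L. -/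

import Mathlib

open CategoryTheory Category MonoidalCategory Limits

universe v u

namespace WeakMultiplierBimonoid

variable {C : Type u} [Category.{v} C] [MonoidalCategory C] [BraidedCategory C]

def wl {A : C} (f : A ⊗ A ⟶ A ⊗ A) : A ⊗ (A ⊗ A) ⟶ A ⊗ (A ⊗ A) :=
  (α_ A A A).inv ≫ (f ▷ A) ≫ (α_ A A A).hom

def ml {A : C} (f : A ⊗ A ⟶ A) : A ⊗ (A ⊗ A) ⟶ A ⊗ A :=
  (α_ A A A).inv ≫ (f ▷ A)

def NdLeftOn {Z V W : C} (v : Z ⊗ V ⟶ W) (𝒴 : Set C) : Prop :=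
  ∀ (X : C), ∀ Y ∈ 𝒴, Function.Injective
    (fun g : X ⟶ V ⊗ Y => (Z ◁ g) ≫ (α_ Z V Y).inv ≫ (v ▷ Y))

def NdRightOn {Z V W : C} (v : Z ⊗ V ⟶ W) (𝒴 : Set C) : Prop :=
  NdLeftOn ((β_ V Z).hom ≫ v) 𝒴

/-- The "middle braiding" `1 ⊗ c ⊗ 1 : A⁴ ⟶ A⁴` on `(A ⊗ A) ⊗ (A ⊗ A)`. -/
def midSw (A : C) : (A ⊗ A) ⊗ (A ⊗ A) ⟶ (A ⊗ A) ⊗ (A ⊗ A) :=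
  (α_ A A (A ⊗ A)).hom ≫ (A ◁ (α_ A A A).inv) ≫ (A ◁ ((β_ A A).hom ▷ A)) ≫
    (A ◁ (α_ A A A).hom) ≫ (α_ A A (A ⊗ A)).inv

/-- A regular weak multiplier bimonoid on an object `A` of a braided monoidal category,
with multiplication non-degenerate with respect to the class `𝒴`
(Definition 2.9 of the paper). -/
structure RWMB (A : C) (𝒴 : Set C) where
  t₁ : A ⊗ A ⟶ A ⊗ A
  t₂ : A ⊗ A ⟶ A ⊗ A
  t₃ : A ⊗ A ⟶ A ⊗ A
  t₄ : A ⊗ A ⟶ A ⊗ A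
  e₁ : A ⊗ A ⟶ A ⊗ A
  e₂ : A ⊗ A ⟶ A ⊗ A
  j : A ⟶ 𝟙_ C
  /-- the induced multiplication -/
  m : A ⊗ A ⟶ A
  /-- counit condition (m1); in particular `m` is the induced multiplication -/
  hm₁ : m = t₁ ≫ (j ▷ A) ≫ (λ_ A).hom
  /-- counit condition (m2) -/
  hm₂ : m = t₂ ≫ (A ◁ j) ≫ (ρ_ A).hom
  /-- counit condition (m3) -/
  hm₃ : m = (β_ A A).hom ≫ t₃ ≫ (j ▷ A) ≫ (λ_ A).hom
  /-- counit condition (m4) -/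
  hm₄ : m = (β_ A A).hom ≫ t₄ ≫ (A ◁ j) ≫ (ρ_ A).hom
  /-- the class `𝒴` contains the monoidal unit -/
  memI : (𝟙_ C) ∈ 𝒴
  memA : A ∈ 𝒴
  memAA : (A ⊗ A) ∈ 𝒴
  /-- `m` is non-degenerate on the left with respect to `𝒴` -/
  ndl : NdLeftOn m 𝒴
  /-- `m` is non-degenerate on the right with respect to `𝒴` -/
  ndr : NdRightOn m 𝒴
  /-- relation (c12) -/
  hc12 : (A ◁ t₁) ≫ ml m = wl t₂ ≫ (A ◁ m)
  /-- relation (c13) -/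
  hc13 : wl t₁ ≫ (A ◁ (β_ A A).hom) ≫ (A ◁ m)
    = (A ◁ (β_ A A).hom) ≫ wl t₃ ≫ (A ◁ m)
  /-- relation (c14) -/
  hc14 : (A ◁ t₁) ≫ wl (β_ A A).hom ≫ ml m = wl t₄ ≫ (A ◁ m)
  /-- relation (c23) -/
  hc23 : wl t₂ ≫ (A ◁ (β_ A A).hom) ≫ (A ◁ m) = (A ◁ t₃) ≫ ml m
  /-- relation (c24) -/
  hc24 : (A ◁ t₂) ≫ wl (β_ A A).hom ≫ ml m = wl (β_ A A).hom ≫ (A ◁ t₄) ≫ ml m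
  /-- relation (c34) -/
  hc34 : (A ◁ t₃) ≫ wl (β_ A A).hom ≫ ml m = wl t₄ ≫ (A ◁ (β_ A A).hom) ≫ (A ◁ m)
  /-- interchange relation for `(t₂, t₁)` -/
  hi21 : (A ◁ t₁) ≫ wl t₂ = wl t₂ ≫ (A ◁ t₁)
  /-- interchange relation for `(t₄, t₁)` -/
  hi41 : (A ◁ t₁) ≫ wl t₄ = wl t₄ ≫ (A ◁ t₁)
  /-- interchange relation for `(t₂, t₃)` -/
  hi23 : (A ◁ t₃) ≫ wl t₂ = wl t₂ ≫ (A ◁ t₃)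
  /-- interchange relation for `(t₄, t₃)` -/
  hi43 : (A ◁ t₃) ≫ wl t₄ = wl t₄ ≫ (A ◁ t₃)
  /-- compatibility of the idempotents `e₁`, `e₂`:
  `(m ⊗ m) ∘ (1 ⊗ c ⊗ 1) ∘ (1 ⊗ 1 ⊗ e₁) = (m ⊗ m) ∘ (1 ⊗ c ⊗ 1) ∘ (e₂ ⊗ 1 ⊗ 1)` -/
  hecomp : ((A ⊗ A) ◁ e₁) ≫ midSw A ≫ (m ▷ (A ⊗ A)) ≫ (A ◁ m)
    = (e₂ ▷ (A ⊗ A)) ≫ midSw A ≫ (m ▷ (A ⊗ A)) ≫ (A ◁ m)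
  /-- Axiom I for the weakly counital fusion morphism `(t₁, e₁, j)` -/
  ax1 : (A ◁ t₁) ≫ wl (β_ A A).hom ≫ (A ◁ t₁) ≫ wl (β_ A A).inv ≫ wl t₁
    = wl t₁ ≫ (A ◁ t₁)
  /-- Axiom II -/
  ax2 : e₁ ≫ e₁ = e₁
  /-- Axiom III -/
  ax3 : t₁ ≫ e₁ = t₁
  /-- Axiom IV -/
  ax4 : (A ◁ e₁) ≫ (A ◁ (β_ A A).inv) ≫ wl t₁ ≫ (A ◁ (β_ A A).hom) ≫ ml m
    = (A ◁ (β_ A A).inv) ≫ wl t₁ ≫ (A ◁ (β_ A A).hom) ≫ ml m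
  /-- Axiom V -/
  ax5 : (A ◁ t₁) ≫ wl e₁ = wl e₁ ≫ (A ◁ t₁)
  /-- Axiom VI -/
  ax6 : wl t₁ ≫ (A ◁ e₁)
    = (A ◁ (β_ A A).inv) ≫ wl e₁ ≫ (A ◁ (β_ A A).hom) ≫ wl t₁
  /-- Axiom VII -/
  ax7 : wl t₁ ≫ (A ◁ ((j ▷ A) ≫ (λ_ A).hom)) ≫ m
    = (A ◁ (β_ A A).hom) ≫ (A ◁ e₁) ≫ (A ◁ ((A ◁ j) ≫ (ρ_ A).hom)) ≫ m
  /-- Axiom VIII -/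
  ax8 : wl t₁ ≫ (A ◁ (β_ A A).hom) ≫ ml m ≫ (j ▷ A) ≫ (λ_ A).hom
    = (A ◁ (β_ A A).hom) ≫ (A ◁ e₁) ≫ (A ◁ ((j ▷ A) ≫ (λ_ A).hom)) ≫ m

namespace RWMB

variable {A : C} {𝒴 : Set C} (S : RWMB A 𝒴)

/-- `⊓ᴸ₁ := (j ⊗ 1) ∘ e₁`. -/
def piL1 : A ⊗ A ⟶ A := S.e₁ ≫ (S.j ▷ A) ≫ (λ_ A).hom

/-- `⊓ᴸ₂ := (j ⊗ 1) ∘ t₄ ∘ c`. -/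
def piL2 : A ⊗ A ⟶ A := (β_ A A).hom ≫ S.t₄ ≫ (S.j ▷ A) ≫ (λ_ A).hom

/-- `⊓̄ᴿ₁ ∘ c⁻¹ = (1 ⊗ j) ∘ e₁`, the second leg of the coequalizer defining the base
object. -/
def piBarR1c : A ⊗ A ⟶ A := S.e₁ ≫ (A ◁ S.j) ≫ (ρ_ A).hom

end RWMB


/-- A module over the semigroup `(A, m)`, relative to the class `𝒴`: an object of `𝒴`
with an associative action which is a regular epimorphism and non-degenerate on the
left with respect to `𝒴`. -/
structure AModule (A : C) (m : A ⊗ A ⟶ A) (𝒴 : Set C) where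
  V : C
  mem : V ∈ 𝒴
  act : A ⊗ V ⟶ V
  assoc : (A ◁ act) ≫ act = (α_ A A V).inv ≫ (m ▷ V) ≫ act
  regEpi : Nonempty (RegularEpi act)
  nd : NdLeftOn act 𝒴

/-- The canonical idempotent
`s := (1 ⊗ ε ⊗ 1) ∘ (1 ⊗ μ ⊗ 1) ∘ (τ̄_V ⊗ τ_W) : V ⊗ W ⟶ V ⊗ W`. -/
def sIdem {L : C} (μ : L ⊗ L ⟶ L) (ε : L ⟶ 𝟙_ C) {V W : C}
    (τbV : V ⟶ V ⊗ L) (τW : W ⟶ L ⊗ W) : V ⊗ W ⟶ V ⊗ W :=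
  (τbV ▷ W) ≫ ((V ⊗ L) ◁ τW) ≫ (α_ V L (L ⊗ W)).hom ≫ (V ◁ (α_ L L W).inv) ≫
    (V ◁ (μ ▷ W)) ≫ (V ◁ (ε ▷ W)) ≫ (V ◁ (λ_ W).hom)

/-- `(v ⊗ w) ∘ (1 ⊗ c ⊗ 1) : (A ⊗ A) ⊗ (V ⊗ W) ⟶ V ⊗ W`, where the middle braiding
`c : A ⊗ V ⟶ V ⊗ A` interchanges the second `A` factor with `V`. -/
def actPair {A V W : C} (v : A ⊗ V ⟶ V) (w : A ⊗ W ⟶ W) :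
    (A ⊗ A) ⊗ (V ⊗ W) ⟶ V ⊗ W :=
  (α_ A A (V ⊗ W)).hom ≫ (A ◁ (α_ A V W).inv) ≫ (A ◁ ((β_ A V).hom ▷ W)) ≫
    (A ◁ (α_ V A W).hom) ≫ (α_ A V (A ⊗ W)).inv ≫ (v ▷ (A ⊗ W)) ≫ (V ◁ w)

/-- `d₁ := (m ⊗ 1) ∘ (1 ⊗ c) ∘ (t₁ ⊗ 1) ∘ (1 ⊗ c⁻¹) : A ⊗ A ⊗ A ⟶ A ⊗ A`. -/
def dOne {A : C} (m : A ⊗ A ⟶ A) (t₁ : A ⊗ A ⟶ A ⊗ A) : A ⊗ (A ⊗ A) ⟶ A ⊗ A :=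
  (A ◁ (β_ A A).inv) ≫ wl t₁ ≫ (A ◁ (β_ A A).hom) ≫ ml m

/-- `d₂ := (1 ⊗ m) ∘ (c ⊗ 1) ∘ (1 ⊗ t₂) ∘ (c⁻¹ ⊗ 1) : A ⊗ A ⊗ A ⟶ A ⊗ A`. -/
def dTwo {A : C} (m : A ⊗ A ⟶ A) (t₂ : A ⊗ A ⟶ A ⊗ A) : A ⊗ (A ⊗ A) ⟶ A ⊗ A :=
  wl (β_ A A).inv ≫ (A ◁ t₂) ≫ wl (β_ A A).hom ≫ (A ◁ m)

/-- The category of modules over the semigroup `(A, m)` relative to `𝒴`; morphisms are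
module morphisms. -/
instance AModule.category (A : C) (m : A ⊗ A ⟶ A) (𝒴 : Set C) :
    Category (AModule A m 𝒴) where
  Hom M N := {f : M.V ⟶ N.V // M.act ≫ f = (A ◁ f) ≫ N.act}
  id M := ⟨𝟙 M.V, by simp⟩
  comp {M N P} f g := ⟨f.1 ≫ g.1, by
    simp only [MonoidalCategory.whiskerLeft_comp, Category.assoc]
    rw [reassoc_of% f.2, g.2]⟩
  id_comp f := Subtype.ext (Category.id_comp f.1)
  comp_id f := Subtype.ext (Category.comp_id f.1)
  assoc f g h := Subtype.ext (Category.assoc f.1 g.1 h.1)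

/-- A bicomodule over the comonoid `(L, δ, ε)`. -/
structure Bicomod (L : C) (δ : L ⟶ L ⊗ L) (ε : L ⟶ 𝟙_ C) where
  V : C
  lco : V ⟶ L ⊗ V
  rco : V ⟶ V ⊗ L
  lcoassoc : lco ≫ (L ◁ lco) = lco ≫ (δ ▷ V) ≫ (α_ L L V).hom
  lcounit : lco ≫ (ε ▷ V) ≫ (λ_ V).hom = 𝟙 V
  rcoassoc : rco ≫ (V ◁ δ) = rco ≫ (rco ▷ L) ≫ (α_ V L L).hom
  rcounit : rco ≫ (V ◁ ε) ≫ (ρ_ V).hom = 𝟙 V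
  bicomm : rco ≫ (lco ▷ L) ≫ (α_ L V L).hom = lco ≫ (L ◁ rco)

/-- The category of `L`-bicomodules; morphisms are bicomodule morphisms. -/
instance Bicomod.category (L : C) (δ : L ⟶ L ⊗ L) (ε : L ⟶ 𝟙_ C) :
    Category (Bicomod L δ ε) where
  Hom M N := {f : M.V ⟶ N.V //
    M.lco ≫ (L ◁ f) = f ≫ N.lco ∧ M.rco ≫ (f ▷ L) = f ≫ N.rco}
  id M := ⟨𝟙 M.V, by simp, by simp⟩
  comp {M N P} f g := ⟨f.1 ≫ g.1, by
    constructor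
    · simp only [MonoidalCategory.whiskerLeft_comp]
      rw [reassoc_of% f.2.1, g.2.1, Category.assoc]
    · simp only [MonoidalCategory.comp_whiskerRight]
      rw [reassoc_of% f.2.2, g.2.2, Category.assoc]⟩
  id_comp f := Subtype.ext (Category.id_comp f.1)
  comp_id f := Subtype.ext (Category.comp_id f.1)
  assoc f g h := Subtype.ext (Category.assoc f.1 g.1 h.1)

section StrictMonoidal

/-- The conditions expressing that `instMA`, `instMB` are monoidal structures on the
categories of `A`-modules and of `L`-bicomodules as in Theorem 4.9, and that `F` is a
strict monoidal functor acting as the identity on morphisms, whose object part sends a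
module to its underlying `L`-bicomodule of Theorem 4.3. -/
def StrictMonoidalLift {A : C} {𝒴 : Set C} (S : RWMB A 𝒴)
    (L : C) (p : A ⟶ L) (n₂ : A ⊗ L ⟶ A)
    (μ : L ⊗ L ⟶ L) (δ : L ⟶ L ⊗ L) (ε : L ⟶ 𝟙_ C)
    (τ : A ⟶ L ⊗ A) (τbar : A ⟶ A ⊗ L)
    [instMA : MonoidalCategory (AModule A S.m 𝒴)]
    [instMB : MonoidalCategory (Bicomod L δ ε)]
    (F : AModule A S.m 𝒴 ⥤ Bicomod L δ ε) : Prop :=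
  -- the monoidal unit of the category of `A`-modules is the module `(L, p ∘ n₂)`
  (∃ h : (𝟙_ (AModule A S.m 𝒴)).V = L,
    (𝟙_ (AModule A S.m 𝒴)).act = (A ◁ eqToHom h) ≫ n₂ ≫ p ≫ eqToHom h.symm) ∧
  -- the monoidal product of `A`-modules `(V, v)`, `(W, w)` is the module `(V ∘ W, b)`
  -- of Proposition 4.8: its carrier splits the canonical idempotent `s` and its
  -- action is induced by the action `b⁰` of Lemma 4.6
  (∀ (M N : AModule A S.m 𝒴)
    (τbM : M.V ⟶ M.V ⊗ L)
    (_ : M.act ≫ τbM = (τbar ▷ M.V) ≫ (α_ A L M.V).hom ≫ (A ◁ (β_ L M.V).hom) ≫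
      (α_ A M.V L).inv ≫ (M.act ▷ L))
    (τN : N.V ⟶ L ⊗ N.V)
    (_ : N.act ≫ τN = (τ ▷ N.V) ≫ (α_ L A N.V).hom ≫ (L ◁ N.act)),
    ∃ (sHat : M.V ⊗ N.V ⟶ (M ⊗ N).V) (sCheck : (M ⊗ N).V ⟶ M.V ⊗ N.V),
      sHat ≫ sCheck = sIdem μ ε τbM τN ∧
      sCheck ≫ sHat = 𝟙 (M ⊗ N).V ∧
      (∀ b0 : A ⊗ (M.V ⊗ N.V) ⟶ M.V ⊗ N.V,
        (A ◁ actPair M.act N.act) ≫ b0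
          = (α_ A (A ⊗ A) (M.V ⊗ N.V)).inv ≫ (dOne S.m S.t₁ ▷ (M.V ⊗ N.V)) ≫
              actPair M.act N.act →
        (A ◁ sHat) ≫ (M ⊗ N).act = b0 ≫ sHat)) ∧
  -- the monoidal unit of the category of `L`-bicomodules is `L`, with both coactions
  -- given by `δ`
  (∃ h : (𝟙_ (Bicomod L δ ε)).V = L,
    (𝟙_ (Bicomod L δ ε)).lco = eqToHom h ≫ δ ≫ (L ◁ eqToHom h.symm) ∧
    (𝟙_ (Bicomod L δ ε)).rco = eqToHom h ≫ δ ≫ (eqToHom h.symm ▷ L)) ∧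
  -- the monoidal product of `L`-bicomodules splits the canonical idempotent `s`
  (∀ B1 B2 : Bicomod L δ ε,
    ∃ (sHat : B1.V ⊗ B2.V ⟶ (B1 ⊗ B2).V) (sCheck : (B1 ⊗ B2).V ⟶ B1.V ⊗ B2.V),
      sHat ≫ sCheck = sIdem μ ε B1.rco B2.lco ∧ sCheck ≫ sHat = 𝟙 (B1 ⊗ B2).V) ∧
  -- `F` sends a module to its carrier, equipped with the coactions of Theorem 4.3
  (∀ M : AModule A S.m 𝒴,
    ∃ h : (F.obj M).V = M.V,
      (∀ τV : M.V ⟶ L ⊗ M.V,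
        M.act ≫ τV = (τ ▷ M.V) ≫ (α_ L A M.V).hom ≫ (L ◁ M.act) →
        (F.obj M).lco = eqToHom h ≫ τV ≫ (L ◁ eqToHom h.symm)) ∧
      (∀ τbV : M.V ⟶ M.V ⊗ L,
        M.act ≫ τbV = (τbar ▷ M.V) ≫ (α_ A L M.V).hom ≫ (A ◁ (β_ L M.V).hom) ≫
          (α_ A M.V L).inv ≫ (M.act ▷ L) →
        (F.obj M).rco = eqToHom h ≫ τbV ≫ (eqToHom h.symm ▷ L))) ∧
  -- `F` acts as the identity on morphisms
  (∀ (M N : AModule A S.m 𝒴) (f : M ⟶ N)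
    (hM : (F.obj M).V = M.V) (hN : (F.obj N).V = N.V),
    (F.map f).1 = eqToHom hM ≫ f.1 ≫ eqToHom hN.symm) ∧
  -- `F` is strict monoidal
  (∃ (FM : F.Monoidal)
    (h0 : F.obj (𝟙_ (AModule A S.m 𝒴)) = 𝟙_ (Bicomod L δ ε))
    (h2 : ∀ M N : AModule A S.m 𝒴, F.obj (M ⊗ N) = F.obj M ⊗ F.obj N),
    @Functor.LaxMonoidal.ε _ _ _ _ _ _ F FM.toLaxMonoidal = eqToHom h0.symm ∧
    ∀ M N : AModule A S.m 𝒴,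
      @Functor.LaxMonoidal.μ _ _ _ _ _ _ F FM.toLaxMonoidal M N
        = eqToHom (h2 M N).symm)

end StrictMonoidal

section Development
set_option linter.unusedSectionVars false
set_option linter.unusedSimpArgs false
set_option linter.unusedVariables false

section
set_option linter.unusedSectionVars false
/-! ### Right-normed calculus -/

def o11 {P Q : C} (f : P ⟶ Q) (Z : C) : P ⊗ Z ⟶ Q ⊗ Z := f ▷ Z
def o12 {P Q R : C} (f : P ⟶ Q ⊗ R) (Z : C) : P ⊗ Z ⟶ Q ⊗ (R ⊗ Z) := f ▷ Z ≫ (α_ Q R Z).hom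
def o21 {P Q R : C} (f : P ⊗ Q ⟶ R) (Z : C) : P ⊗ (Q ⊗ Z) ⟶ R ⊗ Z := (α_ P Q Z).inv ≫ f ▷ Z
def o22 {P Q R T : C} (f : P ⊗ Q ⟶ R ⊗ T) (Z : C) : P ⊗ (Q ⊗ Z) ⟶ R ⊗ (T ⊗ Z) :=
  (α_ P Q Z).inv ≫ f ▷ Z ≫ (α_ R T Z).hom
def o10 {P : C} (f : P ⟶ 𝟙_ C) (Z : C) : P ⊗ Z ⟶ Z := f ▷ Z ≫ (λ_ Z).hom
def o20 {P Q : C} (f : P ⊗ Q ⟶ 𝟙_ C) (Z : C) : P ⊗ (Q ⊗ Z) ⟶ Z :=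
  (α_ P Q Z).inv ≫ f ▷ Z ≫ (λ_ Z).hom

@[simp] theorem ex11_0 {P Q Z Z' : C} (f : P ⟶ Q) (g : Z ⟶ Z') :
    o11 f Z ≫ Q ◁ g = P ◁ g ≫ o11 f Z' := by simp only [o11, whisker_exchange]
@[simp] theorem ex11_0' {P Q Z Z' W : C} (f : P ⟶ Q) (g : Z ⟶ Z') (h : _ ⟶ W) :
    o11 f Z ≫ Q ◁ g ≫ h = P ◁ g ≫ o11 f Z' ≫ h := by
  rw [← Category.assoc, ex11_0, Category.assoc]
@[simp] theorem ex11_1 {P Q X1 Z Z' : C} (f : P ⟶ Q) (g : Z ⟶ Z') :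
    X1 ◁ o11 f Z ≫ X1 ◁ Q ◁ g = X1 ◁ P ◁ g ≫ X1 ◁ o11 f Z' := by simp only [← whiskerLeft_comp, ex11_0]
@[simp] theorem ex11_1' {P Q X1 Z Z' W : C} (f : P ⟶ Q) (g : Z ⟶ Z') (h : _ ⟶ W) :
    X1 ◁ o11 f Z ≫ X1 ◁ Q ◁ g ≫ h = X1 ◁ P ◁ g ≫ X1 ◁ o11 f Z' ≫ h := by
  rw [← Category.assoc, ex11_1, Category.assoc]
@[simp] theorem ex12_0 {P Q R Z Z' : C} (f : P ⟶ Q ⊗ R) (g : Z ⟶ Z') :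
    o12 f Z ≫ Q ◁ R ◁ g = P ◁ g ≫ o12 f Z' := by
  simp only [o12, Category.assoc, ← associator_naturality_right, whisker_exchange_assoc]
@[simp] theorem ex12_0' {P Q R Z Z' W : C} (f : P ⟶ Q ⊗ R) (g : Z ⟶ Z') (h : _ ⟶ W) :
    o12 f Z ≫ Q ◁ R ◁ g ≫ h = P ◁ g ≫ o12 f Z' ≫ h := by
  rw [← Category.assoc, ex12_0, Category.assoc]
@[simp] theorem ex21_0 {P Q R Z Z' : C} (f : P ⊗ Q ⟶ R) (g : Z ⟶ Z') :
    o21 f Z ≫ R ◁ g = P ◁ Q ◁ g ≫ o21 f Z' := by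
  simp only [o21, Category.assoc, ← whisker_exchange, associator_inv_naturality_right_assoc]
@[simp] theorem ex21_0' {P Q R Z Z' W : C} (f : P ⊗ Q ⟶ R) (g : Z ⟶ Z') (h : _ ⟶ W) :
    o21 f Z ≫ R ◁ g ≫ h = P ◁ Q ◁ g ≫ o21 f Z' ≫ h := by
  rw [← Category.assoc, ex21_0, Category.assoc]
@[simp] theorem ex21_1 {P Q R X1 Z Z' : C} (f : P ⊗ Q ⟶ R) (g : Z ⟶ Z') :
    X1 ◁ o21 f Z ≫ X1 ◁ R ◁ g = X1 ◁ P ◁ Q ◁ g ≫ X1 ◁ o21 f Z' := by simp only [← whiskerLeft_comp, ex21_0]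
@[simp] theorem ex21_1' {P Q R X1 Z Z' W : C} (f : P ⊗ Q ⟶ R) (g : Z ⟶ Z') (h : _ ⟶ W) :
    X1 ◁ o21 f Z ≫ X1 ◁ R ◁ g ≫ h = X1 ◁ P ◁ Q ◁ g ≫ X1 ◁ o21 f Z' ≫ h := by
  rw [← Category.assoc, ex21_1, Category.assoc]
@[simp] theorem ex21_2 {P Q R X1 X2 Z Z' : C} (f : P ⊗ Q ⟶ R) (g : Z ⟶ Z') :
    X1 ◁ X2 ◁ o21 f Z ≫ X1 ◁ X2 ◁ R ◁ g = X1 ◁ X2 ◁ P ◁ Q ◁ g ≫ X1 ◁ X2 ◁ o21 f Z' := by simp only [← whiskerLeft_comp, ex21_0]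
@[simp] theorem ex21_2' {P Q R X1 X2 Z Z' W : C} (f : P ⊗ Q ⟶ R) (g : Z ⟶ Z') (h : _ ⟶ W) :
    X1 ◁ X2 ◁ o21 f Z ≫ X1 ◁ X2 ◁ R ◁ g ≫ h = X1 ◁ X2 ◁ P ◁ Q ◁ g ≫ X1 ◁ X2 ◁ o21 f Z' ≫ h := by
  rw [← Category.assoc, ex21_2, Category.assoc]
@[simp] theorem ex22_0 {P Q R T Z Z' : C} (f : P ⊗ Q ⟶ R ⊗ T) (g : Z ⟶ Z') :
    o22 f Z ≫ R ◁ T ◁ g = P ◁ Q ◁ g ≫ o22 f Z' := by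
  simp only [o22, Category.assoc, ← associator_naturality_right, whisker_exchange_assoc,
    associator_inv_naturality_right_assoc]
@[simp] theorem ex22_0' {P Q R T Z Z' W : C} (f : P ⊗ Q ⟶ R ⊗ T) (g : Z ⟶ Z') (h : _ ⟶ W) :
    o22 f Z ≫ R ◁ T ◁ g ≫ h = P ◁ Q ◁ g ≫ o22 f Z' ≫ h := by
  rw [← Category.assoc, ex22_0, Category.assoc]
@[simp] theorem ex22_1 {P Q R T X1 Z Z' : C} (f : P ⊗ Q ⟶ R ⊗ T) (g : Z ⟶ Z') :
    X1 ◁ o22 f Z ≫ X1 ◁ R ◁ T ◁ g = X1 ◁ P ◁ Q ◁ g ≫ X1 ◁ o22 f Z' := by simp only [← whiskerLeft_comp, ex22_0]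
@[simp] theorem ex22_1' {P Q R T X1 Z Z' W : C} (f : P ⊗ Q ⟶ R ⊗ T) (g : Z ⟶ Z') (h : _ ⟶ W) :
    X1 ◁ o22 f Z ≫ X1 ◁ R ◁ T ◁ g ≫ h = X1 ◁ P ◁ Q ◁ g ≫ X1 ◁ o22 f Z' ≫ h := by
  rw [← Category.assoc, ex22_1, Category.assoc]
@[simp] theorem ex10_0 {P Z Z' : C} (f : P ⟶ 𝟙_ C) (g : Z ⟶ Z') :
    o10 f Z ≫ g = P ◁ g ≫ o10 f Z' := by
  simp only [o10, Category.assoc, ← leftUnitor_naturality, whisker_exchange_assoc]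
@[simp] theorem ex10_1 {P X1 Z Z' : C} (f : P ⟶ 𝟙_ C) (g : Z ⟶ Z') :
    X1 ◁ o10 f Z ≫ X1 ◁ g = X1 ◁ P ◁ g ≫ X1 ◁ o10 f Z' := by simp only [← whiskerLeft_comp, ex10_0]
@[simp] theorem ex10_1' {P X1 Z Z' W : C} (f : P ⟶ 𝟙_ C) (g : Z ⟶ Z') (h : _ ⟶ W) :
    X1 ◁ o10 f Z ≫ X1 ◁ g ≫ h = X1 ◁ P ◁ g ≫ X1 ◁ o10 f Z' ≫ h := by
  rw [← Category.assoc, ex10_1, Category.assoc]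
/-- strand crossing -/
def br (X Y Z : C) : X ⊗ (Y ⊗ Z) ⟶ Y ⊗ (X ⊗ Z) := o22 (β_ X Y).hom Z
/-- inverse strand crossing -/
def bri (X Y Z : C) : X ⊗ (Y ⊗ Z) ⟶ Y ⊗ (X ⊗ Z) := o22 (β_ Y X).inv Z

end

section
@[simp] theorem exbr_0 {P Q Z Z' : C} (g : Z ⟶ Z') :
    br P Q Z ≫ Q ◁ P ◁ g = P ◁ Q ◁ g ≫ br P Q Z' := ex22_0 _ g
@[simp] theorem exbr_0' {P Q Z Z' W : C} (g : Z ⟶ Z') (h : _ ⟶ W) :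
    br P Q Z ≫ Q ◁ P ◁ g ≫ h = P ◁ Q ◁ g ≫ br P Q Z' ≫ h := by
  rw [← Category.assoc, exbr_0, Category.assoc]
@[simp] theorem exbr_1 {P Q X1 Z Z' : C} (g : Z ⟶ Z') :
    X1 ◁ br P Q Z ≫ X1 ◁ Q ◁ P ◁ g = X1 ◁ P ◁ Q ◁ g ≫ X1 ◁ br P Q Z' := by simp only [← whiskerLeft_comp, exbr_0]
@[simp] theorem exbr_1' {P Q X1 Z Z' W : C} (g : Z ⟶ Z') (h : _ ⟶ W) :
    X1 ◁ br P Q Z ≫ X1 ◁ Q ◁ P ◁ g ≫ h = X1 ◁ P ◁ Q ◁ g ≫ X1 ◁ br P Q Z' ≫ h := by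
  rw [← Category.assoc, exbr_1, Category.assoc]
@[simp] theorem exbr_2 {P Q X1 X2 Z Z' : C} (g : Z ⟶ Z') :
    X1 ◁ X2 ◁ br P Q Z ≫ X1 ◁ X2 ◁ Q ◁ P ◁ g = X1 ◁ X2 ◁ P ◁ Q ◁ g ≫ X1 ◁ X2 ◁ br P Q Z' := by simp only [← whiskerLeft_comp, exbr_0]
@[simp] theorem exbr_2' {P Q X1 X2 Z Z' W : C} (g : Z ⟶ Z') (h : _ ⟶ W) :
    X1 ◁ X2 ◁ br P Q Z ≫ X1 ◁ X2 ◁ Q ◁ P ◁ g ≫ h = X1 ◁ X2 ◁ P ◁ Q ◁ g ≫ X1 ◁ X2 ◁ br P Q Z' ≫ h := by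
  rw [← Category.assoc, exbr_2, Category.assoc]
@[simp] theorem exbri_0 {P Q Z Z' : C} (g : Z ⟶ Z') :
    bri P Q Z ≫ Q ◁ P ◁ g = P ◁ Q ◁ g ≫ bri P Q Z' := ex22_0 _ g
@[simp] theorem exbri_0' {P Q Z Z' W : C} (g : Z ⟶ Z') (h : _ ⟶ W) :
    bri P Q Z ≫ Q ◁ P ◁ g ≫ h = P ◁ Q ◁ g ≫ bri P Q Z' ≫ h := by
  rw [← Category.assoc, exbri_0, Category.assoc]
@[simp] theorem exbri_1 {P Q X1 Z Z' : C} (g : Z ⟶ Z') :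
    X1 ◁ bri P Q Z ≫ X1 ◁ Q ◁ P ◁ g = X1 ◁ P ◁ Q ◁ g ≫ X1 ◁ bri P Q Z' := by simp only [← whiskerLeft_comp, exbri_0]
@[simp] theorem exbri_1' {P Q X1 Z Z' W : C} (g : Z ⟶ Z') (h : _ ⟶ W) :
    X1 ◁ bri P Q Z ≫ X1 ◁ Q ◁ P ◁ g ≫ h = X1 ◁ P ◁ Q ◁ g ≫ X1 ◁ bri P Q Z' ≫ h := by
  rw [← Category.assoc, exbri_1, Category.assoc]
@[simp] theorem br_bri_0 (P Q Z : C) : br P Q Z ≫ bri Q P Z = 𝟙 _ := by simp [br, bri, o22]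
@[simp] theorem br_bri_0' {P Q Z W : C} (h : _ ⟶ W) : br P Q Z ≫ bri Q P Z ≫ h = h := by
  rw [← Category.assoc, br_bri_0, Category.id_comp]
@[simp] theorem br_bri_1 (P Q X1 Z : C) : X1 ◁ br P Q Z ≫ X1 ◁ bri Q P Z = 𝟙 _ := by
  simp only [← whiskerLeft_comp, br_bri_0, whiskerLeft_id]
@[simp] theorem br_bri_1' {P Q X1 Z W : C} (h : _ ⟶ W) : X1 ◁ br P Q Z ≫ X1 ◁ bri Q P Z ≫ h = h := by
  rw [← Category.assoc, br_bri_1, Category.id_comp]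
@[simp] theorem br_bri_2 (P Q X1 X2 Z : C) : X1 ◁ X2 ◁ br P Q Z ≫ X1 ◁ X2 ◁ bri Q P Z = 𝟙 _ := by
  simp only [← whiskerLeft_comp, br_bri_0, whiskerLeft_id]
@[simp] theorem br_bri_2' {P Q X1 X2 Z W : C} (h : _ ⟶ W) : X1 ◁ X2 ◁ br P Q Z ≫ X1 ◁ X2 ◁ bri Q P Z ≫ h = h := by
  rw [← Category.assoc, br_bri_2, Category.id_comp]
@[simp] theorem br_bri_3 (P Q X1 X2 X3 Z : C) : X1 ◁ X2 ◁ X3 ◁ br P Q Z ≫ X1 ◁ X2 ◁ X3 ◁ bri Q P Z = 𝟙 _ := by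
  simp only [← whiskerLeft_comp, br_bri_0, whiskerLeft_id]
@[simp] theorem br_bri_3' {P Q X1 X2 X3 Z W : C} (h : _ ⟶ W) : X1 ◁ X2 ◁ X3 ◁ br P Q Z ≫ X1 ◁ X2 ◁ X3 ◁ bri Q P Z ≫ h = h := by
  rw [← Category.assoc, br_bri_3, Category.id_comp]
@[simp] theorem bri_br_0 (P Q Z : C) : bri P Q Z ≫ br Q P Z = 𝟙 _ := by simp [br, bri, o22]
@[simp] theorem bri_br_0' {P Q Z W : C} (h : _ ⟶ W) : bri P Q Z ≫ br Q P Z ≫ h = h := by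
  rw [← Category.assoc, bri_br_0, Category.id_comp]
@[simp] theorem bri_br_1 (P Q X1 Z : C) : X1 ◁ bri P Q Z ≫ X1 ◁ br Q P Z = 𝟙 _ := by
  simp only [← whiskerLeft_comp, bri_br_0, whiskerLeft_id]
@[simp] theorem bri_br_1' {P Q X1 Z W : C} (h : _ ⟶ W) : X1 ◁ bri P Q Z ≫ X1 ◁ br Q P Z ≫ h = h := by
  rw [← Category.assoc, bri_br_1, Category.id_comp]
@[simp] theorem bri_br_2 (P Q X1 X2 Z : C) : X1 ◁ X2 ◁ bri P Q Z ≫ X1 ◁ X2 ◁ br Q P Z = 𝟙 _ := by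
  simp only [← whiskerLeft_comp, bri_br_0, whiskerLeft_id]
@[simp] theorem bri_br_2' {P Q X1 X2 Z W : C} (h : _ ⟶ W) : X1 ◁ X2 ◁ bri P Q Z ≫ X1 ◁ X2 ◁ br Q P Z ≫ h = h := by
  rw [← Category.assoc, bri_br_2, Category.id_comp]
@[simp] theorem bri_br_3 (P Q X1 X2 X3 Z : C) : X1 ◁ X2 ◁ X3 ◁ bri P Q Z ≫ X1 ◁ X2 ◁ X3 ◁ br Q P Z = 𝟙 _ := by
  simp only [← whiskerLeft_comp, bri_br_0, whiskerLeft_id]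
@[simp] theorem bri_br_3' {P Q X1 X2 X3 Z W : C} (h : _ ⟶ W) : X1 ◁ X2 ◁ X3 ◁ bri P Q Z ≫ X1 ◁ X2 ◁ X3 ◁ br Q P Z ≫ h = h := by
  rw [← Category.assoc, bri_br_3, Category.id_comp]
theorem sR11 {P Q : C} (f : P ⟶ Q) (X Z : C) :
    o11 f (X ⊗ Z) ≫ br Q X Z =
      br P X Z ≫ X ◁ o11 f Z := by
  trans 𝟙 _ ⊗≫ (f ▷ X ≫ (β_ Q X).hom) ▷ Z ⊗≫ 𝟙 _
  · simp only [BraidedCategory.braiding_tensor_left_hom, BraidedCategory.braiding_tensor_right_hom,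
      BraidedCategory.braiding_tensor_left_inv, BraidedCategory.braiding_tensor_right_inv,
      braiding_tensorUnit_left, braiding_tensorUnit_right, braiding_inv_tensorUnit_left,
      braiding_inv_tensorUnit_right, o11, o12, o21, o22, o10, o20, br, bri]; monoidal
  · rw [BraidedCategory.braiding_naturality_left]; simp only [BraidedCategory.braiding_tensor_left_hom, BraidedCategory.braiding_tensor_right_hom,
      BraidedCategory.braiding_tensor_left_inv, BraidedCategory.braiding_tensor_right_inv,
      braiding_tensorUnit_left, braiding_tensorUnit_right, braiding_inv_tensorUnit_left,
      braiding_inv_tensorUnit_right, o11, o12, o21, o22, o10, o20, br, bri]; monoidal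
theorem siR11 {P Q : C} (f : P ⟶ Q) (X Z : C) :
    o11 f (X ⊗ Z) ≫ bri Q X Z =
      bri P X Z ≫ X ◁ o11 f Z := by
  trans 𝟙 _ ⊗≫ (f ▷ X ≫ (β_ X Q).inv) ▷ Z ⊗≫ 𝟙 _
  · simp only [BraidedCategory.braiding_tensor_left_hom, BraidedCategory.braiding_tensor_right_hom,
      BraidedCategory.braiding_tensor_left_inv, BraidedCategory.braiding_tensor_right_inv,
      braiding_tensorUnit_left, braiding_tensorUnit_right, braiding_inv_tensorUnit_left,
      braiding_inv_tensorUnit_right, o11, o12, o21, o22, o10, o20, br, bri]; monoidal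
  · rw [BraidedCategory.braiding_inv_naturality_left]; simp only [BraidedCategory.braiding_tensor_left_hom, BraidedCategory.braiding_tensor_right_hom,
      BraidedCategory.braiding_tensor_left_inv, BraidedCategory.braiding_tensor_right_inv,
      braiding_tensorUnit_left, braiding_tensorUnit_right, braiding_inv_tensorUnit_left,
      braiding_inv_tensorUnit_right, o11, o12, o21, o22, o10, o20, br, bri]; monoidal
theorem sL11 {P Q : C} (f : P ⟶ Q) (X Z : C) :
    X ◁ o11 f Z ≫ br X Q Z =
      br X P Z ≫ o11 f (X ⊗ Z) := by
  trans 𝟙 _ ⊗≫ (X ◁ f ≫ (β_ X Q).hom) ▷ Z ⊗≫ 𝟙 _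
  · simp only [BraidedCategory.braiding_tensor_left_hom, BraidedCategory.braiding_tensor_right_hom,
      BraidedCategory.braiding_tensor_left_inv, BraidedCategory.braiding_tensor_right_inv,
      braiding_tensorUnit_left, braiding_tensorUnit_right, braiding_inv_tensorUnit_left,
      braiding_inv_tensorUnit_right, o11, o12, o21, o22, o10, o20, br, bri]; monoidal
  · rw [BraidedCategory.braiding_naturality_right]; simp only [BraidedCategory.braiding_tensor_left_hom, BraidedCategory.braiding_tensor_right_hom,
      BraidedCategory.braiding_tensor_left_inv, BraidedCategory.braiding_tensor_right_inv,
      braiding_tensorUnit_left, braiding_tensorUnit_right, braiding_inv_tensorUnit_left,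
      braiding_inv_tensorUnit_right, o11, o12, o21, o22, o10, o20, br, bri]; monoidal
theorem sR12 {P Q R : C} (f : P ⟶ Q ⊗ R) (X Z : C) :
    o12 f (X ⊗ Z) ≫ Q ◁ br R X Z ≫ br Q X (R ⊗ Z) =
      br P X Z ≫ X ◁ o12 f Z := by
  trans 𝟙 _ ⊗≫ (f ▷ X ≫ (β_ (Q ⊗ R) X).hom) ▷ Z ⊗≫ 𝟙 _
  · simp only [BraidedCategory.braiding_tensor_left_hom, BraidedCategory.braiding_tensor_right_hom,
      BraidedCategory.braiding_tensor_left_inv, BraidedCategory.braiding_tensor_right_inv,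
      braiding_tensorUnit_left, braiding_tensorUnit_right, braiding_inv_tensorUnit_left,
      braiding_inv_tensorUnit_right, o11, o12, o21, o22, o10, o20, br, bri]; monoidal
  · rw [BraidedCategory.braiding_naturality_left]; simp only [BraidedCategory.braiding_tensor_left_hom, BraidedCategory.braiding_tensor_right_hom,
      BraidedCategory.braiding_tensor_left_inv, BraidedCategory.braiding_tensor_right_inv,
      braiding_tensorUnit_left, braiding_tensorUnit_right, braiding_inv_tensorUnit_left,
      braiding_inv_tensorUnit_right, o11, o12, o21, o22, o10, o20, br, bri]; monoidal
theorem sR21 {P Q R : C} (f : P ⊗ Q ⟶ R) (X Z : C) :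
    o21 f (X ⊗ Z) ≫ br R X Z =
      P ◁ br Q X Z ≫ br P X (Q ⊗ Z) ≫ X ◁ o21 f Z := by
  trans 𝟙 _ ⊗≫ (f ▷ X ≫ (β_ R X).hom) ▷ Z ⊗≫ 𝟙 _
  · simp only [BraidedCategory.braiding_tensor_left_hom, BraidedCategory.braiding_tensor_right_hom,
      BraidedCategory.braiding_tensor_left_inv, BraidedCategory.braiding_tensor_right_inv,
      braiding_tensorUnit_left, braiding_tensorUnit_right, braiding_inv_tensorUnit_left,
      braiding_inv_tensorUnit_right, o11, o12, o21, o22, o10, o20, br, bri]; monoidal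
  · rw [BraidedCategory.braiding_naturality_left]; simp only [BraidedCategory.braiding_tensor_left_hom, BraidedCategory.braiding_tensor_right_hom,
      BraidedCategory.braiding_tensor_left_inv, BraidedCategory.braiding_tensor_right_inv,
      braiding_tensorUnit_left, braiding_tensorUnit_right, braiding_inv_tensorUnit_left,
      braiding_inv_tensorUnit_right, o11, o12, o21, o22, o10, o20, br, bri]; monoidal
theorem siR21 {P Q R : C} (f : P ⊗ Q ⟶ R) (X Z : C) :
    o21 f (X ⊗ Z) ≫ bri R X Z =
      P ◁ bri Q X Z ≫ bri P X (Q ⊗ Z) ≫ X ◁ o21 f Z := by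
  trans 𝟙 _ ⊗≫ (f ▷ X ≫ (β_ X R).inv) ▷ Z ⊗≫ 𝟙 _
  · simp only [BraidedCategory.braiding_tensor_left_hom, BraidedCategory.braiding_tensor_right_hom,
      BraidedCategory.braiding_tensor_left_inv, BraidedCategory.braiding_tensor_right_inv,
      braiding_tensorUnit_left, braiding_tensorUnit_right, braiding_inv_tensorUnit_left,
      braiding_inv_tensorUnit_right, o11, o12, o21, o22, o10, o20, br, bri]; monoidal
  · rw [BraidedCategory.braiding_inv_naturality_left]; simp only [BraidedCategory.braiding_tensor_left_hom, BraidedCategory.braiding_tensor_right_hom,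
      BraidedCategory.braiding_tensor_left_inv, BraidedCategory.braiding_tensor_right_inv,
      braiding_tensorUnit_left, braiding_tensorUnit_right, braiding_inv_tensorUnit_left,
      braiding_inv_tensorUnit_right, o11, o12, o21, o22, o10, o20, br, bri]; monoidal
theorem sL21 {P Q R : C} (f : P ⊗ Q ⟶ R) (X Z : C) :
    X ◁ o21 f Z ≫ br X R Z =
      br X P (Q ⊗ Z) ≫ P ◁ br X Q Z ≫ o21 f (X ⊗ Z) := by
  trans 𝟙 _ ⊗≫ (X ◁ f ≫ (β_ X R).hom) ▷ Z ⊗≫ 𝟙 _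
  · simp only [BraidedCategory.braiding_tensor_left_hom, BraidedCategory.braiding_tensor_right_hom,
      BraidedCategory.braiding_tensor_left_inv, BraidedCategory.braiding_tensor_right_inv,
      braiding_tensorUnit_left, braiding_tensorUnit_right, braiding_inv_tensorUnit_left,
      braiding_inv_tensorUnit_right, o11, o12, o21, o22, o10, o20, br, bri]; monoidal
  · rw [BraidedCategory.braiding_naturality_right]; simp only [BraidedCategory.braiding_tensor_left_hom, BraidedCategory.braiding_tensor_right_hom,
      BraidedCategory.braiding_tensor_left_inv, BraidedCategory.braiding_tensor_right_inv,
      braiding_tensorUnit_left, braiding_tensorUnit_right, braiding_inv_tensorUnit_left,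
      braiding_inv_tensorUnit_right, o11, o12, o21, o22, o10, o20, br, bri]; monoidal
theorem siL21 {P Q R : C} (f : P ⊗ Q ⟶ R) (X Z : C) :
    X ◁ o21 f Z ≫ bri X R Z =
      bri X P (Q ⊗ Z) ≫ P ◁ bri X Q Z ≫ o21 f (X ⊗ Z) := by
  trans 𝟙 _ ⊗≫ (X ◁ f ≫ (β_ R X).inv) ▷ Z ⊗≫ 𝟙 _
  · simp only [BraidedCategory.braiding_tensor_left_hom, BraidedCategory.braiding_tensor_right_hom,
      BraidedCategory.braiding_tensor_left_inv, BraidedCategory.braiding_tensor_right_inv,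
      braiding_tensorUnit_left, braiding_tensorUnit_right, braiding_inv_tensorUnit_left,
      braiding_inv_tensorUnit_right, o11, o12, o21, o22, o10, o20, br, bri]; monoidal
  · rw [BraidedCategory.braiding_inv_naturality_right]; simp only [BraidedCategory.braiding_tensor_left_hom, BraidedCategory.braiding_tensor_right_hom,
      BraidedCategory.braiding_tensor_left_inv, BraidedCategory.braiding_tensor_right_inv,
      braiding_tensorUnit_left, braiding_tensorUnit_right, braiding_inv_tensorUnit_left,
      braiding_inv_tensorUnit_right, o11, o12, o21, o22, o10, o20, br, bri]; monoidal
theorem siR22 {P Q R T : C} (f : P ⊗ Q ⟶ R ⊗ T) (X Z : C) :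
    o22 f (X ⊗ Z) ≫ R ◁ bri T X Z ≫ bri R X (T ⊗ Z) =
      P ◁ bri Q X Z ≫ bri P X (Q ⊗ Z) ≫ X ◁ o22 f Z := by
  trans 𝟙 _ ⊗≫ (f ▷ X ≫ (β_ X (R ⊗ T)).inv) ▷ Z ⊗≫ 𝟙 _
  · simp only [BraidedCategory.braiding_tensor_left_hom, BraidedCategory.braiding_tensor_right_hom,
      BraidedCategory.braiding_tensor_left_inv, BraidedCategory.braiding_tensor_right_inv,
      braiding_tensorUnit_left, braiding_tensorUnit_right, braiding_inv_tensorUnit_left,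
      braiding_inv_tensorUnit_right, o11, o12, o21, o22, o10, o20, br, bri]; monoidal
  · rw [BraidedCategory.braiding_inv_naturality_left]; simp only [BraidedCategory.braiding_tensor_left_hom, BraidedCategory.braiding_tensor_right_hom,
      BraidedCategory.braiding_tensor_left_inv, BraidedCategory.braiding_tensor_right_inv,
      braiding_tensorUnit_left, braiding_tensorUnit_right, braiding_inv_tensorUnit_left,
      braiding_inv_tensorUnit_right, o11, o12, o21, o22, o10, o20, br, bri]; monoidal
theorem sL22 {P Q R T : C} (f : P ⊗ Q ⟶ R ⊗ T) (X Z : C) :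
    X ◁ o22 f Z ≫ br X R (T ⊗ Z) ≫ R ◁ br X T Z =
      br X P (Q ⊗ Z) ≫ P ◁ br X Q Z ≫ o22 f (X ⊗ Z) := by
  trans 𝟙 _ ⊗≫ (X ◁ f ≫ (β_ X (R ⊗ T)).hom) ▷ Z ⊗≫ 𝟙 _
  · simp only [BraidedCategory.braiding_tensor_left_hom, BraidedCategory.braiding_tensor_right_hom,
      BraidedCategory.braiding_tensor_left_inv, BraidedCategory.braiding_tensor_right_inv,
      braiding_tensorUnit_left, braiding_tensorUnit_right, braiding_inv_tensorUnit_left,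
      braiding_inv_tensorUnit_right, o11, o12, o21, o22, o10, o20, br, bri]; monoidal
  · rw [BraidedCategory.braiding_naturality_right]; simp only [BraidedCategory.braiding_tensor_left_hom, BraidedCategory.braiding_tensor_right_hom,
      BraidedCategory.braiding_tensor_left_inv, BraidedCategory.braiding_tensor_right_inv,
      braiding_tensorUnit_left, braiding_tensorUnit_right, braiding_inv_tensorUnit_left,
      braiding_inv_tensorUnit_right, o11, o12, o21, o22, o10, o20, br, bri]; monoidal
theorem siL22 {P Q R T : C} (f : P ⊗ Q ⟶ R ⊗ T) (X Z : C) :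
    X ◁ o22 f Z ≫ bri X R (T ⊗ Z) ≫ R ◁ bri X T Z =
      bri X P (Q ⊗ Z) ≫ P ◁ bri X Q Z ≫ o22 f (X ⊗ Z) := by
  trans 𝟙 _ ⊗≫ (X ◁ f ≫ (β_ (R ⊗ T) X).inv) ▷ Z ⊗≫ 𝟙 _
  · simp only [BraidedCategory.braiding_tensor_left_hom, BraidedCategory.braiding_tensor_right_hom,
      BraidedCategory.braiding_tensor_left_inv, BraidedCategory.braiding_tensor_right_inv,
      braiding_tensorUnit_left, braiding_tensorUnit_right, braiding_inv_tensorUnit_left,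
      braiding_inv_tensorUnit_right, o11, o12, o21, o22, o10, o20, br, bri]; monoidal
  · rw [BraidedCategory.braiding_inv_naturality_right]; simp only [BraidedCategory.braiding_tensor_left_hom, BraidedCategory.braiding_tensor_right_hom,
      BraidedCategory.braiding_tensor_left_inv, BraidedCategory.braiding_tensor_right_inv,
      braiding_tensorUnit_left, braiding_tensorUnit_right, braiding_inv_tensorUnit_left,
      braiding_inv_tensorUnit_right, o11, o12, o21, o22, o10, o20, br, bri]; monoidal
theorem sR10 {P : C} (f : P ⟶ 𝟙_ C) (X Z : C) :
    o10 f (X ⊗ Z) =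
      br P X Z ≫ X ◁ o10 f Z := by
  trans 𝟙 _ ⊗≫ (f ▷ X ≫ (β_ (𝟙_ C) X).hom) ▷ Z ⊗≫ 𝟙 _
  · simp only [BraidedCategory.braiding_tensor_left_hom, BraidedCategory.braiding_tensor_right_hom,
      BraidedCategory.braiding_tensor_left_inv, BraidedCategory.braiding_tensor_right_inv,
      braiding_tensorUnit_left, braiding_tensorUnit_right, braiding_inv_tensorUnit_left,
      braiding_inv_tensorUnit_right, o11, o12, o21, o22, o10, o20, br, bri]; monoidal
  · rw [BraidedCategory.braiding_naturality_left]; simp only [BraidedCategory.braiding_tensor_left_hom, BraidedCategory.braiding_tensor_right_hom,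
      BraidedCategory.braiding_tensor_left_inv, BraidedCategory.braiding_tensor_right_inv,
      braiding_tensorUnit_left, braiding_tensorUnit_right, braiding_inv_tensorUnit_left,
      braiding_inv_tensorUnit_right, o11, o12, o21, o22, o10, o20, br, bri]; monoidal
theorem sL10 {P : C} (f : P ⟶ 𝟙_ C) (X Z : C) :
    X ◁ o10 f Z =
      br X P Z ≫ o10 f (X ⊗ Z) := by
  trans 𝟙 _ ⊗≫ (X ◁ f ≫ (β_ X (𝟙_ C)).hom) ▷ Z ⊗≫ 𝟙 _
  · simp only [BraidedCategory.braiding_tensor_left_hom, BraidedCategory.braiding_tensor_right_hom,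
      BraidedCategory.braiding_tensor_left_inv, BraidedCategory.braiding_tensor_right_inv,
      braiding_tensorUnit_left, braiding_tensorUnit_right, braiding_inv_tensorUnit_left,
      braiding_inv_tensorUnit_right, o11, o12, o21, o22, o10, o20, br, bri]; monoidal
  · rw [BraidedCategory.braiding_naturality_right]; simp only [BraidedCategory.braiding_tensor_left_hom, BraidedCategory.braiding_tensor_right_hom,
      BraidedCategory.braiding_tensor_left_inv, BraidedCategory.braiding_tensor_right_inv,
      braiding_tensorUnit_left, braiding_tensorUnit_right, braiding_inv_tensorUnit_left,
      braiding_inv_tensorUnit_right, o11, o12, o21, o22, o10, o20, br, bri]; monoidal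
theorem sL20 {P Q : C} (f : P ⊗ Q ⟶ 𝟙_ C) (X Z : C) :
    X ◁ o20 f Z =
      br X P (Q ⊗ Z) ≫ P ◁ br X Q Z ≫ o20 f (X ⊗ Z) := by
  trans 𝟙 _ ⊗≫ (X ◁ f ≫ (β_ X (𝟙_ C)).hom) ▷ Z ⊗≫ 𝟙 _
  · simp only [BraidedCategory.braiding_tensor_left_hom, BraidedCategory.braiding_tensor_right_hom,
      BraidedCategory.braiding_tensor_left_inv, BraidedCategory.braiding_tensor_right_inv,
      braiding_tensorUnit_left, braiding_tensorUnit_right, braiding_inv_tensorUnit_left,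
      braiding_inv_tensorUnit_right, o11, o12, o21, o22, o10, o20, br, bri]; monoidal
  · rw [BraidedCategory.braiding_naturality_right]; simp only [BraidedCategory.braiding_tensor_left_hom, BraidedCategory.braiding_tensor_right_hom,
      BraidedCategory.braiding_tensor_left_inv, BraidedCategory.braiding_tensor_right_inv,
      braiding_tensorUnit_left, braiding_tensorUnit_right, braiding_inv_tensorUnit_left,
      braiding_inv_tensorUnit_right, o11, o12, o21, o22, o10, o20, br, bri]; monoidal
end

section
theorem zl22 {P Q R T : C} {F G : P ⊗ Q ⟶ R ⊗ T} (h : F = G) (Z : C) :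
    (α_ P Q Z).inv ≫ F ▷ Z ≫ (α_ R T Z).hom = (α_ P Q Z).inv ≫ G ▷ Z ≫ (α_ R T Z).hom := by rw [h]
theorem zl21 {P Q R : C} {F G : P ⊗ Q ⟶ R} (h : F = G) (Z : C) :
    (α_ P Q Z).inv ≫ F ▷ Z = (α_ P Q Z).inv ≫ G ▷ Z := by rw [h]
theorem zl31 {P Q Q' R : C} {F G : P ⊗ Q ⊗ Q' ⟶ R} (h : F = G) (Z : C) :
    P ◁ (α_ Q Q' Z).inv ≫ (α_ P (Q ⊗ Q') Z).inv ≫ F ▷ Z =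
    P ◁ (α_ Q Q' Z).inv ≫ (α_ P (Q ⊗ Q') Z).inv ≫ G ▷ Z := by rw [h]
theorem zl32 {P Q Q' R T : C} {F G : P ⊗ Q ⊗ Q' ⟶ R ⊗ T} (h : F = G) (Z : C) :
    P ◁ (α_ Q Q' Z).inv ≫ (α_ P (Q ⊗ Q') Z).inv ≫ F ▷ Z ≫ (α_ R T Z).hom =
    P ◁ (α_ Q Q' Z).inv ≫ (α_ P (Q ⊗ Q') Z).inv ≫ G ▷ Z ≫ (α_ R T Z).hom := by rw [h]
theorem zl33 {P Q Q' R T T' : C} {F G : P ⊗ Q ⊗ Q' ⟶ R ⊗ T ⊗ T'} (h : F = G) (Z : C) :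
    P ◁ (α_ Q Q' Z).inv ≫ (α_ P (Q ⊗ Q') Z).inv ≫ F ▷ Z ≫ (α_ R (T ⊗ T') Z).hom ≫ R ◁ (α_ T T' Z).hom =
    P ◁ (α_ Q Q' Z).inv ≫ (α_ P (Q ⊗ Q') Z).inv ≫ G ▷ Z ≫ (α_ R (T ⊗ T') Z).hom ≫ R ◁ (α_ T T' Z).hom := by
  rw [h]
theorem zl12 {P R T : C} {F G : P ⟶ R ⊗ T} (h : F = G) (Z : C) :
    F ▷ Z ≫ (α_ R T Z).hom = G ▷ Z ≫ (α_ R T Z).hom := by rw [h]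
/-- closedness of the class under the monoidal product -/
class YCl (𝒴 : Set C) : Prop where
  unit : 𝟙_ C ∈ 𝒴
  tens : ∀ Y Y' : C, Y ∈ 𝒴 → Y' ∈ 𝒴 → (Y ⊗ Y') ∈ 𝒴
/-- membership as a class -/
class InY (𝒴 : Set C) (X : C) : Prop where
  mem : X ∈ 𝒴
instance inYTensor {𝒴 : Set C} [YCl 𝒴] {X Y : C} [InY 𝒴 X] [InY 𝒴 Y] : InY 𝒴 (X ⊗ Y) :=
  ⟨YCl.tens X Y InY.mem InY.mem⟩
instance inYUnit {𝒴 : Set C} [YCl 𝒴] : InY 𝒴 (𝟙_ C) := ⟨YCl.unit⟩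

theorem o22_comp {P Q R T U W : C} (f : P ⊗ Q ⟶ R ⊗ T) (g : R ⊗ T ⟶ U ⊗ W) (Z : C) :
    o22 (f ≫ g) Z = o22 f Z ≫ o22 g Z := by simp [o22]
theorem o21_comp {P Q R T U : C} (f : P ⊗ Q ⟶ R ⊗ T) (g : R ⊗ T ⟶ U) (Z : C) :
    o21 (f ≫ g) Z = o22 f Z ≫ o21 g Z := by simp [o22, o21]
theorem o21_comp1 {P Q R U : C} (f : P ⊗ Q ⟶ R) (g : R ⟶ U) (Z : C) :
    o21 (f ≫ g) Z = o21 f Z ≫ o11 g Z := by simp [o11, o21]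
theorem o11_comp {P Q R : C} (f : P ⟶ Q) (g : Q ⟶ R) (Z : C) :
    o11 (f ≫ g) Z = o11 f Z ≫ o11 g Z := by simp [o11]

namespace RWMB
variable {A : C} {𝒴 : Set C} (S : RWMB A 𝒴)
def t5 : A ⊗ A ⟶ A ⊗ A := (β_ A A).hom ≫ S.t₄

theorem zm1 (Z : C) : o21 S.m Z = o22 S.t₁ Z ≫ o10 S.j (A ⊗ Z) := by
  rw [S.hm₁]; simp only [o21, o22, o10]; monoidal
theorem zm2 (Z : C) : o21 S.m Z = o22 S.t₂ Z ≫ A ◁ o10 S.j Z := by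
  rw [S.hm₂]; simp only [o21, o22, o10]; monoidal
theorem zm5 (Z : C) : o21 S.m Z = o22 S.t5 Z ≫ A ◁ o10 S.j Z := by
  rw [S.hm₄]; simp only [o21, o22, o10, t5]; monoidal
theorem zc12 (Z : C) : A ◁ o22 S.t₁ Z ≫ o21 S.m (A ⊗ Z) = o22 S.t₂ (A ⊗ Z) ≫ A ◁ o21 S.m Z := by
  convert zl32 S.hc12 Z using 1 <;> (simp only [o21, o22, wl, ml]; monoidal)
theorem zc14 (Z : C) : A ◁ o22 S.t₁ Z ≫ br A A (A ⊗ Z) ≫ o21 S.m (A ⊗ Z)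
    = o22 S.t₄ (A ⊗ Z) ≫ A ◁ o21 S.m Z := by
  convert zl32 S.hc14 Z using 1 <;> (simp only [o21, o22, wl, ml, br]; monoidal)
theorem zc24 (Z : C) : A ◁ o22 S.t₂ Z ≫ br A A (A ⊗ Z) ≫ o21 S.m (A ⊗ Z)
    = br A A (A ⊗ Z) ≫ A ◁ o22 S.t₄ Z ≫ o21 S.m (A ⊗ Z) := by
  convert zl32 S.hc24 Z using 1 <;> (simp only [o21, o22, wl, ml, br]; monoidal)
theorem zi41 (Z : C) : A ◁ o22 S.t₁ Z ≫ o22 S.t₄ (A ⊗ Z) = o22 S.t₄ (A ⊗ Z) ≫ A ◁ o22 S.t₁ Z := by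
  convert zl33 S.hi41 Z using 1 <;> (simp only [o21, o22, wl, ml, br]; monoidal)
theorem zax1 (Z : C) : A ◁ o22 S.t₁ Z ≫ br A A (A ⊗ Z) ≫ A ◁ o22 S.t₁ Z ≫ bri A A (A ⊗ Z) ≫
    o22 S.t₁ (A ⊗ Z) = o22 S.t₁ (A ⊗ Z) ≫ A ◁ o22 S.t₁ Z := by
  convert zl33 S.ax1 Z using 1 <;> (simp only [o21, o22, wl, ml, br, bri]; monoidal)
theorem zax2 (Z : C) : o22 S.e₁ Z ≫ o22 S.e₁ Z = o22 S.e₁ Z := by rw [← o22_comp, S.ax2]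
theorem zax3 (Z : C) : o22 S.t₁ Z ≫ o22 S.e₁ Z = o22 S.t₁ Z := by rw [← o22_comp, S.ax3]
theorem zax5 (Z : C) : A ◁ o22 S.t₁ Z ≫ o22 S.e₁ (A ⊗ Z) = o22 S.e₁ (A ⊗ Z) ≫ A ◁ o22 S.t₁ Z := by
  convert zl33 S.ax5 Z using 1 <;> (simp only [o21, o22, wl, ml, br]; monoidal)
theorem zax6 (Z : C) : o22 S.t₁ (A ⊗ Z) ≫ A ◁ o22 S.e₁ Z
    = A ◁ bri A A Z ≫ o22 S.e₁ (A ⊗ Z) ≫ A ◁ br A A Z ≫ o22 S.t₁ (A ⊗ Z) := by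
  convert zl33 S.ax6 Z using 1 <;> (simp only [o21, o22, wl, ml, br, bri]; monoidal)
theorem zax7 (Z : C) : o22 S.t₁ (A ⊗ Z) ≫ A ◁ o10 S.j (A ⊗ Z) ≫ o21 S.m Z
    = A ◁ br A A Z ≫ A ◁ o22 S.e₁ Z ≫ A ◁ A ◁ o10 S.j Z ≫ o21 S.m Z := by
  convert zl31 S.ax7 Z using 1 <;> (simp only [o21, o22, o10, wl, ml, br, bri]; monoidal)
theorem zax8 (Z : C) : o22 S.t₁ (A ⊗ Z) ≫ A ◁ br A A Z ≫ o21 S.m (A ⊗ Z) ≫ o10 S.j (A ⊗ Z)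
    = A ◁ br A A Z ≫ A ◁ o22 S.e₁ Z ≫ A ◁ o10 S.j (A ⊗ Z) ≫ o21 S.m Z := by
  convert zl31 S.ax8 Z using 1 <;> (simp only [o21, o22, o10, wl, ml, br, bri]; monoidal)
def dd1 (Z : C) : A ⊗ (A ⊗ (A ⊗ Z)) ⟶ A ⊗ (A ⊗ Z) :=
  A ◁ bri A A Z ≫ o22 S.t₁ (A ⊗ Z) ≫ A ◁ br A A Z ≫ o21 S.m (A ⊗ Z)
theorem zax4 (Z : C) : A ◁ o22 S.e₁ Z ≫ S.dd1 Z = S.dd1 Z := by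
  convert zl32 S.ax4 Z using 1 <;> (simp only [o21, o22, o10, wl, ml, br, bri, dd1]; monoidal)

variable [YCl 𝒴] [InY 𝒴 A]
theorem strip {X Y : C} [InY 𝒴 Y] {f g : X ⟶ A ⊗ Y} (h : A ◁ f ≫ o21 S.m Y = A ◁ g ≫ o21 S.m Y) :
    f = g := S.ndl X Y InY.mem h
end RWMB

end

section
/-- operation on the first and third strands -/
def x13 {P Q R T : C} (f : P ⊗ Q ⟶ R ⊗ T) (X Z : C) : P ⊗ (X ⊗ (Q ⊗ Z)) ⟶ R ⊗ (X ⊗ (T ⊗ Z)) :=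
  P ◁ bri X Q Z ≫ o22 f (X ⊗ Z) ≫ R ◁ br T X Z
theorem x13_alt {P Q R T : C} (f : P ⊗ Q ⟶ R ⊗ T) (X Z : C) :
    x13 f X Z = br P X (Q ⊗ Z) ≫ X ◁ o22 f Z ≫ bri X R (T ⊗ Z) := by
  have h := siL22 f X Z
  have h2 := br P X (Q ⊗ Z) ≫= h =≫ (R ◁ br T X Z)
  simpa [x13] using h2.symm
namespace RWMB
variable {A : C} {𝒴 : Set C} (S : RWMB A 𝒴)
theorem dd1_eq (Z : C) : S.dd1 Z = x13 S.t₁ A Z ≫ o21 S.m (A ⊗ Z) := by simp [dd1, x13]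
theorem M1 (Z : C) : o21 S.m (A ⊗ Z) ≫ o22 S.t₁ Z = A ◁ o22 S.t₁ Z ≫ S.dd1 Z := by
  have h := S.zax1 Z =≫ o10 S.j _
  simp only [Category.assoc, ← zm1] at h
  rw [S.zm1 (A ⊗ Z), Category.assoc, ex10_0, ← h, dd1_eq, x13_alt]
  simp only [Category.assoc]
theorem ax8d (Z : C) : S.dd1 Z ≫ o10 S.j (A ⊗ Z) = A ◁ o22 S.e₁ Z ≫ A ◁ o10 S.j (A ⊗ Z) ≫ o21 S.m Z := by
  have h := A ◁ bri A A Z ≫= S.zax8 Z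
  simp only [dd1, Category.assoc, h, bri_br_1']
theorem ax7d (Z : C) : S.dd1 Z ≫ A ◁ o10 S.j Z = A ◁ o22 S.e₁ Z ≫ A ◁ A ◁ o10 S.j Z ≫ o21 S.m Z := by
  have h := A ◁ bri A A Z ≫= S.zax7 Z
  have h2 := congrArg (fun t => A ◁ bri A A Z ≫ o22 S.t₁ (A ⊗ Z) ≫ A ◁ t ≫ o21 S.m Z) (sR10 S.j A Z)
  simp at h h2
  simp [dd1, ← h, h2]
theorem massoc (Z : C) : o21 S.m (A ⊗ Z) ≫ o21 S.m Z = A ◁ o21 S.m Z ≫ o21 S.m Z := by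
  have h := S.M1 Z =≫ o10 S.j _
  simp only [Category.assoc, ax8d] at h
  rw [← zm1] at h
  rw [h, ← whiskerLeft_comp_assoc, S.zax3, ← whiskerLeft_comp_assoc, ← zm1]
/-- multiplication after crossing -/
theorem B1 [YCl 𝒴] [InY 𝒴 A] : (β_ A A).hom ≫ S.m = (β_ A A).inv ≫ S.m := by
  have key : A ◁ (br A A (𝟙_ C) ≫ o21 S.m (𝟙_ C)) ≫ o21 S.m (𝟙_ C) =
      A ◁ (bri A A (𝟙_ C) ≫ o21 S.m (𝟙_ C)) ≫ o21 S.m (𝟙_ C) := by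
    have h := bri A A _ ≫= S.zc24 (𝟙_ C) =≫ (A ◁ o10 S.j _)
    have h1 := bri A A _ ≫= (sL21 S.m A (𝟙_ C)) =≫ o21 S.m _
    have e4 : o22 S.t₄ (𝟙_ C) ≫ A ◁ o10 S.j (𝟙_ C) = bri A A (𝟙_ C) ≫ o21 S.m (𝟙_ C) := by
      rw [zm5, t5, o22_comp]
      have := bri_br_0' (P := A) (Q := A) (Z := 𝟙_ C) (o22 S.t₄ (𝟙_ C) ≫ A ◁ o10 S.j (𝟙_ C))
      rw [← this]; simp [br]
    have e2 := congrArg (fun t => bri A A _ ≫ A ◁ t ≫ br A A _ ≫ o21 S.m _) (S.zm2 (𝟙_ C))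
    have e4' := congrArg (fun t => A ◁ t ≫ o21 S.m _) e4
    simp at h h1 e2 e4'
    simp [← e4', ← h, ← e2, massoc, h1]
  have h := S.strip key
  have h' : o21 ((β_ A A).hom ≫ S.m) (𝟙_ C) = o21 ((β_ A A).inv ≫ S.m) (𝟙_ C) := by
    rw [o21_comp, o21_comp]; exact h
  simpa [o21] using h'
theorem zB1 [YCl 𝒴] [InY 𝒴 A] (Z : C) : br A A Z ≫ o21 S.m Z = bri A A Z ≫ o21 S.m Z := by
  simpa only [o21_comp, br, bri] using congrArg (fun t => o21 t Z) S.B1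
end RWMB

end

section
theorem YB (X P Q Z : C) : X ◁ br P Q Z ≫ br X Q (P ⊗ Z) ≫ Q ◁ br X P Z =
    br X P (Q ⊗ Z) ≫ P ◁ br X Q Z ≫ br P Q (X ⊗ Z) := sL22 (β_ P Q).hom X Z
theorem ndr_aux (B A Y : C) : (β_ (B ⊗ (A ⊗ Y)) A).inv ≫ (α_ B (A ⊗ Y) A).hom ≫ B ◁ (α_ A Y A).hom ≫
    B ◁ A ◁ (β_ Y A).hom = bri A B (A ⊗ Y) ≫ B ◁ bri A A Y := by
  simp [BraidedCategory.braiding_tensor_left_inv, bri, o22]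
namespace RWMB
variable {A : C} {𝒴 : Set C} (S : RWMB A 𝒴) [YCl 𝒴] [InY 𝒴 A]
theorem NDRm {X B Y : C} [InY 𝒴 B] [InY 𝒴 Y] {f g : X ⟶ B ⊗ (A ⊗ Y)}
    (h : f ▷ A ≫ (α_ B (A ⊗ Y) A).hom ≫ B ◁ (α_ A Y A).hom ≫ B ◁ A ◁ (β_ Y A).hom ≫ B ◁ o21 S.m Y
      = g ▷ A ≫ (α_ B (A ⊗ Y) A).hom ≫ B ◁ (α_ A Y A).hom ≫ B ◁ A ◁ (β_ Y A).hom ≫ B ◁ o21 S.m Y) :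
    f = g := by
  have key : ∀ f : X ⟶ B ⊗ (A ⊗ Y), A ◁ (f ≫ br B A Y) ≫ br A A _ ≫ o21 S.m (B ⊗ Y) =
      (β_ X A).inv ≫ (f ▷ A ≫ (α_ B (A ⊗ Y) A).hom ≫ B ◁ (α_ A Y A).hom ≫ B ◁ A ◁ (β_ Y A).hom ≫
        B ◁ o21 S.m Y) ≫ br B A Y := by
    intro f
    rw [Category.assoc, ← BraidedCategory.braiding_inv_naturality_right_assoc]
    have e1 := ndr_aux B A Y =≫ (B ◁ o21 S.m Y ≫ br B A Y)
    simp only [Category.assoc] at e1 ⊢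
    rw [e1]
    have e2 := congrArg (fun t => bri A B _ ≫ B ◁ t ≫ br B A Y) (S.zB1 Y)
    have e3 := congrArg (fun t => bri A B _ ≫ B ◁ br A A Y ≫ t) (sL21 S.m B Y)
    have e4 := congrArg (fun t => bri A B _ ≫ t ≫ o21 S.m _) (YB B A A Y)
    simp at e2 e3 e4 ⊢
    rw [← e2, e3, e4]
  have h1 : A ◁ (f ≫ br B A Y) ≫ br A A _ ≫ o21 S.m (B ⊗ Y)
      = A ◁ (g ≫ br B A Y) ≫ br A A _ ≫ o21 S.m (B ⊗ Y) := by rw [key, key, h]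
  have h2 := S.ndr X (B ⊗ Y) InY.mem (a₁ := f ≫ br B A Y) (a₂ := g ≫ br B A Y)
    (by simpa [br, o22, o21] using h1)
  have h3 := h2 =≫ bri A B Y
  simpa using h3
theorem NDR {X B : C} [InY 𝒴 B] {f g : X ⟶ B ⊗ A}
    (h : f ▷ A ≫ (α_ B A A).hom ≫ B ◁ S.m = g ▷ A ≫ (α_ B A A).hom ≫ B ◁ S.m) : f = g := by
  have e : f ≫ B ◁ (ρ_ A).inv = g ≫ B ◁ (ρ_ A).inv := by
    apply S.NDRm
    have h' := h =≫ B ◁ (ρ_ A).inv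
    convert h' using 1 <;> (simp only [o21, braiding_tensorUnit_left]; monoidal)
  have e' := e =≫ B ◁ (ρ_ A).hom
  simpa using e'
theorem zB15 (Z : C) : S.dd1 Z = o22 S.t5 (A ⊗ Z) ≫ A ◁ o21 S.m Z := by
  rw [dd1_eq, x13_alt, t5, o22_comp]
  simp only [Category.assoc]
  rw [← zc14, ← zB1]; rfl
theorem HI (Z : C) : x13 S.t₁ A Z ≫ o22 S.t5 (A ⊗ Z) = o22 S.t5 (A ⊗ Z) ≫ A ◁ o22 S.t₁ Z := by
  have h := br A A _ ≫= S.zi41 Z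
  rw [x13_alt, t5, o22_comp]
  have h2 := bri_br_0' (P := A) (Q := A) (Z := A ⊗ Z) (o22 S.t₄ (A ⊗ Z))
  simp only [Category.assoc, br] at h h2 ⊢
  rw [h2, h]
theorem RLt1 (Z : C) [InY 𝒴 Z] : A ◁ o21 S.m Z ≫ o22 S.t₁ Z = o22 S.t₁ (A ⊗ Z) ≫ A ◁ o21 S.m Z := by
  apply S.strip
  have h := S.zc12 (A ⊗ Z) =≫ A ◁ o21 S.m Z
  have h2 := A ◁ A ◁ o21 S.m Z ≫= S.zc12 Z
  have h3 := o22 S.t₂ _ ≫= congrArg (fun t => A ◁ t) (S.massoc Z)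
  simp at h h2 h3 ⊢
  rw [h2, ← h3, h]
/-- the pairing multiplication on two pairs of strands -/
def star (Z : C) : A ⊗ (A ⊗ (A ⊗ (A ⊗ Z))) ⟶ A ⊗ (A ⊗ Z) :=
  A ◁ br A A (A ⊗ Z) ≫ o21 S.m _ ≫ A ◁ o21 S.m Z
theorem zhe (Z : C) : A ◁ A ◁ o22 S.e₁ Z ≫ S.star Z = o22 S.e₂ _ ≫ S.star Z := by
  have h := congrArg (fun t => (α_ _ _ _).inv ≫ (α_ _ _ _).inv ≫ t ▷ Z ≫ (α_ _ _ _).hom) S.hecomp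
  have h' := (A ◁ A ◁ (α_ A A Z).inv) ≫= h
  convert h' using 1 <;> (simp only [o21, o22, midSw, star, br]; monoidal)
end RWMB

end

section
def o32 {P Q Q' R T : C} (f : P ⊗ (Q ⊗ Q') ⟶ R ⊗ T) (Z : C) : P ⊗ (Q ⊗ (Q' ⊗ Z)) ⟶ R ⊗ (T ⊗ Z) :=
  P ◁ (α_ Q Q' Z).inv ≫ (α_ P (Q ⊗ Q') Z).inv ≫ f ▷ Z ≫ (α_ R T Z).hom
def o33 {P Q Q' R T T' : C} (f : P ⊗ (Q ⊗ Q') ⟶ R ⊗ (T ⊗ T')) (Z : C) :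
    P ⊗ (Q ⊗ (Q' ⊗ Z)) ⟶ R ⊗ (T ⊗ (T' ⊗ Z)) :=
  P ◁ (α_ Q Q' Z).inv ≫ (α_ P (Q ⊗ Q') Z).inv ≫ f ▷ Z ≫ (α_ R (T ⊗ T') Z).hom ≫ R ◁ (α_ T T' Z).hom
theorem x13_comp {P Q R T U W : C} (f : P ⊗ Q ⟶ R ⊗ T) (g : R ⊗ T ⟶ U ⊗ W) (X Z : C) :
    x13 (f ≫ g) X Z = x13 f X Z ≫ x13 g X Z := by simp [x13, o22_comp]
/-- `x13` past a multiplication of the two middle strands -/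
theorem x13_m {P Q R T X Y W : C} (f : P ⊗ Q ⟶ R ⊗ T) (h : X ⊗ Y ⟶ W) (Z : C) :
    P ◁ o21 h (Q ⊗ Z) ≫ x13 f W Z = P ◁ X ◁ bri Y Q Z ≫ x13 f X (Y ⊗ Z) ≫ R ◁ X ◁ br T Y Z ≫
      R ◁ o21 h (T ⊗ Z) := by
  have h1 := congrArg (fun t => P ◁ t ≫ o22 f _ ≫ R ◁ br T W Z) (siR21 h Q Z)
  have h2 := congrArg (fun t => P ◁ X ◁ bri Y Q Z ≫ P ◁ bri X Q _ ≫ o22 f _ ≫ R ◁ t) (sL21 h T Z)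
  simp [x13] at h1 h2 ⊢
  rw [h1, ← h2]
namespace RWMB
variable {A : C} {𝒴 : Set C} (S : RWMB A 𝒴) [YCl 𝒴] [InY 𝒴 A]
theorem NDR22 {P Q B : C} [InY 𝒴 B] {f g : P ⊗ Q ⟶ B ⊗ A}
    (h : o22 f (A ⊗ 𝟙_ C) ≫ B ◁ o21 S.m (𝟙_ C) = o22 g (A ⊗ 𝟙_ C) ≫ B ◁ o21 S.m (𝟙_ C)) : f = g := by
  apply S.NDR
  have h' := congrArg (fun t => (α_ P Q A).hom ≫ P ◁ Q ◁ (ρ_ A).inv ≫ t ≫ B ◁ (ρ_ A).hom) h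
  convert h' using 1 <;> (simp only [o22, o21]; monoidal)
theorem NDR32 {P Q R B : C} [InY 𝒴 B] {f g : P ⊗ (Q ⊗ R) ⟶ B ⊗ A}
    (h : o32 f (A ⊗ 𝟙_ C) ≫ B ◁ o21 S.m (𝟙_ C) = o32 g (A ⊗ 𝟙_ C) ≫ B ◁ o21 S.m (𝟙_ C)) : f = g := by
  apply S.NDR
  have h' := congrArg (fun t => (α_ P (Q ⊗ R) A).hom ≫ P ◁ (α_ Q R A).hom ≫
    P ◁ Q ◁ R ◁ (ρ_ A).inv ≫ t ≫ B ◁ (ρ_ A).hom) h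
  convert h' using 1 <;> (simp only [o32, o21]; monoidal)
theorem NDR33 {P Q R B Y : C} [InY 𝒴 B] [InY 𝒴 Y] {f g : P ⊗ (Q ⊗ R) ⟶ B ⊗ (A ⊗ Y)}
    (h : o33 f (A ⊗ 𝟙_ C) ≫ B ◁ A ◁ br Y A (𝟙_ C) ≫ B ◁ o21 S.m (Y ⊗ 𝟙_ C)
      = o33 g (A ⊗ 𝟙_ C) ≫ B ◁ A ◁ br Y A (𝟙_ C) ≫ B ◁ o21 S.m (Y ⊗ 𝟙_ C)) : f = g := by
  apply S.NDRm
  have h' := congrArg (fun t => (α_ P (Q ⊗ R) A).hom ≫ P ◁ (α_ Q R A).hom ≫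
    P ◁ Q ◁ R ◁ (ρ_ A).inv ≫ t ≫ B ◁ A ◁ (ρ_ Y).hom) h
  convert h' using 1 <;> (simp only [o33, o21, o22, br]; monoidal)
theorem star_nd {X Z : C} [InY 𝒴 Z] {f g : X ⟶ A ⊗ (A ⊗ Z)}
    (h : A ◁ A ◁ f ≫ S.star Z = A ◁ A ◁ g ≫ S.star Z) : f = g := by
  have e1 : A ◁ f ≫ br A A (A ⊗ Z) ≫ A ◁ o21 S.m Z = A ◁ g ≫ br A A (A ⊗ Z) ≫ A ◁ o21 S.m Z := by
    apply S.strip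
    simpa [star] using h
  have e2 : f ≫ bri A A Z = g ≫ bri A A Z := by
    apply S.strip
    have key : ∀ f : X ⟶ A ⊗ (A ⊗ Z), A ◁ (f ≫ bri A A Z) ≫ o21 S.m (A ⊗ Z) =
        (A ◁ f ≫ br A A (A ⊗ Z) ≫ A ◁ o21 S.m Z) ≫ bri A A Z := by
      intro f
      have := congrArg (fun t => A ◁ f ≫ A ◁ bri A A Z ≫ t ≫ bri A A Z) (sR21 S.m A Z)
      simp at this ⊢
      rw [this]
    rw [key, key, e1]
  simpa using e2 =≫ br A A Z
theorem star_m2 (Z : C) : S.star (A ⊗ Z) ≫ A ◁ o21 S.m Z = A ◁ A ◁ A ◁ o21 S.m Z ≫ S.star Z := by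
  have := congrArg (fun t => A ◁ br A A _ ≫ o21 S.m _ ≫ A ◁ t) (S.massoc Z)
  simp [star] at this ⊢
  rw [this]
theorem RL2 (Z : C) [InY 𝒴 Z] : A ◁ o21 S.m Z ≫ o22 S.e₁ Z = o22 S.e₁ (A ⊗ Z) ≫ A ◁ o21 S.m Z := by
  apply S.star_nd
  have h1 := A ◁ A ◁ A ◁ o21 S.m Z ≫= S.zhe Z
  have h2 := S.zhe (A ⊗ Z) =≫ A ◁ o21 S.m Z
  have h3 := o22 S.e₂ _ ≫= S.star_m2 Z
  have h4 := A ◁ A ◁ o22 S.e₁ (A ⊗ Z) ≫= S.star_m2 Z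
  simp only [Category.assoc, whiskerLeft_comp] at *
  rw [h1, ← h4, h2, h3, ex22_0']
theorem starM (Z : C) : A ◁ A ◁ o21 S.m (A ⊗ Z) ≫ S.star Z =
    A ◁ A ◁ A ◁ bri A A Z ≫ S.star (A ⊗ Z) ≫ A ◁ br A A Z ≫ o21 S.m (A ⊗ Z) := by
  have h1 := congrArg (fun t => A ◁ t ≫ o21 S.m _ ≫ A ◁ o21 S.m _) (sL21 S.m A (A ⊗ Z))
  have h2 := congrArg (fun t => A ◁ A ◁ A ◁ bri A A Z ≫ A ◁ br A A _ ≫ A ◁ A ◁ t ≫ o21 S.m _ ≫ o21 S.m _) (sR21 S.m A Z)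
  have h3 := congrArg (fun t => A ◁ br A A _ ≫ A ◁ A ◁ br A A _ ≫ t ≫ A ◁ o21 S.m _) (S.massoc (A ⊗ (A ⊗ Z)))
  simp [star] at h1 h2 h3 ⊢
  rw [h1, h2, h3]
theorem RL1 (Z : C) [InY 𝒴 Z] : o21 S.m (A ⊗ Z) ≫ o22 S.e₁ Z = x13 S.e₁ A Z ≫ o21 S.m (A ⊗ Z) := by
  apply S.star_nd
  have h1 := A ◁ A ◁ o21 S.m _ ≫= S.zhe Z
  have h2 := A ◁ A ◁ A ◁ bri A A Z ≫= S.zhe (A ⊗ Z) =≫ (A ◁ br A A Z ≫ o21 S.m (A ⊗ Z))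
  have h3 := o22 S.e₂ _ ≫= S.starM Z
  have h4 := (A ◁ A ◁ x13 S.e₁ A Z) ≫= S.starM Z
  simp only [Category.assoc, whiskerLeft_comp, x13] at *
  simp only [Category.assoc, whiskerLeft_comp, br_bri_3', br_bri_3] at h4
  rw [h1, h4, h2, ← ex22_0', h3]
  simp
theorem dd1_e1 (Z : C) [InY 𝒴 Z] : S.dd1 Z ≫ o22 S.e₁ Z = S.dd1 Z := by
  rw [dd1_eq, Category.assoc, RL1, ← Category.assoc, ← x13_comp, S.ax3]
theorem E5 : S.t5 ≫ S.e₁ = S.t5 := by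
  apply S.NDR22
  have h := S.dd1_e1 (𝟙_ C)
  rw [zB15, Category.assoc, RL2] at h
  simp only [o22_comp, Category.assoc, h]
theorem zE5 (Z : C) : o22 S.t5 Z ≫ o22 S.e₁ Z = o22 S.t5 Z := by rw [← o22_comp, E5]
theorem Md (Z : C) : o21 S.m (A ⊗ (A ⊗ Z)) ≫ S.dd1 Z = A ◁ S.dd1 Z ≫ S.dd1 Z := by
  have h1 := congrArg (fun t => A ◁ A ◁ bri A A Z ≫ t ≫ A ◁ br A A Z ≫ o21 S.m _) (S.M1 (A ⊗ Z))
  have h2 := congrArg (fun t => A ◁ A ◁ bri A A Z ≫ A ◁ o22 S.t₁ _ ≫ A ◁ A ◁ br A A Z ≫ t ≫ o21 S.m _)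
    (x13_m S.t₁ S.m (X := A) (Y := A) Z)
  have h3 := congrArg (fun t => A ◁ A ◁ bri A A Z ≫ A ◁ o22 S.t₁ _ ≫ x13 S.t₁ A _ ≫ A ◁ A ◁ br A A Z ≫ t)
    (S.massoc (A ⊗ Z))
  simp [dd1, x13] at h1 h2 h3 ⊢
  rw [h1, h2, h3]
end RWMB

end

section
namespace RWMB
variable {A : C} {𝒴 : Set C} (S : RWMB A 𝒴) [YCl 𝒴] [InY 𝒴 A]
theorem M5p : ml S.m ≫ S.t5 = A ◁ S.t5 ≫ wl S.t5 ≫ A ◁ S.m := by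
  apply S.NDR32
  have e1 : ∀ Z : C, o32 (ml S.m ≫ S.t5) Z = o21 S.m (A ⊗ Z) ≫ o22 S.t5 Z := by
    intro Z; simp only [o32, o21, o22, ml]; monoidal
  have e2 : ∀ Z : C, o32 (A ◁ S.t5 ≫ wl S.t5 ≫ A ◁ S.m) Z =
      A ◁ o22 S.t5 Z ≫ o22 S.t5 (A ⊗ Z) ≫ A ◁ o21 S.m Z := by
    intro Z; simp only [o32, o21, o22, wl]; monoidal
  rw [e1, e2]
  have h := S.Md (𝟙_ C)
  have h2 := congrArg (fun t => A ◁ o22 S.t5 _ ≫ o22 S.t5 _ ≫ A ◁ t) (S.massoc (𝟙_ C))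
  simp [zB15] at h h2 ⊢
  rw [h, h2]
theorem M5 (Z : C) : o21 S.m (A ⊗ Z) ≫ o22 S.t5 Z = A ◁ o22 S.t5 Z ≫ o22 S.t5 (A ⊗ Z) ≫ A ◁ o21 S.m Z := by
  convert congrArg (fun t => o32 t Z) S.M5p using 1 <;> (simp only [o32, o21, o22, wl, ml]; monoidal)
theorem c24p : A ◁ S.t5 ≫ ml S.m = wl S.t₂ ≫ A ◁ (β_ A A).hom ≫ ml S.m := by
  apply S.NDR32
  have e1 : ∀ Z : C, o32 (A ◁ S.t5 ≫ ml S.m) Z = A ◁ o22 S.t5 Z ≫ o21 S.m (A ⊗ Z) := by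
    intro Z; simp only [o32, o21, o22, ml]; monoidal
  have e2 : ∀ Z : C, o32 (wl S.t₂ ≫ A ◁ (β_ A A).hom ≫ ml S.m) Z =
      o22 S.t₂ (A ⊗ Z) ≫ A ◁ br A A Z ≫ o21 S.m (A ⊗ Z) := by
    intro Z; simp only [o32, o21, o22, wl, ml, br]; monoidal
  rw [e1, e2]
  have h1 := congrArg (fun t => A ◁ t ≫ o21 S.m _) (S.zB15 (𝟙_ C))
  have h2 := congrArg (fun t => A ◁ A ◁ bri A A _ ≫ A ◁ o22 S.t₁ _ ≫ A ◁ A ◁ br A A _ ≫ t) (S.massoc (A ⊗ 𝟙_ C))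
  have h3 := congrArg (fun t => A ◁ A ◁ bri A A _ ≫ t ≫ A ◁ br A A _ ≫ o21 S.m _) (S.zc12 (A ⊗ 𝟙_ C))
  have h4 := congrArg (fun t => A ◁ A ◁ bri A A _ ≫ o22 S.t₂ _ ≫ A ◁ t ≫ o21 S.m _) (sR21 S.m A (𝟙_ C))
  simp [dd1] at h1 h2 h3 h4 ⊢
  rw [← h1, ← h2, h3, h4]
theorem c24 (Z : C) : A ◁ o22 S.t5 Z ≫ o21 S.m (A ⊗ Z) = o22 S.t₂ (A ⊗ Z) ≫ A ◁ br A A Z ≫ o21 S.m (A ⊗ Z) := by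
  convert congrArg (fun t => o32 t Z) S.c24p using 1 <;> (simp only [o32, o21, o22, wl, ml, br]; monoidal)
theorem B12p : wl S.t₂ ≫ A ◁ S.e₁ = A ◁ S.e₁ ≫ wl S.t₂ := by
  apply S.NDR33
  have e1 : ∀ Z : C, o33 (wl S.t₂ ≫ A ◁ S.e₁) Z = o22 S.t₂ (A ⊗ Z) ≫ A ◁ o22 S.e₁ Z := by
    intro Z; simp only [o33, o21, o22, wl]; monoidal
  have e2 : ∀ Z : C, o33 (A ◁ S.e₁ ≫ wl S.t₂) Z = A ◁ o22 S.e₁ Z ≫ o22 S.t₂ (A ⊗ Z) := by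
    intro Z; simp only [o33, o21, o22, wl]; monoidal
  rw [e1, e2]
  have h1 := congrArg (fun t => o22 S.t₂ _ ≫ A ◁ A ◁ br A A _ ≫ A ◁ t) (S.RL1 (𝟙_ C))
  have h2 := congrArg (fun t => A ◁ A ◁ br A A _ ≫ t ≫ A ◁ o22 S.e₁ _) (S.zc12 (A ⊗ 𝟙_ C))
  have h3 := congrArg (fun t => A ◁ o22 S.e₁ _ ≫ A ◁ A ◁ br A A _ ≫ t) (S.zc12 (A ⊗ 𝟙_ C))
  have h4 := congrArg (fun t => A ◁ A ◁ br A A _ ≫ A ◁ t ≫ o21 S.m _) (S.zax6 (𝟙_ C))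
  simp [x13] at h1 h2 h3 h4 ⊢
  rw [← h1, ← h2, h4, h3]
theorem B12 (Z : C) : o22 S.t₂ (A ⊗ Z) ≫ A ◁ o22 S.e₁ Z = A ◁ o22 S.e₁ Z ≫ o22 S.t₂ (A ⊗ Z) := by
  convert congrArg (fun t => o33 t Z) S.B12p using 1 <;> (simp only [o33, o21, o22, wl, ml, br]; monoidal)
end RWMB

end

section
/-- regular epimorphisms as a class -/
class REpi {X Y : C} (f : X ⟶ Y) : Prop where
  re : Nonempty (RegularEpi f)
/-- regular epimorphisms are stable -/
class PresRE (C : Type u) [Category.{v} C] [MonoidalCategory C] : Prop where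
  wl : ∀ {X Y : C} (W : C) (f : X ⟶ Y), Nonempty (RegularEpi f) → Nonempty (RegularEpi (W ◁ f))
  wr : ∀ {X Y : C} (W : C) (f : X ⟶ Y), Nonempty (RegularEpi f) → Nonempty (RegularEpi (f ▷ W))
  comp : ∀ {X Y Z : C} (f : X ⟶ Y) (g : Y ⟶ Z),
      Nonempty (RegularEpi f) → Nonempty (RegularEpi g) → Nonempty (RegularEpi (f ≫ g))
instance repiEpi {X Y : C} (f : X ⟶ Y) [h : REpi f] : Epi f :=
  h.re.elim fun r => r.epi
theorem REpi.of_split {X Y : C} (f : X ⟶ Y) (g : Y ⟶ X) (h : g ≫ f = 𝟙 Y) : REpi f :=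
  ⟨⟨@RegularEpi.ofSplitEpi _ _ _ _ f ⟨⟨⟨g, h⟩⟩⟩⟩⟩
instance repiWl [PresRE C] {X Y : C} (f : X ⟶ Y) [h : REpi f] (W : C) : REpi (W ◁ f) :=
  ⟨PresRE.wl W f h.re⟩
theorem repiWr [PresRE C] {X Y : C} (f : X ⟶ Y) [h : REpi f] (W : C) : REpi (f ▷ W) :=
  ⟨PresRE.wr W f h.re⟩
theorem repiComp [PresRE C] {X Y Z : C} (f : X ⟶ Y) (g : Y ⟶ Z) [h : REpi f] [h' : REpi g] : REpi (f ≫ g) :=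
  ⟨PresRE.comp f g h.re h'.re⟩
theorem repiIso {X Y : C} (f : X ⟶ Y) [IsIso f] : REpi f := REpi.of_split f (inv f) (by simp)
instance repi11 [PresRE C] {P Q : C} (f : P ⟶ Q) [REpi f] (Z : C) : REpi (o11 f Z) := repiWr f Z
instance repi21 [PresRE C] {P Q R : C} (f : P ⊗ Q ⟶ R) [REpi f] (Z : C) : REpi (o21 f Z) :=
  haveI := repiWr f Z
  haveI := repiIso (α_ P Q Z).inv
  repiComp _ _
/-- the data of the base object -/
structure LH {A : C} {𝒴 : Set C} (S : RWMB A 𝒴) {L : C} (p : A ⟶ L) (n₁ : L ⊗ A ⟶ A) (n₂ : A ⊗ L ⟶ A)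
    (μ : L ⊗ L ⟶ L) (δ : L ⟶ L ⊗ L) (ε : L ⟶ 𝟙_ C) (τ : A ⟶ L ⊗ A) (τbar : A ⟶ A ⊗ L) : Prop where
  hpc : S.piL1 ≫ p = S.piBarR1c ≫ p
  hn₁ : (p ▷ A) ≫ n₁ = S.piL1
  hndn₁ : NdRightOn n₁ 𝒴
  hn₂ : (A ◁ p) ≫ n₂ = S.piL2
  hμ : (L ◁ p) ≫ μ = n₁ ≫ p
  hδ : S.m ≫ p ≫ δ = S.t₁ ≫ (p ▷ A) ≫ (L ◁ p)
  hε : p ≫ ε = S.j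
  hμδ : δ ≫ μ = 𝟙 L
  hτ : S.m ≫ τ = S.t₁ ≫ (p ▷ A)
  hτbar : S.m ≫ τbar = (β_ A A).hom ≫ S.t₄ ≫ (A ◁ p)
namespace LH
variable {A : C} {𝒴 : Set C} {S : RWMB A 𝒴} {L : C} {p : A ⟶ L} {n₁ : L ⊗ A ⟶ A} {n₂ : A ⊗ L ⟶ A}
    {μ : L ⊗ L ⟶ L} {δ : L ⟶ L ⊗ L} {ε : L ⟶ 𝟙_ C} {τ : A ⟶ L ⊗ A} {τbar : A ⟶ A ⊗ L}
    (H : LH S p n₁ n₂ μ δ ε τ τbar)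
include H
theorem zpc (Z : C) : o22 S.e₁ Z ≫ o10 S.j (A ⊗ Z) ≫ o11 p Z = o22 S.e₁ Z ≫ A ◁ o10 S.j Z ≫ o11 p Z := by
  convert zl21 H.hpc Z using 1 <;> (simp only [o11, o21, o22, o10, RWMB.piL1, RWMB.piBarR1c]; monoidal)
theorem zn1 (Z : C) : o11 p (A ⊗ Z) ≫ o21 n₁ Z = o22 S.e₁ Z ≫ o10 S.j (A ⊗ Z) := by
  convert zl21 H.hn₁ Z using 1 <;> (simp only [o11, o21, o22, o10, RWMB.piL1]; monoidal)
theorem zn2 (Z : C) : A ◁ o11 p Z ≫ o21 n₂ Z = o22 S.t5 Z ≫ o10 S.j (A ⊗ Z) := by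
  convert zl21 H.hn₂ Z using 1 <;> (simp only [o11, o21, o22, o10, RWMB.piL2, RWMB.t5]; monoidal)
theorem zmu (Z : C) : L ◁ o11 p Z ≫ o21 μ Z = o21 n₁ Z ≫ o11 p Z := by
  convert zl21 H.hμ Z using 1 <;> (simp only [o11, o21]; monoidal)
theorem zdel (Z : C) : o21 S.m Z ≫ o11 p Z ≫ o12 δ Z = o22 S.t₁ Z ≫ o11 p (A ⊗ Z) ≫ L ◁ o11 p Z := by
  convert zl22 H.hδ Z using 1 <;> (simp only [o11, o12, o22, o21]; monoidal)
theorem zeps (Z : C) : o11 p Z ≫ o10 ε Z = o10 S.j Z := by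
  rw [← H.hε]; simp [o11, o10]
theorem zmd (Z : C) : o12 δ Z ≫ o21 μ Z = 𝟙 _ := by
  have : o12 δ Z ≫ o21 μ Z = (δ ≫ μ) ▷ Z := by simp [o12, o21]
  rw [this, H.hμδ]; simp
theorem ztau (Z : C) : o21 S.m Z ≫ o12 τ Z = o22 S.t₁ Z ≫ o11 p (A ⊗ Z) := by
  convert zl22 H.hτ Z using 1 <;> (simp only [o11, o12, o22, o21]; monoidal)
theorem ztb (Z : C) : o21 S.m Z ≫ o12 τbar Z = o22 S.t5 Z ≫ A ◁ o11 p Z := by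
  convert zl22 H.hτbar Z using 1 <;> (simp only [o11, o12, o22, o21, RWMB.t5]; monoidal)
theorem stripn {X Y : C} [InY 𝒴 Y] {f g : X ⟶ L ⊗ Y}
    (h : A ◁ f ≫ br A L Y ≫ o21 n₁ Y = A ◁ g ≫ br A L Y ≫ o21 n₁ Y) : f = g :=
  H.hndn₁ X Y InY.mem (by simpa [br, o22, o21] using h)
variable [YCl 𝒴] [InY 𝒴 A] [InY 𝒴 L]
theorem NDL {X B : C} [InY 𝒴 B] {f g : X ⟶ B ⊗ L}
    (h : f ▷ A ≫ (α_ B L A).hom ≫ B ◁ n₁ = g ▷ A ≫ (α_ B L A).hom ≫ B ◁ n₁) : f = g := by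
  have key : ∀ f : X ⟶ B ⊗ L, A ◁ (f ≫ B ◁ (ρ_ L).inv ≫ bri B L (𝟙_ C)) ≫ br A L _ ≫ o21 n₁ _ =
      (β_ A X).hom ≫ (f ▷ A ≫ (α_ B L A).hom ≫ B ◁ n₁) ≫ B ◁ (ρ_ A).inv ≫ bri B A _ := by
    intro f
    rw [Category.assoc, ← BraidedCategory.braiding_naturality_right_assoc]
    have h1 : (β_ A (B ⊗ L)).hom ≫ ((α_ B L A).hom ≫ B ◁ n₁) ≫ B ◁ (ρ_ A).inv ≫ bri B A _ =
        A ◁ B ◁ (ρ_ L).inv ≫ br A B _ ≫ B ◁ br A L _ ≫ B ◁ o21 n₁ _ ≫ bri B A _ := by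
      simp only [BraidedCategory.braiding_tensor_right_hom, o21, br, bri, o22]; monoidal
    rw [h1]
    have h2 := congrArg (fun t => A ◁ f ≫ A ◁ B ◁ (ρ_ L).inv ≫ br A B _ ≫ B ◁ br A L _ ≫ t) (siL21 n₁ B (𝟙_ C))
    have h3 := congrArg (fun t => A ◁ f ≫ A ◁ B ◁ (ρ_ L).inv ≫ br A B _ ≫ t ≫ o21 n₁ _) (siL22 (β_ A L).hom B (𝟙_ C))
    change _ = A ◁ f ≫ A ◁ B ◁ (ρ_ L).inv ≫ br A B _ ≫ (bri B A _ ≫ A ◁ bri B L _ ≫ br A L _) ≫ o21 n₁ _ at h3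
    change A ◁ f ≫ A ◁ B ◁ (ρ_ L).inv ≫ br A B _ ≫ (B ◁ br A L _ ≫ bri B L _ ≫ L ◁ bri B A _) ≫ o21 n₁ _ = _ at h3
    simp only [Category.assoc, whiskerLeft_comp, br_bri_0'] at h2 h3 ⊢
    rw [h2, h3]
  have h1 := H.stripn (f := f ≫ B ◁ (ρ_ L).inv ≫ bri B L (𝟙_ C)) (g := g ≫ B ◁ (ρ_ L).inv ≫ bri B L (𝟙_ C))
    (by rw [key, key, h])
  simpa using h1 =≫ (br L B _ ≫ B ◁ (ρ_ L).hom)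
variable [PresRE C] [REpi S.m] [REpi p]
theorem star (Z : C) [InY 𝒴 Z] : o22 S.e₁ Z = o12 τbar (A ⊗ Z) ≫ A ◁ o21 n₁ Z := by
  rw [← cancel_epi (o21 S.m (A ⊗ Z))]
  apply S.strip
  have h1 := congrArg (fun t => A ◁ t ≫ o21 S.m _) (S.RL1 Z)
  have h2 := congrArg (fun t => A ◁ t ≫ A ◁ A ◁ o21 n₁ _ ≫ o21 S.m _) (H.ztb (A ⊗ Z))
  have h3 := congrArg (fun t => A ◁ o22 S.t5 _ ≫ A ◁ A ◁ t ≫ o21 S.m _) (H.zn1 Z)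
  have h4 := S.c24 (A ⊗ Z) =≫ (A ◁ o22 S.e₁ Z ≫ A ◁ o10 S.j (A ⊗ Z))
  have h5 := congrArg (fun t => o22 S.t₂ _ ≫ A ◁ t ≫ A ◁ br A A _ ≫ A ◁ A ◁ o10 S.j _ ≫ o21 S.m _) (x13_alt S.e₁ A Z)
  have h6 := congrArg (fun t => A ◁ A ◁ bri A A Z ≫ t ≫ A ◁ A ◁ br A A Z ≫ A ◁ o10 S.j _ ≫ o21 S.m _)
    (S.B12 (A ⊗ Z))
  have h7 := congrArg (fun t => o22 S.t₂ _ ≫ A ◁ x13 S.e₁ A Z ≫ A ◁ t ≫ o21 S.m _) (sR10 S.j A (A ⊗ Z))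
  have h8 := congrArg (fun t => A ◁ x13 S.e₁ A Z ≫ t ≫ o21 S.m _) (S.zm2 (A ⊗ (A ⊗ Z)))
  have h9 := congrArg (fun t => A ◁ x13 S.e₁ A Z ≫ t) (S.massoc (A ⊗ Z))
  simp [x13] at h1 h2 h3 h4 h5 h6 h7 h8 h9 ⊢
  rw [h1, h2, h3, h4, ← h5, ← h7, h6, ← h8, h9]
end LH

end

section
theorem ybi (P Q X Z : C) : bri P Q (X ⊗ Z) ≫ Q ◁ bri P X Z ≫ bri Q X (P ⊗ Z) =
    P ◁ bri Q X Z ≫ bri P X (Q ⊗ Z) ≫ X ◁ bri P Q Z := siR22 (β_ Q P).inv X Z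
theorem ybl (X P Q Z : C) : X ◁ bri P Q Z ≫ br X Q (P ⊗ Z) ≫ Q ◁ br X P Z =
    br X P (Q ⊗ Z) ≫ P ◁ br X Q Z ≫ bri P Q (X ⊗ Z) := sL22 (β_ Q P).inv X Z
namespace LH
variable {A : C} {𝒴 : Set C} {S : RWMB A 𝒴} {L : C} {p : A ⟶ L} {n₁ : L ⊗ A ⟶ A} {n₂ : A ⊗ L ⟶ A}
    {μ : L ⊗ L ⟶ L} {δ : L ⟶ L ⊗ L} {ε : L ⟶ 𝟙_ C} {τ : A ⟶ L ⊗ A} {τbar : A ⟶ A ⊗ L}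
    (H : LH S p n₁ n₂ μ δ ε τ τbar) [YCl 𝒴] [InY 𝒴 A] [InY 𝒴 L]
include H
theorem P1 (Z : C) : o22 S.t₁ Z ≫ A ◁ o10 S.j Z ≫ o11 p Z = o21 S.m Z ≫ o11 p Z := by
  have h1 := S.zax3 Z =≫ (o10 S.j (A ⊗ Z) ≫ o11 p Z)
  have h2 := S.zax3 Z =≫ (A ◁ o10 S.j Z ≫ o11 p Z)
  have h3 := o22 S.t₁ Z ≫= H.zpc Z
  have h4 := S.zm1 Z =≫ o11 p Z
  simp at h1 h2 h3 h4 ⊢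
  rw [h4, ← h1, h3, h2]
theorem P5 (Z : C) : o22 S.t5 Z ≫ o10 S.j (A ⊗ Z) ≫ o11 p Z = o21 S.m Z ≫ o11 p Z := by
  have h1 := S.zE5 Z =≫ (o10 S.j (A ⊗ Z) ≫ o11 p Z)
  have h2 := S.zE5 Z =≫ (A ◁ o10 S.j Z ≫ o11 p Z)
  have h3 := o22 S.t5 Z ≫= H.zpc Z
  have h4 := S.zm5 Z =≫ o11 p Z
  simp at h1 h2 h3 h4 ⊢
  rw [h4, ← h1, h3, h2]
theorem n2p (Z : C) : A ◁ o11 p Z ≫ o21 n₂ Z ≫ o11 p Z = o21 S.m Z ≫ o11 p Z := by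
  rw [← H.P5]
  have h := H.zn2 Z =≫ o11 p Z
  simp at h ⊢
  rw [h]
theorem n2m [PresRE C] [REpi p] (Z : C) : o21 n₂ (A ⊗ Z) ≫ o21 S.m Z = A ◁ o21 n₁ Z ≫ o21 S.m Z := by
  rw [← cancel_epi (A ◁ o11 p (A ⊗ Z))]
  have h1 := H.zn2 (A ⊗ Z) =≫ o21 S.m Z
  have h2 := S.zB15 Z =≫ o10 S.j (A ⊗ Z)
  have h3 := S.ax8d Z
  have h4 := congrArg (fun t => A ◁ t ≫ o21 S.m Z) (H.zn1 Z)
  simp at h1 h2 h3 h4 ⊢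
  rw [h1, h4, ← h3, h2]
variable [PresRE C] [REpi S.m] [REpi p]
theorem pd1 (Z : C) : o11 p Z ≫ o12 δ Z = o12 τ Z ≫ L ◁ o11 p Z := by
  rw [← cancel_epi (o21 S.m Z)]
  have h1 := H.ztau Z =≫ L ◁ o11 p Z
  have h2 := H.zdel Z
  simp at h1 h2 ⊢
  rw [h1, h2]
theorem NDL12 {P B : C} [InY 𝒴 B] {f g : P ⟶ B ⊗ L}
    (h : o12 f (A ⊗ 𝟙_ C) ≫ B ◁ o21 n₁ (𝟙_ C) = o12 g (A ⊗ 𝟙_ C) ≫ B ◁ o21 n₁ (𝟙_ C)) : f = g := by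
  apply H.NDL
  have h' := congrArg (fun t => P ◁ (ρ_ A).inv ≫ t ≫ B ◁ (ρ_ A).hom) h
  convert h' using 1 <;> (simp only [o12, o21]; monoidal)
theorem pd2 (Z : C) : o11 p Z ≫ o12 δ Z = o12 τbar Z ≫ o11 p (L ⊗ Z) := by
  have key : p ≫ δ = τbar ≫ p ▷ L := by
    apply H.NDL12
    have e1 : ∀ Z : C, o12 (p ≫ δ) Z = o11 p Z ≫ o12 δ Z := by intro Z; simp only [o11, o12]; monoidal
    have e2 : ∀ Z : C, o12 (τbar ≫ p ▷ L) Z = o12 τbar Z ≫ o11 p (L ⊗ Z) := by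
      intro Z; simp only [o11, o12]; monoidal
    rw [e1, e2, H.pd1, ← cancel_epi (o21 S.m (A ⊗ 𝟙_ C))]
    have h1 := H.ztau (A ⊗ 𝟙_ C) =≫ (L ◁ o11 p _ ≫ L ◁ o21 n₁ _)
    have h2 := congrArg (fun t => o22 S.t₁ _ ≫ A ◁ t ≫ o11 p _) (H.zn1 (𝟙_ C))
    have h3 := S.zax6 (𝟙_ C) =≫ (A ◁ o10 S.j _ ≫ o11 p _)
    have h4 := congrArg (fun t => o21 S.m _ ≫ t ≫ o11 p _) (H.star (𝟙_ C))
    have h5 := congrArg (fun t => t ≫ o11 p _) (S.RL1 (𝟙_ C))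
    have h6 := congrArg (fun t => x13 S.e₁ A (𝟙_ C) ≫ t) (H.P1 (A ⊗ 𝟙_ C))
    simp [x13] at h1 h2 h3 h4 h5 h6 ⊢
    rw [h1, h2, h3, h6, ← h5, h4]
  convert zl12 key Z using 1 <;> (simp only [o11, o12]; monoidal)
theorem taum (Z : C) [InY 𝒴 Z] : o21 S.m Z ≫ o12 τ Z = o12 τ (A ⊗ Z) ≫ L ◁ o21 S.m Z := by
  rw [← cancel_epi (o21 S.m (A ⊗ Z))]
  have h1 := S.massoc Z =≫ o12 τ Z
  have h2 := A ◁ o21 S.m Z ≫= H.ztau Z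
  have h3 := S.RLt1 Z =≫ o11 p _
  have h4 := H.ztau (A ⊗ Z) =≫ L ◁ o21 S.m Z
  simp at h1 h2 h3 h4 ⊢
  rw [h1, h2, h3, h4]
theorem tauc (Z : C) : o12 τ Z ≫ o10 ε (A ⊗ Z) = 𝟙 _ := by
  rw [← cancel_epi (o21 S.m Z)]
  have h1 := H.ztau Z =≫ o10 ε (A ⊗ Z)
  have h2 := o22 S.t₁ Z ≫= H.zeps (A ⊗ Z)
  have h3 := S.zm1 Z
  simp at h1 h2 h3 ⊢
  rw [h1, h2, h3]
theorem tbc (Z : C) : o12 τbar Z ≫ A ◁ o10 ε Z = 𝟙 _ := by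
  rw [← cancel_epi (o21 S.m Z)]
  have h1 := H.ztb Z =≫ A ◁ o10 ε Z
  have h2 := congrArg (fun t => o22 S.t5 Z ≫ A ◁ t) (H.zeps Z)
  have h3 := S.zm5 Z
  simp at h1 h2 h3 ⊢
  rw [h1, h2, h3]
theorem bal (Z : C) : S.dd1 Z ≫ o12 τbar (A ⊗ Z) = S.dd1 Z ≫ A ◁ o12 τ Z := by
  have h1 := S.dd1_eq Z =≫ o12 τbar (A ⊗ Z)
  have h2 := x13 S.t₁ A Z ≫= H.ztb (A ⊗ Z)
  have h3 := S.HI Z =≫ A ◁ o11 p (A ⊗ Z)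
  have h4 := congrArg (fun t => o22 S.t5 _ ≫ A ◁ t) (H.ztau Z)
  have h5 := S.zB15 Z =≫ A ◁ o12 τ Z
  simp only [Category.assoc, whiskerLeft_comp] at h1 h2 h3 h4 h5 ⊢
  rw [h1, h2, h3, h5, h4]
theorem tauco (Z : C) : o12 τ Z ≫ o12 δ (A ⊗ Z) = o12 τ Z ≫ L ◁ o12 τ Z := by
  rw [← cancel_epi (o21 S.m Z), ← cancel_epi (o21 S.m (A ⊗ Z))]
  have h1 := o21 S.m (A ⊗ Z) ≫= H.ztau Z =≫ o12 δ (A ⊗ Z)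
  have h1' := o21 S.m (A ⊗ Z) ≫= H.ztau Z =≫ L ◁ o12 τ Z
  have h2 := S.M1 Z =≫ (o11 p _ ≫ o12 δ (A ⊗ Z))
  have h2' := S.M1 Z =≫ (A ◁ o12 τ Z ≫ o11 p _)
  have h3 := congrArg (fun t => A ◁ o22 S.t₁ _ ≫ S.dd1 Z ≫ t) (H.pd2 (A ⊗ Z))
  have h4 := congrArg (fun t => A ◁ o22 S.t₁ _ ≫ t ≫ o11 p _) (H.bal Z)
  simp at h1 h1' h2 h2' h3 h4 ⊢
  rw [h1, h1', h2, h2', h3, h4]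
theorem tbco (Z : C) : o12 τbar Z ≫ A ◁ o12 δ Z = o12 τbar Z ≫ o12 τbar (L ⊗ Z) := by
  rw [← cancel_epi (o21 S.m Z), ← cancel_epi (o21 S.m (A ⊗ Z))]
  have h1 := o21 S.m (A ⊗ Z) ≫= H.ztb Z =≫ A ◁ o12 δ Z
  have h1' := o21 S.m (A ⊗ Z) ≫= H.ztb Z =≫ o12 τbar (L ⊗ Z)
  have h2 := S.M5 Z =≫ (o12 τbar (A ⊗ Z) ≫ A ◁ L ◁ o11 p Z)
  have h2' := S.M5 Z =≫ (A ◁ o12 τ Z ≫ A ◁ L ◁ o11 p _)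
  have h3 := congrArg (fun t => o21 S.m (A ⊗ Z) ≫ o22 S.t5 Z ≫ A ◁ t) (H.pd1 Z)
  have h4 := congrArg (fun t => A ◁ o22 S.t5 _ ≫ t ≫ A ◁ L ◁ o11 p _) (H.bal Z)
  simp [RWMB.zB15] at h1 h1' h2 h2' h3 h4 ⊢
  rw [h1, h1', h2, h3, h2', h4]
theorem e1tau (Z : C) [InY 𝒴 Z] : o22 S.e₁ Z ≫ o12 τ (A ⊗ Z) = o12 τ (A ⊗ Z) ≫ L ◁ o22 S.e₁ Z := by
  rw [← cancel_epi (o21 S.m (A ⊗ Z))]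
  have h1 := S.RL1 Z =≫ o12 τ _
  have h2 := x13 S.e₁ A Z ≫= H.ztau (A ⊗ Z)
  have h3 := S.zax6 Z =≫ o11 p _
  have h4 := H.ztau (A ⊗ Z) =≫ L ◁ o22 S.e₁ Z
  simp [x13] at h1 h2 h3 h4 ⊢
  rw [h1, h2, h4, h3]
theorem NDL13 {P B B' : C} [InY 𝒴 B] [InY 𝒴 B'] {f g : P ⟶ B ⊗ (B' ⊗ L)}
    (h : o12 f (A ⊗ 𝟙_ C) ≫ B ◁ ((α_ B' L (A ⊗ 𝟙_ C)).hom ≫ B' ◁ o21 n₁ (𝟙_ C)) =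
      o12 g (A ⊗ 𝟙_ C) ≫ B ◁ ((α_ B' L (A ⊗ 𝟙_ C)).hom ≫ B' ◁ o21 n₁ (𝟙_ C))) : f = g := by
  rw [← cancel_mono (α_ B B' L).inv]
  apply H.NDL12
  have h' := congrArg (fun t => t ≫ (α_ B B' _).inv) h
  convert h' using 1 <;> (simp only [o12, o21]; monoidal)
theorem bico : τbar ≫ τ ▷ L ≫ (α_ L A L).hom = τ ≫ L ◁ τbar := by
  apply H.NDL13
  have e1 : ∀ Z, o12 (τbar ≫ τ ▷ L ≫ (α_ L A L).hom) Z ≫ L ◁ (α_ A L Z).hom = o12 τbar Z ≫ o12 τ (L ⊗ Z) := by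
    intro Z; simp only [o12]; monoidal
  have e2 : ∀ Z, o12 (τ ≫ L ◁ τbar) Z ≫ L ◁ (α_ A L Z).hom = o12 τ Z ≫ L ◁ o12 τbar Z := by
    intro Z; simp only [o12]; monoidal
  simp only [whiskerLeft_comp, reassoc_of% e1, reassoc_of% e2]
  have h1 := H.star (𝟙_ C) =≫ o12 τ _
  have h2 := congrArg (fun t => o12 τ _ ≫ L ◁ t) (H.star (𝟙_ C))
  have h3 := H.e1tau (𝟙_ C)
  simp at h1 h2 h3 ⊢
  rw [← h1, h3, h2]
theorem delco (Z : C) : o12 δ Z ≫ o12 δ (L ⊗ Z) = o12 δ Z ≫ L ◁ o12 δ Z := by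
  rw [← cancel_epi (o11 p Z)]
  have h1 := H.pd1 Z =≫ o12 δ (L ⊗ Z)
  have h2 := H.tauco Z =≫ L ◁ L ◁ o11 p Z
  have h3 := congrArg (fun t => o12 τ Z ≫ L ◁ t) (H.pd1 Z)
  have h4 := H.pd1 Z =≫ L ◁ o12 δ Z
  simp at h1 h2 h3 h4 ⊢
  rw [h1, h2, h4, h3]
theorem delc1 (Z : C) : o12 δ Z ≫ o10 ε (L ⊗ Z) = 𝟙 _ := by
  rw [← cancel_epi (o11 p Z)]
  have h1 := H.pd1 Z =≫ o10 ε (L ⊗ Z)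
  have h2 := H.tauc Z =≫ o11 p Z
  simp at h1 h2 ⊢
  rw [h1, h2]
theorem delc2 (Z : C) : o12 δ Z ≫ L ◁ o10 ε Z = 𝟙 _ := by
  rw [← cancel_epi (o11 p Z)]
  have h1 := H.pd2 Z =≫ L ◁ o10 ε Z
  have h2 := H.tbc Z =≫ o11 p Z
  simp at h1 h2 ⊢
  rw [h1, h2]
theorem E1 (Z : C) [InY 𝒴 Z] : o21 n₁ Z ≫ o12 τ Z = L ◁ o12 τ Z ≫ o21 μ (A ⊗ Z) := by
  rw [← cancel_epi (L ◁ o21 S.m Z), ← cancel_epi (o11 p (A ⊗ A ⊗ Z))]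
  have h1 := A ◁ o21 S.m Z ≫= H.zn1 Z =≫ o12 τ Z
  have h2 := S.RL2 Z =≫ (A ◁ o12 τ Z ≫ o10 S.j _)
  have h3 := congrArg (fun t => o22 S.e₁ _ ≫ A ◁ t ≫ o10 S.j _) (H.ztau Z)
  have h4 := S.zax5 Z =≫ (A ◁ o11 p _ ≫ o10 S.j _)
  have h5 := A ◁ o22 S.t₁ Z ≫= H.zn1 (A ⊗ Z) =≫ (o11 p _)
  have h6 := congrArg (fun t => o11 p _ ≫ L ◁ t ≫ o21 μ _) (H.ztau Z)
  have h7 := congrArg (fun t => A ◁ o22 S.t₁ Z ≫ o11 p _ ≫ t) (H.zmu (A ⊗ Z))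
  simp at h1 h2 h3 h4 h5 h6 h7 ⊢
  rw [h1, h2, h3, ← h4, h6, h7, h5]
theorem E3 (Z : C) [InY 𝒴 Z] : L ◁ o12 τ Z ≫ o21 μ (A ⊗ Z) = o12 δ (A ⊗ Z) ≫ L ◁ o21 n₁ Z := by
  rw [← cancel_epi (L ◁ o21 S.m Z), ← cancel_epi (o11 p (A ⊗ A ⊗ Z))]
  have h5 := A ◁ o22 S.t₁ Z ≫= H.zn1 (A ⊗ Z) =≫ (o11 p _)
  have h6 := congrArg (fun t => o11 p _ ≫ L ◁ t ≫ o21 μ _) (H.ztau Z)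
  have h7 := congrArg (fun t => A ◁ o22 S.t₁ Z ≫ o11 p _ ≫ t) (H.zmu (A ⊗ Z))
  have h1 := A ◁ o22 S.t₁ Z ≫= H.zpc (A ⊗ Z)
  have h2 := S.zax5 Z =≫ (A ◁ o10 S.j _ ≫ o11 p _)
  have h3 := congrArg (fun t => o22 S.e₁ _ ≫ A ◁ t ≫ o11 p _) (S.zm1 Z)
  have h4 := S.RL2 Z =≫ o11 p _
  have h8 := congrArg (fun t => A ◁ o21 S.m Z ≫ t ≫ o11 p _) (H.star Z)
  have h9 := congrArg (fun t => A ◁ o21 S.m Z ≫ t ≫ L ◁ o21 n₁ _) (H.pd2 (A ⊗ Z))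
  simp at h1 h2 h3 h4 h5 h6 h7 h8 h9 ⊢
  rw [h6, h7, h5, h1, h2, ← h3, ← h4, h8, h9]
theorem F1 (Z : C) [InY 𝒴 Z] : o21 μ Z ≫ o12 δ Z = L ◁ o12 δ Z ≫ o21 μ (L ⊗ Z) := by
  rw [← cancel_epi (L ◁ o11 p Z)]
  have h1 := H.zmu Z =≫ o12 δ Z
  have h2 := o21 n₁ Z ≫= H.pd1 Z
  have h3 := H.E1 Z =≫ L ◁ o11 p Z
  have h4 := congrArg (fun t => L ◁ t ≫ o21 μ _) (H.pd1 Z)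
  simp at h1 h2 h3 h4 ⊢
  rw [h1, h2, h4, h3]
theorem F2 (Z : C) [InY 𝒴 Z] : L ◁ o12 δ Z ≫ o21 μ (L ⊗ Z) = o12 δ (L ⊗ Z) ≫ L ◁ o21 μ Z := by
  rw [← cancel_epi (L ◁ o11 p Z)]
  have h3 := H.E3 Z =≫ L ◁ o11 p Z
  have h4 := congrArg (fun t => L ◁ t ≫ o21 μ _) (H.pd1 Z)
  have h5 := congrArg (fun t => o12 δ _ ≫ L ◁ t) (H.zmu Z)
  simp at h3 h4 h5 ⊢
  rw [h4, h3, h5]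
theorem n1s (Z : C) [InY 𝒴 Z] : o21 n₁ Z = L ◁ o12 τ Z ≫ o21 μ (A ⊗ Z) ≫ o10 ε (A ⊗ Z) := by
  have h1 := H.E1 Z =≫ o10 ε _
  have h2 := o21 n₁ Z ≫= H.tauc Z
  simp at h1 h2 ⊢
  rw [← h1, h2]
theorem Tt1 (Z : C) [InY 𝒴 Z] : o22 S.t₁ Z ≫ o12 τ (A ⊗ Z) = o12 τ (A ⊗ Z) ≫ L ◁ o22 S.t₁ Z := by
  rw [← cancel_epi (o21 S.m (A ⊗ Z))]
  have h1 := S.M1 Z =≫ o12 τ _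
  have h2 := A ◁ o22 S.t₁ Z ≫= S.dd1_eq Z =≫ o12 τ _
  have h3 := A ◁ o22 S.t₁ Z ≫= x13 S.t₁ A Z ≫= H.ztau (A ⊗ Z)
  have h4 := A ◁ o22 S.t₁ Z ≫= x13_alt S.t₁ A Z =≫ (o22 S.t₁ _ ≫ o11 p _)
  have h5 := S.zax1 Z =≫ o11 p _
  have h6 := H.ztau (A ⊗ Z) =≫ L ◁ o22 S.t₁ Z
  simp only [Category.assoc] at h1 h2 h3 h4 h5 h6
  rw [h1, h2, h3, h4, h5, h6]
  simp
theorem Td (Z : C) [InY 𝒴 Z] : S.dd1 Z ≫ o12 τ (A ⊗ Z) = o12 τ _ ≫ L ◁ S.dd1 Z := by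
  have h1 := x13 S.t₁ A Z ≫= H.taum (A ⊗ Z)
  have h2 := congrArg (fun t => A ◁ bri A A Z ≫ t ≫ L ◁ A ◁ br A A Z ≫ L ◁ o21 S.m _) (H.Tt1 (A ⊗ Z))
  simp [RWMB.dd1_eq, x13] at h1 h2 ⊢
  rw [h1, h2]
theorem dd1_e (Z : C) : S.dd1 (A ⊗ Z) ≫ A ◁ o22 S.e₁ Z =
    A ◁ A ◁ bri A A Z ≫ A ◁ bri A A (A ⊗ Z) ≫ o22 S.e₁ _ ≫ A ◁ br A A (A ⊗ Z) ≫ A ◁ A ◁ br A A Z ≫ S.dd1 (A ⊗ Z) := by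
  have h1 := congrArg (fun t => A ◁ bri A A (A ⊗ Z) ≫ o22 S.t₁ _ ≫ A ◁ t ≫ A ◁ br A A _ ≫ o21 S.m _) (x13_alt S.e₁ A Z)
  have h2 := congrArg (fun t => A ◁ bri A A (A ⊗ Z) ≫ A ◁ A ◁ bri A A Z ≫ t ≫ A ◁ A ◁ br A A Z ≫ A ◁ br A A _ ≫ o21 S.m _) (S.zax6 (A ⊗ Z))
  have h3 := congrArg (fun t => A ◁ t ≫ o22 S.e₁ _ ≫ A ◁ br A A (A ⊗ Z) ≫ A ◁ A ◁ br A A Z ≫ o22 S.t₁ _ ≫ A ◁ br A A _ ≫ o21 S.m _)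
    (ybi A A A Z)
  have h4 := congrArg (fun t => A ◁ A ◁ bri A A Z ≫ A ◁ bri A A (A ⊗ Z) ≫ o22 S.e₁ _ ≫ A ◁ t ≫ o22 S.t₁ _ ≫ A ◁ br A A _ ≫ o21 S.m _)
    (ybl A A A Z)
  simp [RWMB.dd1, x13] at h1 h2 h3 h4 ⊢
  rw [← h1, h2, h3, h4]
theorem Tdb (Z : C) : S.dd1 Z ≫ A ◁ o12 τbar Z = o12 τbar _ ≫ A ◁ br L A _ ≫ A ◁ A ◁ br L A Z ≫ S.dd1 (L ⊗ Z) := by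
  have key : dOne S.m S.t₁ ≫ A ◁ τbar = τbar ▷ (A ⊗ A) ≫ (α_ A L _).hom ≫ A ◁ (β_ L (A ⊗ A)).hom ≫ (α_ A _ L).inv ≫
      dOne S.m S.t₁ ▷ L ≫ (α_ A A L).hom := by
    apply H.NDL13
    have e1 : ∀ Z, o12 (dOne S.m S.t₁ ≫ A ◁ τbar) Z ≫ A ◁ (α_ A L Z).hom =
        (α_ A (A ⊗ A) Z).hom ≫ A ◁ (α_ A A Z).hom ≫ S.dd1 Z ≫ A ◁ o12 τbar Z := by
      intro Z; simp only [o12, o22, o21, RWMB.dd1, br, bri, dOne, wl, ml]; monoidal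
    have e2 : ∀ Z, o12 (τbar ▷ (A ⊗ A) ≫ (α_ A L _).hom ≫ A ◁ (β_ L (A ⊗ A)).hom ≫ (α_ A _ L).inv ≫
      dOne S.m S.t₁ ▷ L ≫ (α_ A A L).hom) Z ≫ A ◁ (α_ A L Z).hom = (α_ A (A ⊗ A) Z).hom ≫ A ◁ (α_ A A Z).hom ≫
        o12 τbar _ ≫ A ◁ br L A _ ≫ A ◁ A ◁ br L A Z ≫ S.dd1 (L ⊗ Z) := by
      intro Z
      simp only [BraidedCategory.braiding_tensor_right_hom, o12, o22, o21, RWMB.dd1, br, bri, dOne, wl, ml]; monoidal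
    simp only [whiskerLeft_comp, reassoc_of% e1, reassoc_of% e2]
    have h1 := congrArg (fun t => S.dd1 _ ≫ A ◁ t) (H.star (𝟙_ C))
    have h2 := H.dd1_e (𝟙_ C)
    have h3 := congrArg (fun t => A ◁ A ◁ bri A A _ ≫ A ◁ bri A A _ ≫ t ≫ A ◁ br A A _ ≫ A ◁ A ◁ br A A _ ≫ S.dd1 _)
      (H.star (A ⊗ (A ⊗ 𝟙_ C)))
    have h4 := congrArg (fun t => A ◁ A ◁ bri A A _ ≫ A ◁ bri A A _ ≫ o12 τbar _ ≫ A ◁ t ≫ A ◁ A ◁ br A A _ ≫ S.dd1 _)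
      (sR21 n₁ A (A ⊗ 𝟙_ C))
    have h5 := congrArg (fun t => A ◁ A ◁ bri A A _ ≫ o12 τbar _ ≫ A ◁ br L A _ ≫ A ◁ A ◁ t ≫ S.dd1 _)
      (sR21 n₁ A (𝟙_ C))
    simp [RWMB.dd1] at h1 h2 h3 h4 h5 ⊢
    rw [← h1, h2, h3, h4, h5]
  convert congrArg (fun t => A ◁ (α_ A A Z).inv ≫ (α_ A (A ⊗ A) Z).inv ≫ o12 t Z ≫ A ◁ (α_ A L Z).hom) key using 1 <;>
   (simp only [BraidedCategory.braiding_tensor_right_hom, o12, o22, o21, RWMB.dd1, br, bri, dOne, wl, ml]; monoidal)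
end LH

end

section
namespace RWMB
variable {A : C} {𝒴 : Set C} (S : RWMB A 𝒴)
/-- the morphism `dTwo` in right-normed form -/
def dd2 (Z : C) : A ⊗ (A ⊗ (A ⊗ Z)) ⟶ A ⊗ (A ⊗ Z) :=
  bri A A (A ⊗ Z) ≫ A ◁ o22 S.t₂ Z ≫ br A A (A ⊗ Z) ≫ A ◁ o21 S.m Z
theorem dd2_eq (Z : C) : S.dd2 Z = o32 (dTwo S.m S.t₂) Z := by
  simp only [dd2, o32, dTwo, wl, br, bri, o22, o21]; monoidal
theorem dd1_eq32 (Z : C) : S.dd1 Z = o32 (dOne S.m S.t₁) Z := by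
  simp only [dd1, o32, dOne, wl, ml, br, bri, o22, o21]; monoidal
variable [YCl 𝒴] [InY 𝒴 A]
theorem Dd (Z : C) : A ◁ A ◁ S.dd1 Z ≫ S.star Z = S.dd2 (A ⊗ A ⊗ Z) ≫ S.star Z := by
  have h1 := congrArg (fun t => bri A A _ ≫ A ◁ o22 S.t₂ _ ≫ br A A _ ≫ A ◁ t ≫ o21 S.m _ ≫ A ◁ o21 S.m _) (sR21 S.m A (A ⊗ Z))
  have h2 := congrArg (fun t => bri A A _ ≫ A ◁ o22 S.t₂ _ ≫ br A A _ ≫ A ◁ A ◁ br A A (A ⊗ Z) ≫ A ◁ br A A _ ≫ o21 S.m _ ≫ A ◁ t) (S.massoc Z)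
  have h3 := congrArg (fun t => A ◁ A ◁ A ◁ bri A A Z ≫ A ◁ A ◁ o22 S.t₁ _ ≫ A ◁ A ◁ A ◁ br A A Z ≫ A ◁ t ≫ o21 S.m _ ≫ A ◁ o21 S.m _) (sL21 S.m A (A ⊗ Z))
  have h4 := congrArg (fun t => A ◁ A ◁ A ◁ bri A A Z ≫ A ◁ A ◁ o22 S.t₁ _ ≫ A ◁ A ◁ A ◁ br A A Z ≫ A ◁ br A A _ ≫ A ◁ A ◁ br A A _ ≫ t ≫ A ◁ o21 S.m _) (S.massoc (A ⊗ (A ⊗ Z)))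
  have h5 := congrArg (fun t => A ◁ A ◁ A ◁ bri A A Z ≫ A ◁ A ◁ o22 S.t₁ _ ≫ A ◁ A ◁ A ◁ br A A Z ≫ bri A A _ ≫ t ≫ A ◁ br A A _ ≫ o21 S.m _ ≫ A ◁ o21 S.m _) (sL21 S.m A (A ⊗ (A ⊗ Z)))
  have h6 := congrArg (fun t => bri A A _ ≫ A ◁ A ◁ A ◁ bri A A Z ≫ A ◁ t ≫ A ◁ A ◁ br A A Z ≫ br A A _ ≫ A ◁ br A A _ ≫ o21 S.m _ ≫ A ◁ o21 S.m _) (S.zc12 (A ⊗ Z))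
  have h7 := congrArg (fun t => bri A A _ ≫ A ◁ o22 S.t₂ _ ≫ A ◁ A ◁ A ◁ bri A A Z ≫ A ◁ A ◁ t ≫ br A A _ ≫ A ◁ br A A _ ≫ o21 S.m _ ≫ A ◁ o21 S.m _) (sR21 S.m A Z)
  simp [dd1, dd2, RWMB.star] at h1 h2 h3 h4 h5 h6 h7 ⊢
  rw [h1, h2, h3, ← h4, ← h5, h6, h7]
theorem starR {X : C} {f g : X ⟶ A ⊗ A}
    (h : o12 f (A ⊗ A ⊗ 𝟙_ C) ≫ S.star (𝟙_ C) = o12 g (A ⊗ A ⊗ 𝟙_ C) ≫ S.star (𝟙_ C)) : f = g := by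
  have h1 : f ▷ A ≫ (α_ A A A).hom ≫ A ◁ (β_ A A).hom ≫ (α_ A A A).inv ≫ S.m ▷ A =
      g ▷ A ≫ (α_ A A A).hom ≫ A ◁ (β_ A A).hom ≫ (α_ A A A).inv ≫ S.m ▷ A := by
    apply S.NDR
    have h' := congrArg (fun t => (α_ X A A).hom ≫ X ◁ A ◁ (ρ_ A).inv ≫ t ≫ A ◁ (ρ_ A).hom) h
    convert h' using 1 <;> (simp only [o12, o21, RWMB.star, br, o22]; monoidal)
  rw [← cancel_mono (λ_ (A ⊗ A)).inv]
  apply S.NDRm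
  have h' := congrArg (fun t => t ≫ (λ_ _).inv) h1
  convert h' using 1 <;> (simp only [o21]; monoidal)
theorem e2e2 : S.e₂ ≫ S.e₂ = S.e₂ := by
  apply S.starR
  have e1 : ∀ f g : A ⊗ A ⟶ A ⊗ A, ∀ Z, o12 (f ≫ g) Z = (α_ A A Z).hom ≫ o22 f Z ≫ o22 g Z := by
    intro f g Z; simp only [o12, o22]; monoidal
  have e2 : ∀ f : A ⊗ A ⟶ A ⊗ A, ∀ Z, o12 f Z = (α_ A A Z).hom ≫ o22 f Z := by
    intro f Z; simp only [o12, o22]; monoidal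
  rw [e1, e2]
  have h1 := o22 S.e₂ _ ≫= S.zhe (𝟙_ C)
  have h2 := congrArg (fun t => A ◁ A ◁ t ≫ S.star _) (S.zax2 (𝟙_ C))
  have h3 := A ◁ A ◁ o22 S.e₁ _ ≫= S.zhe (𝟙_ C)
  have h4 := S.zhe (𝟙_ C)
  simp only [Category.assoc, whiskerLeft_comp] at h1 h2 h3 h4 ⊢
  have h5 : o22 S.e₂ _ ≫ A ◁ A ◁ o22 S.e₁ (𝟙_ C) ≫ S.star (𝟙_ C) = A ◁ A ◁ o22 S.e₁ (𝟙_ C) ≫ o22 S.e₂ _ ≫ S.star (𝟙_ C) := by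
    simp only [ex22_0']
  have k := h1.symm.trans (h5.trans (h3.symm.trans (h2.trans h4)))
  rw [k]
theorem e2d2 : S.e₂ ▷ A ≫ (α_ A A A).hom ≫ dTwo S.m S.t₂ = (α_ A A A).hom ≫ dTwo S.m S.t₂ := by
  apply S.starR
  have e1 : ∀ Z, o12 (S.e₂ ▷ A ≫ (α_ A A A).hom ≫ dTwo S.m S.t₂) Z =
      (α_ _ A Z).hom ≫ (α_ A A _).hom ≫ o22 S.e₂ (A ⊗ Z) ≫ S.dd2 Z := by
    intro Z; simp only [dd2_eq, o12, o22, o32]; monoidal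
  have e2 : ∀ Z, o12 ((α_ A A A).hom ≫ dTwo S.m S.t₂) Z = (α_ _ A Z).hom ≫ (α_ A A _).hom ≫ S.dd2 Z := by
    intro Z; simp only [dd2_eq, o12, o22, o32]; monoidal
  rw [e1, e2]
  have h1 := o22 S.e₂ _ ≫= S.Dd (𝟙_ C)
  have h2 := A ◁ A ◁ S.dd1 _ ≫= S.zhe (𝟙_ C)
  have h3 := congrArg (fun t => A ◁ A ◁ t ≫ S.star _) (S.dd1_e1 (𝟙_ C))
  have h4 := S.Dd (𝟙_ C)
  simp only [Category.assoc, whiskerLeft_comp, ex22_0'] at h1 h2 h3 h4 ⊢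
  rw [← h1, ← h2, h3, h4]
theorem d2e2 : dTwo S.m S.t₂ ≫ S.e₂ = dTwo S.m S.t₂ := by
  apply S.starR
  have e1 : ∀ Z, o12 (dTwo S.m S.t₂ ≫ S.e₂) Z = (α_ A _ Z).hom ≫ A ◁ (α_ A A _).hom ≫ S.dd2 Z ≫ o22 S.e₂ Z := by
    intro Z; simp only [dd2_eq, o12, o22, o32]; monoidal
  have e2 : ∀ Z, o12 (dTwo S.m S.t₂) Z = (α_ A _ Z).hom ≫ A ◁ (α_ A A _).hom ≫ S.dd2 Z := by
    intro Z; simp only [dd2_eq, o12, o22, o32]; monoidal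
  rw [e1, e2]
  have h1 := S.dd2 _ ≫= S.zhe (𝟙_ C)
  have h2 := A ◁ A ◁ A ◁ o22 S.e₁ _ ≫= S.Dd (𝟙_ C)
  have h3 := congrArg (fun t => A ◁ A ◁ t ≫ S.star _) (S.zax4 (𝟙_ C))
  have h4 := S.Dd (𝟙_ C)
  have ex : ∀ {Z Z' : C} (g : Z ⟶ Z'), A ◁ A ◁ A ◁ g ≫ S.dd2 Z' = S.dd2 Z ≫ A ◁ A ◁ g := by
    intro Z Z' g; simp [dd2]
  simp only [Category.assoc, whiskerLeft_comp, reassoc_of% ex] at h1 h2 h3 h4 ⊢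
  rw [← h1, ← h2, h3, h4]
theorem d2d2 : (α_ A (A ⊗ A) A).inv ≫ dTwo S.m S.t₂ ▷ A ≫ (α_ A A A).hom ≫ dTwo S.m S.t₂ =
    A ◁ (α_ A A A).hom ≫ A ◁ A ◁ S.m ≫ dTwo S.m S.t₂ := by
  apply S.starR
  have e1 : ∀ Z, o12 ((α_ A (A ⊗ A) A).inv ≫ dTwo S.m S.t₂ ▷ A ≫ (α_ A A A).hom ≫ dTwo S.m S.t₂) Z =
     (α_ A _ Z).hom ≫ A ◁ (α_ _ A _).hom ≫ A ◁ (α_ A A _).hom ≫ S.dd2 (A ⊗ Z) ≫ S.dd2 Z := by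
    intro Z; simp only [dd2_eq, o12, o22, o32]; monoidal
  have e2 : ∀ Z, o12 (A ◁ (α_ A A A).hom ≫ A ◁ A ◁ S.m ≫ dTwo S.m S.t₂) Z =
     (α_ A _ Z).hom ≫ A ◁ (α_ _ A _).hom ≫ A ◁ (α_ A A _).hom ≫ A ◁ A ◁ o21 S.m Z ≫ S.dd2 Z := by
    intro Z; simp only [dd2_eq, o12, o22, o32, o21]; monoidal
  rw [e1, e2]
  have ex : ∀ {Z Z' : C} (g : Z ⟶ Z'), A ◁ A ◁ A ◁ g ≫ S.dd2 Z' = S.dd2 Z ≫ A ◁ A ◁ g := by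
    intro Z Z' g; simp [dd2]
  have h1 := S.dd2 _ ≫= S.Dd (𝟙_ C)
  have h2 := A ◁ A ◁ A ◁ S.dd1 _ ≫= S.Dd (𝟙_ C)
  have h3 := congrArg (fun t => A ◁ A ◁ t ≫ S.star _) (S.Md (𝟙_ C))
  have h4 := A ◁ A ◁ o21 S.m _ ≫= S.Dd (𝟙_ C)
  simp only [Category.assoc, whiskerLeft_comp, reassoc_of% ex] at h1 h2 h3 h4 ⊢
  rw [← h1, ← h2, ← h3, h4]
theorem I1 (Z : C) : A ◁ o21 S.m Z ≫ o21 S.m Z ≫ o10 S.j Z = A ◁ o22 S.t₁ Z ≫ A ◁ A ◁ o10 S.j Z ≫ o21 S.m Z ≫ o10 S.j Z := by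
  have h1 := S.M1 Z =≫ (A ◁ o10 S.j Z ≫ o10 S.j Z)
  have h2 := A ◁ o22 S.t₁ Z ≫= S.ax7d Z =≫ o10 S.j Z
  have h3 := congrArg (fun t => A ◁ t ≫ A ◁ A ◁ o10 S.j Z ≫ o21 S.m Z ≫ o10 S.j Z) (S.zax3 Z)
  have h4 := o21 S.m _ ≫= S.zm1 Z =≫ o10 S.j Z
  have h5 := S.massoc Z =≫ o10 S.j Z
  simp only [Category.assoc, whiskerLeft_comp, ex10_0] at h1 h2 h3 h4 h5 ⊢
  rw [← h5, h4, h1, h2, h3]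
theorem vii0 (Z : C) : A ◁ o21 S.m Z ≫ o22 S.t₂ Z ≫ o10 S.j _ = o22 S.t₂ _ ≫ o10 S.j _ ≫ o21 S.m Z := by
  have key : A ◁ S.m ≫ S.t₂ ≫ S.j ▷ A = (α_ A A A).inv ≫ S.t₂ ▷ A ≫ (α_ A A A).hom ≫ S.j ▷ (A ⊗ A) ≫ (𝟙_ C) ◁ S.m := by
    apply S.NDR32
    have e1 : ∀ Z, o32 (A ◁ S.m ≫ S.t₂ ≫ S.j ▷ A) Z = (A ◁ o21 S.m Z ≫ o22 S.t₂ Z ≫ o10 S.j _) ≫ (λ_ _).inv := by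
      intro Z; simp only [o32, o21, o22, o10]; monoidal
    have e2 : ∀ Z, o32 ((α_ A A A).inv ≫ S.t₂ ▷ A ≫ (α_ A A A).hom ≫ S.j ▷ (A ⊗ A) ≫ (𝟙_ C) ◁ S.m) Z =
        (o22 S.t₂ _ ≫ o10 S.j _ ≫ o21 S.m Z) ≫ (λ_ _).inv := by
      intro Z; simp only [o32, o21, o22, o10]; monoidal
    rw [e1, e2]
    suffices hh : (A ◁ o21 S.m _ ≫ o22 S.t₂ _ ≫ o10 S.j _) ≫ o21 S.m (𝟙_ C) = (o22 S.t₂ _ ≫ o10 S.j _ ≫ o21 S.m _) ≫ o21 S.m (𝟙_ C) by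
      have h' := hh =≫ (λ_ _).inv
      simp only [Category.assoc, ← leftUnitor_inv_naturality] at h' ⊢
      simpa using h'
    have h1 := A ◁ o21 S.m _ ≫= S.zc12 (𝟙_ C) =≫ o10 S.j _
    have h2 := congrArg (fun t => A ◁ t ≫ o21 S.m _ ≫ o10 S.j _) (S.M1 (𝟙_ C))
    have h3 := congrArg (fun t => A ◁ A ◁ o22 S.t₁ _ ≫ A ◁ t ≫ o21 S.m _ ≫ o10 S.j _) (S.dd1_eq (𝟙_ C))
    have h4 := A ◁ A ◁ o22 S.t₁ _ ≫= A ◁ x13 S.t₁ A _ ≫= S.I1 (A ⊗ 𝟙_ C)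
    have h5 := congrArg (fun t => o22 S.t₂ _ ≫ o10 S.j _ ≫ t) (S.massoc (𝟙_ C))
    have h6 := A ◁ A ◁ o21 S.m _ ≫= S.zc12 (𝟙_ C) =≫ o10 S.j _
    have h7 := congrArg (fun t => A ◁ t ≫ o21 S.m _ ≫ o10 S.j _) (S.RLt1 (𝟙_ C))
    have h8 := congrArg (fun t => A ◁ o22 S.t₁ _ ≫ A ◁ A ◁ t ≫ o21 S.m _ ≫ o10 S.j _) (S.zm1 (𝟙_ C))
    have h9 := congrArg (fun t => A ◁ t ≫ A ◁ A ◁ o10 S.j _ ≫ o21 S.m _ ≫ o10 S.j _) (S.zax1 (𝟙_ C))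
    have h10 := congrArg (fun t => A ◁ A ◁ o22 S.t₁ _ ≫ A ◁ t ≫ A ◁ o22 S.t₁ _ ≫ A ◁ A ◁ o10 S.j _ ≫ o21 S.m _ ≫ o10 S.j _) (x13_alt S.t₁ A (𝟙_ C))
    simp at h1 h2 h3 h4 h5 h6 h7 h8 h9 h10 ⊢
    rw [← h1, h2, h3, h4, h10, h9, ← h8, ← h7, h6, h5]
  convert congrArg (fun t => o32 t Z ≫ (λ_ _).hom) key using 1 <;> (simp only [o32, o21, o22, o10]; monoidal)
end RWMB

end

section
namespace RWMB
variable {A : C} {𝒴 : Set C} (S : RWMB A 𝒴) [YCl 𝒴] [InY 𝒴 A] [PresRE C]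
theorem vii1 (Z : C) : A ◁ A ◁ o21 S.m Z ≫ S.dd2 Z ≫ o10 S.j _ = S.dd2 (A ⊗ Z) ≫ o10 S.j _ ≫ o21 S.m Z := by
  have h1 := congrArg (fun t => bri A A _ ≫ A ◁ t ≫ o21 S.m Z) (S.vii0 Z)
  have h2 := congrArg (fun t => bri A A _ ≫ A ◁ o22 S.t₂ _ ≫ A ◁ o10 S.j _ ≫ t) (S.massoc Z)
  have h3 := congrArg (fun t => A ◁ A ◁ o21 S.m Z ≫ bri A A _ ≫ A ◁ o22 S.t₂ Z ≫ t ≫ o21 S.m Z) (sL10 S.j A (A ⊗ Z))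
  have h4 := congrArg (fun t => bri A A _ ≫ A ◁ o22 S.t₂ _ ≫ t ≫ o21 S.m _ ≫ o21 S.m Z) (sL10 S.j A (A ⊗ (A ⊗ Z)))
  simp [dd2] at h1 h2 h3 h4 ⊢
  rw [← h3, h1, ← h4, h2]
theorem vii {E₂ : C} {eHat₂ : A ⊗ A ⟶ E₂} {eCheck₂ : E₂ ⟶ A ⊗ A}
    (he₂ : eHat₂ ≫ eCheck₂ = S.e₂) (he₂' : eCheck₂ ≫ eHat₂ = 𝟙 E₂) [REpi (dTwo S.m S.t₂ ≫ eHat₂)] (Z : C) :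
    S.dd2 Z ≫ o10 S.j _ = o22 S.e₂ _ ≫ o10 S.j _ ≫ o21 S.m Z := by
  have q1 : eHat₂ ▷ (A ⊗ Z) ≫ eCheck₂ ▷ (A ⊗ Z) = S.e₂ ▷ (A ⊗ Z) := by
    rw [← comp_whiskerRight, he₂]
  suffices hh : eCheck₂ ▷ (A ⊗ Z) ≫ (α_ A A _).hom ≫ S.dd2 Z ≫ o10 S.j _ = eCheck₂ ▷ (A ⊗ Z) ≫ (α_ A A _).hom ≫ o22 S.e₂ _ ≫ o10 S.j _ ≫ o21 S.m Z by
    have h' := ((α_ A A _).inv ≫ eHat₂ ▷ (A ⊗ Z)) ≫= hh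
    simp only [Category.assoc] at h'
    rw [reassoc_of% q1] at h'
    have e1 : o22 S.e₂ (A ⊗ Z) ≫ S.dd2 Z = S.dd2 Z := by
      have := S.e2d2
      have h := congrArg (fun t => (α_ A A _).inv ≫ (α_ _ A Z).inv ≫ o12 t Z) this
      simp only [dd2_eq]
      convert h using 1 <;> (simp only [o22, o12, o32]; monoidal)
    have e2 : o22 S.e₂ (A ⊗ Z) ≫ o22 S.e₂ (A ⊗ Z) = o22 S.e₂ (A ⊗ Z) := by
      rw [← o22_comp, S.e2e2]
    have e3 : (α_ A A (A ⊗ Z)).inv ≫ S.e₂ ▷ (A ⊗ Z) ≫ (α_ A A (A ⊗ Z)).hom = o22 S.e₂ (A ⊗ Z) := rfl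
    rw [reassoc_of% q1, reassoc_of% e3, reassoc_of% e3, reassoc_of% e1, reassoc_of% e2] at h'
    exact h'
  haveI := repiWr (dTwo S.m S.t₂ ≫ eHat₂) (A ⊗ Z)
  rw [← cancel_epi ((dTwo S.m S.t₂ ≫ eHat₂) ▷ (A ⊗ Z))]
  have e1 : (dTwo S.m S.t₂ ≫ eHat₂) ▷ (A ⊗ Z) ≫ eCheck₂ ▷ (A ⊗ Z) ≫ (α_ A A _).hom =
      (α_ A _ _).hom ≫ A ◁ (α_ A A _).hom ≫ S.dd2 (A ⊗ Z) := by
    rw [← comp_whiskerRight_assoc, Category.assoc, he₂, S.d2e2, dd2_eq, o32]; monoidal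
  rw [reassoc_of% e1, reassoc_of% e1]
  have e2 : S.dd2 (A ⊗ Z) ≫ o22 S.e₂ _ = S.dd2 (A ⊗ Z) := by
    have h := congrArg (fun t => o32 t (A ⊗ Z)) S.d2e2
    simp only [dd2_eq]
    convert h using 1; (simp only [o22, o32]; monoidal)
  have e3 : S.dd2 (A ⊗ Z) ≫ S.dd2 Z = A ◁ A ◁ o21 S.m Z ≫ S.dd2 Z := by
    have h := congrArg (fun t => A ◁ (α_ A A _).inv ≫ A ◁ (α_ _ A Z).inv ≫ (α_ A _ _).inv ≫ o12 t Z) S.d2d2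
    simp only [dd2_eq]
    convert h using 1 <;> (simp only [o21, o12, o32]; monoidal)
  rw [reassoc_of% e2, reassoc_of% e3, S.vii1]
end RWMB
namespace LH
variable {A : C} {𝒴 : Set C} {S : RWMB A 𝒴} {L : C} {p : A ⟶ L} {n₁ : L ⊗ A ⟶ A} {n₂ : A ⊗ L ⟶ A}
    {μ : L ⊗ L ⟶ L} {δ : L ⟶ L ⊗ L} {ε : L ⟶ 𝟙_ C} {τ : A ⟶ L ⊗ A} {τbar : A ⟶ A ⊗ L}
    (H : LH S p n₁ n₂ μ δ ε τ τbar)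
include H
variable [YCl 𝒴] [InY 𝒴 A] [InY 𝒴 L] [PresRE C] [REpi S.m] [REpi p]
theorem n2x (Z : C) : o21 n₂ (A ⊗ Z) ≫ o21 S.m Z = x13 S.t₁ L Z ≫ o21 n₂ (A ⊗ Z) ≫ o10 S.j (A ⊗ Z) := by
  rw [← cancel_epi (A ◁ o11 p (A ⊗ Z))]
  have h1 := H.zn2 (A ⊗ Z) =≫ o21 S.m Z
  have h2 := S.zB15 Z =≫ o10 S.j _
  have h3 := S.HI Z =≫ (A ◁ o10 S.j _ ≫ o10 S.j _)
  have h4 := congrArg (fun t => o22 S.t5 _ ≫ A ◁ t ≫ o10 S.j _) (S.zm1 Z)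
  have h5 : A ◁ o11 p (A ⊗ Z) ≫ x13 S.t₁ L Z = x13 S.t₁ A Z ≫ A ◁ o11 p (A ⊗ Z) := by
    have k1 := congrArg (fun t => A ◁ t ≫ o22 S.t₁ _ ≫ A ◁ br A L _) (siR11 p A Z)
    have k2 := congrArg (fun t => A ◁ bri A A Z ≫ o22 S.t₁ _ ≫ A ◁ t) (sL11 p A Z)
    simp [x13] at k1 k2 ⊢
    rw [k1, k2]
  have h6 := x13 S.t₁ A Z ≫= H.zn2 (A ⊗ Z) =≫ o10 S.j _
  simp only [Category.assoc] at h1 h2 h3 h4 h5 h6 ⊢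
  rw [h1, reassoc_of% h5, h6]
  simp at h3 h4 ⊢
  rw [h4, h3]
theorem NDe {X Y : C} [InY 𝒴 Y] {u v : X ⟶ L ⊗ Y}
    (h : A ◁ u ≫ o21 n₂ Y ≫ o10 S.j Y = A ◁ v ≫ o21 n₂ Y ≫ o10 S.j Y) : u = v := by
  apply H.stripn
  apply S.strip
  have key : ∀ u : X ⟶ L ⊗ Y, A ◁ (A ◁ u ≫ br A L Y ≫ o21 n₁ Y) ≫ o21 S.m Y =
      o22 S.t₁ X ≫ bri A A X ≫ A ◁ (A ◁ u ≫ o21 n₂ Y ≫ o10 S.j Y) := by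
    intro u
    have h1 := A ◁ A ◁ u ≫= A ◁ br A L Y ≫= H.n2m Y
    have h2 := A ◁ A ◁ u ≫= A ◁ br A L Y ≫= H.n2x Y
    have h3 := (A ◁ A ◁ u ≫ o22 S.t₁ _ ≫ bri A A _) ≫= sL20 (n₂ ≫ S.j) A Y
    have e : ∀ Z, o20 (n₂ ≫ S.j) Z = o21 n₂ Z ≫ o10 S.j Z := by
      intro Z; simp only [o20, o21, o10]; monoidal
    simp [x13, e] at h1 h2 h3 ⊢
    rw [← h1, h2, h3]
  rw [key, key, h]
end LH

end

section
theorem REpi.desc_of {X Y T : C} (f : X ⟶ Y) [hf : REpi f] (k : X ⟶ T)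
    (h : ∀ {W : C} (a b : W ⟶ X), a ≫ f = b ≫ f → a ≫ k = b ≫ k) : ∃ l : Y ⟶ T, f ≫ l = k := by
  obtain ⟨r⟩ := hf.re
  obtain ⟨l, hl⟩ := RegularEpi.desc' r k (h _ _ r.w)
  exact ⟨l, hl⟩
/-- associative and non-degenerate actions -/
class Mdl {A : C} {𝒴 : Set C} (S : RWMB A 𝒴) {V : C} (v : A ⊗ V ⟶ V) : Prop where
  assoc : (A ◁ v) ≫ v = o21 S.m V ≫ v
  nd : NdLeftOn v 𝒴
/-- the action on the first two strands -/
def ap {A V W : C} (v : A ⊗ V ⟶ V) (w : A ⊗ W ⟶ W) (Z : C) : A ⊗ (A ⊗ (V ⊗ (W ⊗ Z))) ⟶ V ⊗ (W ⊗ Z) :=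
  A ◁ br A V (W ⊗ Z) ≫ o21 v (A ⊗ W ⊗ Z) ≫ V ◁ o21 w Z
namespace RWMB
variable {A : C} {𝒴 : Set C} (S : RWMB A 𝒴) [YCl 𝒴] [InY 𝒴 A]
instance mdlSelf : Mdl S S.m where
  assoc := by
    have h := (A ◁ A ◁ (ρ_ A).inv ≫= S.massoc (𝟙_ C)) =≫ (ρ_ _).hom
    convert h.symm using 1 <;> (simp only [o21]; monoidal)
  nd := S.ndl
variable {V W : C} (v : A ⊗ V ⟶ V) [Mdl S v] (w : A ⊗ W ⟶ W) [Mdl S w]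
include S
theorem zact (Z : C) : A ◁ o21 v Z ≫ o21 v Z = o21 S.m (V ⊗ Z) ≫ o21 v Z := by
  convert zl31 (Mdl.assoc (S := S) (v := v)) Z using 1 <;> (simp only [o21]; monoidal)
theorem stripM {X Y : C} [hY : InY 𝒴 Y] {f g : X ⟶ V ⊗ Y} (h : A ◁ f ≫ o21 v Y = A ◁ g ≫ o21 v Y) : f = g :=
  Mdl.nd (S := S) (v := v) X Y hY.mem h
theorem stripM0 {X : C} {f g : X ⟶ V} (h : A ◁ f ≫ v = A ◁ g ≫ v) : f = g := by
  rw [← cancel_mono (ρ_ V).inv]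
  apply S.stripM v
  have h' := h =≫ (ρ_ V).inv
  convert h' using 1 <;> (simp only [o21]; monoidal)
theorem apND {X Z : C} [InY 𝒴 V] [InY 𝒴 W] [InY 𝒴 Z] {f g : X ⟶ V ⊗ (W ⊗ Z)} (h : A ◁ A ◁ f ≫ ap v w Z = A ◁ A ◁ g ≫ ap v w Z) : f = g := by
  have h1 : A ◁ f ≫ br A V _ ≫ V ◁ o21 w Z = A ◁ g ≫ br A V _ ≫ V ◁ o21 w Z := by
    apply S.stripM v
    simpa [ap] using h
  have h2 : ∀ f : X ⟶ V ⊗ (W ⊗ Z), (A ◁ f ≫ br A V _ ≫ V ◁ o21 w Z) ≫ bri V W Z = A ◁ (f ≫ bri V W Z) ≫ o21 w (V ⊗ Z) := by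
    intro f
    have h3 := congrArg (fun t => A ◁ f ≫ br A V _ ≫ t) (siL21 w V Z)
    simp at h3 ⊢
    rw [h3]
  have h4 : f ≫ bri V W Z = g ≫ bri V W Z := by
    apply S.stripM w
    rw [← h2, ← h2, h1]
  simpa using h4 =≫ br W V Z
theorem apap (Z : C) : A ◁ A ◁ ap v w Z ≫ ap v w Z = S.star (V ⊗ W ⊗ Z) ≫ ap v w Z := by
  have h1 := congrArg (fun t => A ◁ A ◁ A ◁ br A V (W ⊗ Z) ≫ A ◁ t ≫ o21 v _ ≫ V ◁ A ◁ o21 w Z ≫ V ◁ o21 w Z) (sL21 v A (A ⊗ W ⊗ Z))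
  have h2 := congrArg (fun t => A ◁ A ◁ A ◁ br A V (W ⊗ Z) ≫ A ◁ br A A _ ≫ A ◁ A ◁ br A V _ ≫ t ≫ V ◁ A ◁ o21 w Z ≫ V ◁ o21 w Z) (S.zact v (A ⊗ A ⊗ W ⊗ Z))
  have h3 := congrArg (fun t => A ◁ A ◁ A ◁ br A V (W ⊗ Z) ≫ A ◁ br A A _ ≫ A ◁ A ◁ br A V _ ≫ o21 S.m _ ≫ o21 v _ ≫ V ◁ t) (S.zact w Z)
  have h4 := congrArg (fun t => A ◁ br A A _ ≫ A ◁ A ◁ t ≫ o21 S.m _ ≫ o21 v _ ≫ V ◁ o21 w Z) (sR21 S.m V (W ⊗ Z))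
  simp [ap, RWMB.star] at h1 h2 h3 h4 ⊢
  rw [h1, h2, h3, h4]
theorem apv (Z : C) : A ◁ A ◁ o21 v (A ⊗ Z) ≫ ap v S.m Z = A ◁ A ◁ A ◁ bri V A Z ≫ S.star (V ⊗ Z) ≫ A ◁ br A V Z ≫ o21 v (A ⊗ Z) := by
  have h1 := congrArg (fun t => A ◁ t ≫ o21 v _ ≫ V ◁ o21 S.m Z) (sL21 v A (A ⊗ Z))
  have h2 := congrArg (fun t => A ◁ br A A _ ≫ A ◁ A ◁ br A V _ ≫ t ≫ V ◁ o21 S.m Z) (S.zact v (A ⊗ A ⊗ Z))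
  have h3 := congrArg (fun t => A ◁ A ◁ A ◁ bri V A Z ≫ A ◁ br A A _ ≫ o21 S.m _ ≫ A ◁ t ≫ o21 v _) (sR21 S.m V Z)
  simp [ap, RWMB.star] at h1 h2 h3 ⊢
  rw [h1, h2, h3]
end RWMB
namespace LH
variable {A : C} {𝒴 : Set C} {S : RWMB A 𝒴} {L : C} {p : A ⟶ L} {n₁ : L ⊗ A ⟶ A} {n₂ : A ⊗ L ⟶ A}
    {μ : L ⊗ L ⟶ L} {δ : L ⟶ L ⊗ L} {ε : L ⟶ 𝟙_ C} {τ : A ⟶ L ⊗ A} {τbar : A ⟶ A ⊗ L}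
    (H : LH S p n₁ n₂ μ δ ε τ τbar)
include H
variable [YCl 𝒴] [InY 𝒴 A] [InY 𝒴 L] [PresRE C] [REpi S.m] [REpi p]
theorem tn2 (Z : C) : A ◁ o12 τ Z ≫ o21 n₂ (A ⊗ Z) ≫ o10 S.j _ = o22 S.t₂ Z ≫ o10 S.j _ := by
  rw [← cancel_epi (A ◁ o21 S.m Z)]
  have h1 := congrArg (fun t => A ◁ t ≫ o21 n₂ _ ≫ o10 S.j _) (H.ztau Z)
  have h2 := congrArg (fun t => A ◁ o22 S.t₁ Z ≫ t ≫ o10 S.j _) (H.zn2 (A ⊗ Z))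
  have h3 := congrArg (fun t => A ◁ o22 S.t₁ Z ≫ t ≫ o10 S.j _) (S.zm5 (A ⊗ Z))
  have h4 := S.zc12 Z =≫ o10 S.j _
  have h5 := S.vii0 Z
  simp at h1 h2 h3 h4 h5 ⊢
  rw [h1, h2, ← h3, h4, ← h5]
variable {V : C} (v : A ⊗ V ⟶ V) [InY 𝒴 V] [REpi v] [Mdl S v]
theorem exTau {E₂ : C} {eHat₂ : A ⊗ A ⟶ E₂} {eCheck₂ : E₂ ⟶ A ⊗ A}
    (he₂ : eHat₂ ≫ eCheck₂ = S.e₂) (he₂' : eCheck₂ ≫ eHat₂ = 𝟙 E₂) [REpi (dTwo S.m S.t₂ ≫ eHat₂)] :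
    ∃ tV : V ⟶ L ⊗ V, v ≫ tV = o12 τ V ≫ L ◁ v := by
  apply REpi.desc_of
  intro W a b hab
  apply H.NDe
  have k1 : ∀ a : W ⟶ A ⊗ V, A ◁ (a ≫ o12 τ V ≫ L ◁ v) ≫ o21 n₂ V ≫ o10 S.j V = A ◁ a ≫ o22 S.t₂ V ≫ o10 S.j _ ≫ v := by
    intro a
    have h1 := A ◁ a ≫= H.tn2 V =≫ v
    simpa using h1
  rw [k1, k1]
  apply S.stripM0 v
  have k2 : ∀ a : W ⟶ A ⊗ V, A ◁ (A ◁ a ≫ o22 S.t₂ V ≫ o10 S.j _ ≫ v) ≫ v = A ◁ A ◁ (a ≫ v) ≫ br A A _ ≫ o22 S.e₂ _ ≫ o10 S.j _ ≫ v := by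
    intro a
    have h1 := (A ◁ A ◁ a ≫ A ◁ o22 S.t₂ V ≫ A ◁ o10 S.j _) ≫= Mdl.assoc (S := S) (v := v)
    have h2 := congrArg (fun t => A ◁ A ◁ a ≫ A ◁ o22 S.t₂ V ≫ t ≫ o21 S.m V ≫ v) (sL10 S.j A (A ⊗ V))
    have h3 := congrArg (fun t => A ◁ A ◁ a ≫ br A A _ ≫ t ≫ v) (S.vii he₂ he₂' V)
    have h4 := (A ◁ A ◁ a ≫ br A A _ ≫ o22 S.e₂ _ ≫ o10 S.j _) ≫= Mdl.assoc (S := S) (v := v)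
    simp [RWMB.dd2] at h1 h2 h3 h4 ⊢
    rw [h1, h2, h3, h4]
  rw [k2, k2, hab]
theorem exTaub : ∃ tbV : V ⟶ V ⊗ L, v ≫ tbV = (τbar ▷ V) ≫ (α_ A L V).hom ≫ (A ◁ (β_ L V).hom) ≫
      (α_ A V L).inv ≫ (v ▷ L) := by
  apply REpi.desc_of
  intro W a b hab
  apply H.NDL
  have k1 : ∀ a : W ⟶ A ⊗ V, (a ≫ (τbar ▷ V) ≫ (α_ A L V).hom ≫ (A ◁ (β_ L V).hom) ≫
      (α_ A V L).inv ≫ (v ▷ L)) ▷ A ≫ (α_ V L A).hom ≫ V ◁ n₁ = ((a ▷ A ≫ (α_ A V A).hom ≫ A ◁ V ◁ (ρ_ A).inv)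
        ≫ x13 S.e₁ V (𝟙_ C) ≫ o21 v _) ≫ V ◁ (ρ_ A).hom := by
    intro a
    have h1 : (a ≫ (τbar ▷ V) ≫ (α_ A L V).hom ≫ (A ◁ (β_ L V).hom) ≫
      (α_ A V L).inv ≫ (v ▷ L)) ▷ A ≫ (α_ V L A).hom ≫ V ◁ n₁ = (a ▷ A ≫ (α_ A V A).hom ≫ A ◁ V ◁ (ρ_ A).inv)
       ≫ (o12 τbar _ ≫ A ◁ br L V _ ≫ o21 v _ ≫ V ◁ o21 n₁ (𝟙_ C)) ≫ V ◁ (ρ_ A).hom := by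
      simp only [o12, o21, br, o22]; monoidal
    have h2 := congrArg (fun t => o12 τbar _ ≫ A ◁ L ◁ bri V A _ ≫ A ◁ t ≫ o21 v _) (sR21 n₁ V (𝟙_ C))
    have h3 := congrArg (fun t => A ◁ bri V A _ ≫ t ≫ A ◁ br A V _ ≫ o21 v _) (H.star (V ⊗ 𝟙_ C))
    rw [h1]
    simp [x13] at h2 h3 ⊢
    have h4 := h2.symm.trans h3.symm
    rw [reassoc_of% h4]
  rw [k1, k1]
  congr 1
  apply S.apND v S.m
  have k2 : ∀ a : W ⊗ A ⟶ A ⊗ V ⊗ A ⊗ 𝟙_ C, A ◁ A ◁ (a ≫ x13 S.e₁ V (𝟙_ C) ≫ o21 v _) ≫ ap v S.m (𝟙_ C) =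
      A ◁ A ◁ (a ≫ o21 v _) ≫ o22 S.e₂ _ ≫ ap v S.m (𝟙_ C) := by
    intro a
    have h1 := (A ◁ A ◁ a ≫ A ◁ A ◁ x13 S.e₁ V (𝟙_ C)) ≫= S.apv v (𝟙_ C)
    have h2 := congrArg (fun t => A ◁ A ◁ a ≫ A ◁ A ◁ A ◁ bri V A _ ≫ t ≫ A ◁ br A V _ ≫ o21 v _) (S.zhe (V ⊗ 𝟙_ C))
    have h3 := (A ◁ A ◁ a ≫ o22 S.e₂ _) ≫= S.apv v (𝟙_ C)
    simp [x13] at h1 h2 h3 ⊢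
    rw [h1, h2, ← h3]
  have k3 : ∀ a : W ⟶ A ⊗ V, (a ▷ A ≫ (α_ A V A).hom ≫ A ◁ V ◁ (ρ_ A).inv) ≫ o21 v _ = (a ≫ v) ▷ A ≫ V ◁ (ρ_ A).inv := by
    intro a; simp only [o21]; monoidal
  rw [k2, k2, k3, k3, hab]
end LH

end

section
namespace RWMB
variable {A : C} {𝒴 : Set C} (S : RWMB A 𝒴) [YCl 𝒴] [InY 𝒴 A] [PresRE C] [REpi S.m]
variable {V W : C} (v : A ⊗ V ⟶ V) [Mdl S v] [InY 𝒴 V] [REpi v] (w : A ⊗ W ⟶ W) [Mdl S w] [InY 𝒴 W] [REpi w]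
/-- the lift of `t5` to a module -/
def IsT {V : C} (v : A ⊗ V ⟶ V) (T : A ⊗ V ⟶ V ⊗ A) : Prop :=
  ∀ Z : C, A ◁ o21 v Z ≫ o22 T Z = o22 S.t5 (V ⊗ Z) ≫ A ◁ br A V Z ≫ o21 v (A ⊗ Z)
theorem exT : ∃ T : A ⊗ V ⟶ V ⊗ A, S.IsT v T := by
  have : ∃ T' : A ⊗ V ⊗ 𝟙_ C ⟶ V ⊗ A ⊗ 𝟙_ C, A ◁ o21 v (𝟙_ C) ≫ T' = o22 S.t5 (V ⊗ 𝟙_ C) ≫ A ◁ br A V (𝟙_ C) ≫ o21 v (A ⊗ 𝟙_ C) := by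
    apply REpi.desc_of
    intro X a b hab
    apply S.stripM v
    have k : ∀ a : X ⟶ A ⊗ A ⊗ V ⊗ 𝟙_ C, A ◁ (a ≫ o22 S.t5 (V ⊗ 𝟙_ C) ≫ A ◁ br A V (𝟙_ C) ≫ o21 v (A ⊗ 𝟙_ C)) ≫ o21 v (A ⊗ 𝟙_ C) =
        A ◁ (a ≫ A ◁ o21 v (𝟙_ C)) ≫ o22 S.t₂ _ ≫ A ◁ br A V _ ≫ o21 v _ := by
      intro a
      have h1 := (A ◁ a ≫ A ◁ o22 S.t5 _ ≫ A ◁ A ◁ br A V (𝟙_ C)) ≫= S.zact v (A ⊗ 𝟙_ C)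
      have h2 := congrArg (fun t => A ◁ a ≫ t ≫ A ◁ br A V _ ≫ o21 v _) (S.c24 (V ⊗ 𝟙_ C))
      have h3 := congrArg (fun t => A ◁ a ≫ o22 S.t₂ _ ≫ A ◁ t ≫ o21 v _) (sL21 v A (𝟙_ C))
      have h4 := (A ◁ a ≫ o22 S.t₂ _ ≫ A ◁ br A A _ ≫ A ◁ A ◁ br A V (𝟙_ C)) ≫= S.zact v (A ⊗ 𝟙_ C)
      simp at h1 h2 h3 h4 ⊢
      rw [h1, h2, h3, h4]
    rw [k, k, hab]
  obtain ⟨T', hT'⟩ := this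
  refine ⟨A ◁ (ρ_ V).inv ≫ T' ≫ V ◁ (ρ_ A).hom, fun Z => ?_⟩
  have h : A ◁ v ≫ (A ◁ (ρ_ V).inv ≫ T' ≫ V ◁ (ρ_ A).hom) = o22 S.t5 V ≫ A ◁ (β_ A V).hom ≫ (α_ A V A).inv ≫ v ▷ A := by
    have h1 := (A ◁ A ◁ (ρ_ V).inv) ≫= hT' =≫ (V ◁ (ρ_ A).hom)
    convert h1 using 1 <;> (simp only [o21, o22, br]; monoidal)
  convert zl32 h Z using 1 <;> (simp only [o21, o22, br]; monoidal)
variable {S v} {T : A ⊗ V ⟶ V ⊗ A} {U : A ⊗ W ⟶ W ⊗ A}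
theorem IsT.mul (hT : S.IsT v T) (Z : C) : o21 S.m (V ⊗ Z) ≫ o22 T Z = A ◁ o22 T Z ≫ o22 T (A ⊗ Z) ≫ V ◁ o21 S.m Z := by
  rw [← cancel_epi (A ◁ A ◁ o21 v Z)]
  have h1 := (o21 S.m _) ≫= hT Z
  have h2 := congrArg (fun t => t ≫ A ◁ br A V Z ≫ o21 v _) (S.M5 (V ⊗ Z))
  have h3 := congrArg (fun t => A ◁ t ≫ o22 T (A ⊗ Z) ≫ V ◁ o21 S.m Z) (hT Z)
  have h4 := congrArg (fun t => A ◁ o22 S.t5 _ ≫ A ◁ A ◁ br A V _ ≫ t ≫ V ◁ o21 S.m Z) (hT (A ⊗ Z))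
  have h5 := congrArg (fun t => A ◁ o22 S.t5 _ ≫ o22 S.t5 _ ≫ A ◁ t ≫ o21 v _) (sR21 S.m V Z)
  simp at h1 h2 h3 h4 h5 ⊢
  rw [h1, h2, h3, h4, h5]
theorem IsT.HI (hT : S.IsT v T) (Z : C) : x13 S.t₁ V Z ≫ o22 T (A ⊗ Z) = o22 T (A ⊗ Z) ≫ V ◁ o22 S.t₁ Z := by
  rw [← cancel_epi (A ◁ o21 v (A ⊗ Z))]
  have h1 := (hT (A ⊗ Z)) =≫ V ◁ o22 S.t₁ Z
  have h2 := congrArg (fun t => A ◁ t ≫ o22 S.t₁ _ ≫ A ◁ br A V _ ≫ o22 T _) (siR21 v A Z)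
  have h3 := congrArg (fun t => A ◁ A ◁ bri V A Z ≫ A ◁ bri A A _ ≫ o22 S.t₁ _ ≫ A ◁ t ≫ o22 T _) (sL21 v A Z)
  have h4 := congrArg (fun t => A ◁ A ◁ bri V A Z ≫ A ◁ bri A A _ ≫ o22 S.t₁ _ ≫ A ◁ br A A _ ≫ A ◁ A ◁ br A V _ ≫ t) (hT (A ⊗ Z))
  have h5 := congrArg (fun t => A ◁ A ◁ bri V A Z ≫ t ≫ A ◁ A ◁ br A V _ ≫ A ◁ br A V _ ≫ o21 v _) (S.HI (V ⊗ Z))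
  have h6 := congrArg (fun t => o22 S.t5 _ ≫ A ◁ t ≫ A ◁ br A V _ ≫ o21 v _) (x13_alt S.t₁ V Z)
  simp [x13] at h1 h2 h3 h4 h5 h6 ⊢
  rw [h2, h3, h4, h5, h6, h1]
theorem IsT.H5m (hT : S.IsT v T) (Z : C) : A ◁ o22 T (A ⊗ Z) ≫ o22 T (A ⊗ A ⊗ Z) ≫ V ◁ o22 S.t5 (A ⊗ Z) ≫ V ◁ A ◁ o21 S.m Z =
    o22 S.t5 (V ⊗ A ⊗ Z) ≫ A ◁ br A V (A ⊗ Z) ≫ o22 T (A ⊗ A ⊗ Z) ≫ V ◁ A ◁ o21 S.m Z := by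
  have h1 := congrArg (fun t => A ◁ o22 T (A ⊗ Z) ≫ o22 T (A ⊗ A ⊗ Z) ≫ V ◁ t) (S.zB15 Z)
  have h2 := congrArg (fun t => A ◁ o22 T (A ⊗ Z) ≫ A ◁ V ◁ bri A A Z ≫ t ≫ V ◁ A ◁ br A A Z ≫ V ◁ o21 S.m _) (hT.HI (A ⊗ Z))
  have h3 := congrArg (fun t => A ◁ t ≫ o22 S.t₁ _ ≫ A ◁ br A V _ ≫ A ◁ V ◁ br A A Z ≫ o22 T _ ≫ V ◁ o21 S.m _) (siR22 T A Z)
  have h4 := congrArg (fun t => A ◁ A ◁ bri V A Z ≫ A ◁ bri A A _ ≫ o22 S.t₁ _ ≫ A ◁ t ≫ o22 T _ ≫ V ◁ o21 S.m _) (sL22 T A Z)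
  have h5 := congrArg (fun t => A ◁ A ◁ bri V A Z ≫ A ◁ bri A A _ ≫ o22 S.t₁ _ ≫ A ◁ br A A _ ≫ A ◁ A ◁ br A V Z ≫ t) (hT.mul (A ⊗ Z))
  have h6 := congrArg (fun t => o22 S.t5 _ ≫ A ◁ A ◁ bri V A Z ≫ A ◁ t ≫ o22 T _) (sR21 S.m V Z)
  have h7 := congrArg (fun t => A ◁ A ◁ bri V A Z ≫ t ≫ A ◁ br A V Z ≫ o22 T _) (S.zB15 (V ⊗ Z))
  simp [x13, RWMB.dd1] at h1 h2 h3 h4 h5 h6 h7 ⊢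
  rw [← h1, ← h2, h3, h4, ← h5, h7, h6]
theorem IsT.H5 (hT : S.IsT v T) (Z : C) : A ◁ o22 T Z ≫ o22 T (A ⊗ Z) ≫ V ◁ o22 S.t5 Z = o22 S.t5 (V ⊗ Z) ≫ A ◁ br A V Z ≫ o22 T (A ⊗ Z) := by
  have h : (A ◁ T ≫ o22 T A ≫ V ◁ S.t5) ≫ (α_ V A A).inv = (o22 S.t5 V ≫ A ◁ (β_ A V).hom ≫ o22 T A) ≫ (α_ V A A).inv := by
    apply S.NDR32
    have h' := hT.H5m (𝟙_ C) =≫ (α_ V A (A ⊗ 𝟙_ C)).inv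
    convert h' using 1 <;> (simp only [o32, o21, o22, br]; monoidal)
  have h2 := h =≫ (α_ V A A).hom
  simp only [Category.assoc, Iso.inv_hom_id, Category.comp_id] at h2
  convert zl33 h2 Z using 1 <;> (simp only [o21, o22, br]; monoidal)
end RWMB

end

section
/-- the left coaction induced on a module -/
def IsTau {A L V : C} (τ : A ⟶ L ⊗ A) (v : A ⊗ V ⟶ V) (tV : V ⟶ L ⊗ V) : Prop :=
  ∀ Z : C, o21 v Z ≫ o12 tV Z = o12 τ (V ⊗ Z) ≫ L ◁ o21 v Z
/-- the right coaction induced on a module -/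
def IsTaub {A L V : C} (τbar : A ⟶ A ⊗ L) (v : A ⊗ V ⟶ V) (tb : V ⟶ V ⊗ L) : Prop :=
  ∀ Z : C, o21 v Z ≫ o12 tb Z = o12 τbar (V ⊗ Z) ≫ A ◁ br L V Z ≫ o21 v (L ⊗ Z)
theorem IsTau.mk {A L V : C} {τ : A ⟶ L ⊗ A} {v : A ⊗ V ⟶ V} {tV : V ⟶ L ⊗ V}
    (h : v ≫ tV = (τ ▷ V) ≫ (α_ L A V).hom ≫ (L ◁ v)) : IsTau τ v tV := by
  intro Z
  convert zl22 h Z using 1 <;> (simp only [o21, o12, o22, br]; monoidal)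
theorem IsTaub.mk {A L V : C} {τbar : A ⟶ A ⊗ L} {v : A ⊗ V ⟶ V} {tb : V ⟶ V ⊗ L}
    (h : v ≫ tb = (τbar ▷ V) ≫ (α_ A L V).hom ≫ (A ◁ (β_ L V).hom) ≫ (α_ A V L).inv ≫ (v ▷ L)) : IsTaub τbar v tb := by
  intro Z
  convert zl22 h Z using 1 <;> (simp only [o21, o12, o22, br]; monoidal)
/-- the pairing action of `L` -/
def sg {L W : C} (μ : L ⊗ L ⟶ L) (ε : L ⟶ 𝟙_ C) (tW : W ⟶ L ⊗ W) (Z : C) : L ⊗ (W ⊗ Z) ⟶ W ⊗ Z :=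
  L ◁ o12 tW Z ≫ o21 μ (W ⊗ Z) ≫ o10 ε (W ⊗ Z)
/-- the canonical idempotent, with a passive factor -/
def sz {L V W : C} (μ : L ⊗ L ⟶ L) (ε : L ⟶ 𝟙_ C) (tb : V ⟶ V ⊗ L) (tW : W ⟶ L ⊗ W) (Z : C) :
    V ⊗ (W ⊗ Z) ⟶ V ⊗ (W ⊗ Z) := o12 tb (W ⊗ Z) ≫ V ◁ sg μ ε tW Z
/-- the action before taking the splitting -/
def bz {A V W : C} (T : A ⊗ V ⟶ V ⊗ A) (w : A ⊗ W ⟶ W) (Z : C) : A ⊗ (V ⊗ (W ⊗ Z)) ⟶ V ⊗ (W ⊗ Z) :=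
  o22 T (W ⊗ Z) ≫ V ◁ o21 w Z
theorem sLap {A X V W : C} (v : A ⊗ V ⟶ V) (w : A ⊗ W ⟶ W) (Z : C) : X ◁ ap v w Z ≫ br X V _ ≫ V ◁ br X W Z =
    br X A _ ≫ A ◁ br X A _ ≫ A ◁ A ◁ br X V _ ≫ A ◁ A ◁ V ◁ br X W Z ≫ ap v w (X ⊗ Z) := by
  have h1 := congrArg (fun t => X ◁ A ◁ br A V _ ≫ t ≫ V ◁ X ◁ o21 w Z ≫ V ◁ br X W Z) (sL21 v X (A ⊗ W ⊗ Z))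
  have h2 := congrArg (fun t => X ◁ A ◁ br A V _ ≫ br X A _ ≫ A ◁ br X V _ ≫ o21 v _ ≫ V ◁ t) (sL21 w X Z)
  have h3 := congrArg (fun t => br X A _ ≫ A ◁ t ≫ A ◁ V ◁ A ◁ br X W Z ≫ o21 v _ ≫ V ◁ o21 w _) (YB X A V (W ⊗ Z))
  simp [ap] at h1 h2 h3 ⊢
  rw [h1, h2, h3]
namespace RWMB
variable {A : C} {𝒴 : Set C} {S : RWMB A 𝒴} [YCl 𝒴] [InY 𝒴 A] [PresRE C] [REpi S.m]
variable {V W : C} {v : A ⊗ V ⟶ V} [Mdl S v] [InY 𝒴 V] [REpi v] {w : A ⊗ W ⟶ W} [Mdl S w] [InY 𝒴 W] [REpi w]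
variable {T : A ⊗ V ⟶ V ⊗ A} {U : A ⊗ W ⟶ W ⊗ A}
instance repiAp (Z : C) : REpi (ap v w Z) := by
  have := REpi.of_split (A ◁ br A V (W ⊗ Z)) (A ◁ bri V A (W ⊗ Z)) (by simp)
  have := repiComp (o21 v (A ⊗ W ⊗ Z)) (V ◁ o21 w Z)
  exact repiComp _ _
theorem IsT.ap0 (hT : S.IsT v T) (Z : C) : A ◁ A ◁ br A V Z ≫ A ◁ o21 v (A ⊗ Z) ≫ o22 T (A ⊗ Z) ≫ V ◁ o21 S.m Z =
    S.dd1 (V ⊗ Z) ≫ A ◁ br A V Z ≫ o21 v (A ⊗ Z) := by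
  have h1 := congrArg (fun t => A ◁ A ◁ br A V Z ≫ t ≫ V ◁ o21 S.m Z) (hT (A ⊗ Z))
  have h2 := congrArg (fun t => o22 S.t5 _ ≫ A ◁ t ≫ o21 v (A ⊗ Z)) (sR21 S.m V Z)
  have h3 := S.zB15 (V ⊗ Z) =≫ (A ◁ br A V Z ≫ o21 v (A ⊗ Z))
  simp at h1 h2 h3 ⊢
  rw [h1, h3, h2]
theorem IsT.ap_bz (hT : S.IsT v T) (Z : C) : A ◁ ap v w Z ≫ bz T w Z = S.dd1 (V ⊗ W ⊗ Z) ≫ ap v w Z := by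
  have h1 := hT.ap0 (W ⊗ Z) =≫ V ◁ o21 w Z
  have h2 := congrArg (fun t => A ◁ A ◁ br A V _ ≫ A ◁ o21 v _ ≫ o22 T _ ≫ V ◁ t) (S.zact w Z)
  simp [ap, bz] at h1 h2 ⊢
  rw [h2, h1]
theorem IsT.bassoc (hT : S.IsT v T) (Z : C) : A ◁ bz T w Z ≫ bz T w Z = o21 S.m _ ≫ bz T w Z := by
  have h1 := hT.mul (W ⊗ Z) =≫ V ◁ o21 w Z
  have h2 := congrArg (fun t => A ◁ o22 T _ ≫ o22 T _ ≫ V ◁ t) (S.zact w Z)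
  simp [bz] at h1 h2 ⊢
  rw [h2, h1]
theorem IsT.TTb (hT : S.IsT v T) (hU : S.IsT w U) (Z : C) : A ◁ bz T w Z ≫ o22 T (W ⊗ Z) ≫ V ◁ o22 U Z =
    o22 S.t5 _ ≫ A ◁ br A V _ ≫ A ◁ V ◁ br A W Z ≫ bz T w (A ⊗ Z) := by
  have h1 := congrArg (fun t => A ◁ o22 T _ ≫ o22 T _ ≫ V ◁ t) (hU Z)
  have h2 := hT.H5 (W ⊗ Z) =≫ (V ◁ A ◁ br A W Z ≫ V ◁ o21 w (A ⊗ Z))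
  simp [bz] at h1 h2 ⊢
  rw [h1, h2]
theorem IsT.S3 (hT : S.IsT v T) (Z : C) : A ◁ A ◁ bz T w Z ≫ ap v w Z = S.dd2 _ ≫ ap v w Z := by
  rw [← cancel_epi (A ◁ A ◁ A ◁ ap v w Z)]
  have h1 := congrArg (fun t => A ◁ A ◁ t ≫ ap v w Z) (hT.ap_bz (w := w) Z)
  have h2 := (A ◁ A ◁ S.dd1 _) ≫= S.apap v w Z
  have h3 := S.Dd (V ⊗ W ⊗ Z) =≫ ap v w Z
  have h4 := S.dd2 _ ≫= S.apap v w Z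
  simp [RWMB.dd2] at h1 h2 h3 h4 ⊢
  rw [h1, h2, h3, h4]
end RWMB
namespace LH
variable {A : C} {𝒴 : Set C} {S : RWMB A 𝒴} {L : C} {p : A ⟶ L} {n₁ : L ⊗ A ⟶ A} {n₂ : A ⊗ L ⟶ A}
    {μ : L ⊗ L ⟶ L} {δ : L ⟶ L ⊗ L} {ε : L ⟶ 𝟙_ C} {τ : A ⟶ L ⊗ A} {τbar : A ⟶ A ⊗ L}
    (H : LH S p n₁ n₂ μ δ ε τ τbar)
include H
variable [YCl 𝒴] [InY 𝒴 A] [InY 𝒴 L] [PresRE C] [REpi S.m] [REpi p]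
variable {V W : C} {v : A ⊗ V ⟶ V} [Mdl S v] [InY 𝒴 V] [REpi v] {w : A ⊗ W ⟶ W} [Mdl S w] [InY 𝒴 W] [REpi w]
variable {T : A ⊗ V ⟶ V ⊗ A} {U : A ⊗ W ⟶ W ⊗ A} {tV : V ⟶ L ⊗ V} {tbV : V ⟶ V ⊗ L} {tW : W ⟶ L ⊗ W} {tbW : W ⟶ W ⊗ L}
theorem nW (htW : IsTau τ w tW) (Z : C) [InY 𝒴 Z] : L ◁ o21 w Z ≫ sg μ ε tW Z = o21 n₁ (W ⊗ Z) ≫ o21 w Z := by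
  have h1 := congrArg (fun t => L ◁ t ≫ o21 μ _ ≫ o10 ε _) (htW Z)
  have h2 := H.n1s (W ⊗ Z) =≫ o21 w Z
  simp [sg] at h1 h2 ⊢
  rw [h1, h2]
theorem S1 (htb : IsTaub τbar v tbV) (htW : IsTau τ w tW) (Z : C) [InY 𝒴 Z] :
    ap v w Z ≫ sz μ ε tbV tW Z = o22 S.e₁ _ ≫ ap v w Z := by
  have h1 := congrArg (fun t => A ◁ br A V _ ≫ t ≫ V ◁ L ◁ o21 w Z ≫ V ◁ sg μ ε tW Z) (htb (A ⊗ W ⊗ Z))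
  have h2 := congrArg (fun t => A ◁ br A V _ ≫ o12 τbar _ ≫ A ◁ br L V _ ≫ o21 v _ ≫ V ◁ t) (H.nW htW Z)
  have h3 := congrArg (fun t => o12 τbar _ ≫ A ◁ t ≫ o21 v _ ≫ V ◁ o21 w Z) (sR21 n₁ V (W ⊗ Z))
  have h4 := H.star (V ⊗ W ⊗ Z) =≫ ap v w Z
  simp [ap, sz] at h1 h2 h3 h4 ⊢
  rw [h1, h2, ← h3, h4]
theorem S2 (htb : IsTaub τbar v tbV) (htW : IsTau τ w tW) (Z : C) [InY 𝒴 Z] :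
    A ◁ A ◁ sz μ ε tbV tW Z ≫ ap v w Z = o22 S.e₂ _ ≫ ap v w Z := by
  rw [← cancel_epi (A ◁ A ◁ ap v w Z)]
  have h1 := congrArg (fun t => A ◁ A ◁ t ≫ ap v w Z) (H.S1 htb htW Z)
  have h2 := (A ◁ A ◁ o22 S.e₁ _) ≫= S.apap v w Z
  have h3 := S.zhe (V ⊗ W ⊗ Z) =≫ ap v w Z
  have h4 := o22 S.e₂ _ ≫= S.apap v w Z
  simp at h1 h2 h3 h4 ⊢
  rw [h1, h2, h3, h4]
theorem S4 (hT : S.IsT v T) (htb : IsTaub τbar v tbV) (htW : IsTau τ w tW) (Z : C) [InY 𝒴 Z] :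
    bz T w Z ≫ sz μ ε tbV tW Z = bz T w Z := by
  rw [← cancel_epi (A ◁ ap v w Z)]
  have h1 := hT.ap_bz (w := w) Z
  have h2 := S.dd1 _ ≫= H.S1 htb htW Z
  have h3 := S.dd1_e1 (V ⊗ W ⊗ Z) =≫ ap v w Z
  simp only [Category.assoc] at h1 h2 h3 ⊢
  rw [reassoc_of% h1, h2, h3, h1]
theorem S5 (hT : S.IsT v T) (htb : IsTaub τbar v tbV) (htW : IsTau τ w tW) (Z : C) [InY 𝒴 Z] :
    A ◁ sz μ ε tbV tW Z ≫ bz T w Z = bz T w Z := by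
  rw [← cancel_epi (A ◁ ap v w Z)]
  have h1 := hT.ap_bz (w := w) Z
  have h2 := congrArg (fun t => A ◁ t ≫ bz T w Z) (H.S1 htb htW Z)
  have h3 := S.zax4 (V ⊗ W ⊗ Z) =≫ ap v w Z
  simp only [Category.assoc, MonoidalCategory.whiskerLeft_comp] at h1 h2 h3 ⊢
  rw [h2, h1, h3]
theorem lcoT (hT : S.IsT v T) (htV : IsTau τ v tV) (Z : C) [InY 𝒴 Z] :
    bz T w Z ≫ o12 tV (W ⊗ Z) = o12 τ _ ≫ L ◁ bz T w Z := by
  rw [← cancel_epi (A ◁ ap v w Z)]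
  have h1 := hT.ap_bz (w := w) Z =≫ o12 tV (W ⊗ Z)
  have h2 := congrArg (fun t => S.dd1 (V ⊗ W ⊗ Z) ≫ A ◁ br A V _ ≫ t ≫ L ◁ V ◁ o21 w Z) (htV (A ⊗ W ⊗ Z))
  have h3 := H.Td (V ⊗ W ⊗ Z) =≫ L ◁ ap v w Z
  have h4 := o12 τ _ ≫= congrArg (fun t => L ◁ t) (hT.ap_bz (w := w) Z)
  simp [ap] at h1 h2 h3 h4 ⊢
  rw [h1, h2, h3, h4]
theorem rcoT (hT : S.IsT v T) (htW : IsTaub τbar w tbW) (Z : C) [InY 𝒴 Z] :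
    bz T w Z ≫ V ◁ o12 tbW Z = o12 τbar _ ≫ A ◁ br L V _ ≫ A ◁ V ◁ br L W Z ≫ bz T w (L ⊗ Z) := by
  rw [← cancel_epi (A ◁ ap v w Z)]
  have h1 := hT.ap_bz (w := w) Z =≫ V ◁ o12 tbW Z
  have h2 := congrArg (fun t => S.dd1 (V ⊗ W ⊗ Z) ≫ A ◁ br A V _ ≫ o21 v _ ≫ V ◁ t) (htW Z)
  have h3 := congrArg (fun t => S.dd1 (V ⊗ W ⊗ Z) ≫ A ◁ t ≫ A ◁ V ◁ A ◁ br L W Z ≫ o21 v _ ≫ V ◁ o21 w _) (sR12 τbar V (W ⊗ Z))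
  have h4 := H.Tdb (V ⊗ W ⊗ Z) =≫ (A ◁ A ◁ br L V _ ≫ A ◁ A ◁ V ◁ br L W _ ≫ ap v w (L ⊗ Z))
  have h5 := congrArg (fun t => o12 τbar _ ≫ A ◁ t ≫ bz T w (L ⊗ Z)) (sLap (X := L) v w Z)
  have h6 := congrArg (fun t => o12 τbar _ ≫ A ◁ br L A _ ≫ A ◁ A ◁ br L A _ ≫ A ◁ A ◁ A ◁ br L V _ ≫ A ◁ A ◁ A ◁ V ◁ br L W _ ≫ t) (hT.ap_bz (w := w) (L ⊗ Z))
  simp [ap, RWMB.dd1, x13] at h1 h2 h3 h4 h5 h6 ⊢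
  rw [h1, h2, ← h3, h4, h5, h6]
end LH

end

section
namespace RWMB
variable {A : C} {𝒴 : Set C} (S : RWMB A 𝒴) [YCl 𝒴] [InY 𝒴 A] [PresRE C] [REpi S.m]
theorem selfT : S.IsT S.m S.t5 := by
  intro Z
  have h : A ◁ S.m ≫ S.t5 = o22 S.t5 A ≫ A ◁ (β_ A A).hom ≫ (α_ A A A).inv ≫ S.m ▷ A := by
    have : A ◁ o21 S.m (𝟙_ C) ≫ o22 S.t5 (𝟙_ C) = o22 S.t5 (A ⊗ 𝟙_ C) ≫ A ◁ br A A (𝟙_ C) ≫ o21 S.m (A ⊗ 𝟙_ C) := by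
      apply S.stripM S.m
      have h1 := (A ◁ o22 S.t5 _ ≫ A ◁ A ◁ br A A (𝟙_ C)) ≫= S.massoc (A ⊗ 𝟙_ C)
      have h2 := congrArg (fun t => t ≫ A ◁ br A A _ ≫ o21 S.m _) (S.c24 (A ⊗ 𝟙_ C))
      have h3 := congrArg (fun t => o22 S.t₂ _ ≫ A ◁ t ≫ o21 S.m _) (sL21 S.m A (𝟙_ C))
      have h4 := (o22 S.t₂ _ ≫ A ◁ br A A _ ≫ A ◁ A ◁ br A A (𝟙_ C)) ≫= S.massoc (A ⊗ 𝟙_ C)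
      have h5 := (A ◁ A ◁ o21 S.m (𝟙_ C)) ≫= S.c24 (𝟙_ C)
      simp at h1 h2 h3 h4 h5 ⊢
      rw [h5, h3, ← h4, ← h1, h2]
    have h1 := (A ◁ A ◁ (ρ_ A).inv) ≫= this =≫ (A ◁ (ρ_ A).hom)
    convert h1 using 1 <;> (simp only [o21, o22, br]; monoidal)
  convert zl32 h Z using 1 <;> (simp only [o21, o22, br]; monoidal)
end RWMB
namespace LH
variable {A : C} {𝒴 : Set C} {S : RWMB A 𝒴} {L : C} {p : A ⟶ L} {n₁ : L ⊗ A ⟶ A} {n₂ : A ⊗ L ⟶ A}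
    {μ : L ⊗ L ⟶ L} {δ : L ⟶ L ⊗ L} {ε : L ⟶ 𝟙_ C} {τ : A ⟶ L ⊗ A} {τbar : A ⟶ A ⊗ L}
    (H : LH S p n₁ n₂ μ δ ε τ τbar)
include H
variable [YCl 𝒴] [InY 𝒴 A] [InY 𝒴 L] [PresRE C] [REpi S.m] [REpi p]
variable {V W : C} {v : A ⊗ V ⟶ V} [Mdl S v] [InY 𝒴 V] [REpi v] {w : A ⊗ W ⟶ W} [Mdl S w] [InY 𝒴 W] [REpi w]
variable {T : A ⊗ V ⟶ V ⊗ A} {U : A ⊗ W ⟶ W ⊗ A} {tV : V ⟶ L ⊗ V} {tbV : V ⟶ V ⊗ L} {tW : W ⟶ L ⊗ W} {tbW : W ⟶ W ⊗ L}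
theorem zLp (Z : C) : A ◁ o11 p Z ≫ o21 (n₂ ≫ p) Z = o21 S.m Z ≫ o11 p Z := by
  rw [← H.n2p Z, o21_comp1]
theorem pT {T : A ⊗ L ⟶ L ⊗ A} (hT : S.IsT (n₂ ≫ p) T) (Z : C) : A ◁ o11 p Z ≫ o22 T Z = o22 S.t5 Z ≫ o11 p (A ⊗ Z) := by
  rw [← cancel_epi (A ◁ o21 S.m Z)]
  have h1 := congrArg (fun t => A ◁ t ≫ o22 T Z) (H.zLp Z)
  have h2 := (A ◁ A ◁ o11 p Z) ≫= hT Z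
  have h4 := congrArg (fun t => o22 S.t5 _ ≫ A ◁ t ≫ o21 (n₂ ≫ p) _) (sL11 p A Z)
  have h5 := congrArg (fun t => o22 S.t5 _ ≫ A ◁ br A A Z ≫ t) (H.zLp (A ⊗ Z))
  have h6 := S.selfT Z =≫ o11 p (A ⊗ Z)
  simp at h1 h2 h4 h5 h6 ⊢
  rw [← h1, h2, h4, h5, h6]
theorem lamM {T : A ⊗ L ⟶ L ⊗ A} (hT : S.IsT (n₂ ≫ p) T) (htV : IsTau τ v tV) (Z : C) [InY 𝒴 Z] :
    bz T v Z ≫ sg μ ε tV Z = A ◁ sg μ ε tV Z ≫ o21 v Z := by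
  rw [← cancel_epi (A ◁ o11 p _), ← cancel_epi (A ◁ A ◁ o21 v Z)]
  have k : A ◁ o21 v Z ≫ o11 p _ ≫ sg μ ε tV Z = o22 S.e₁ _ ≫ o10 S.j _ ≫ o21 v Z := by
    have h1 := o11 p _ ≫= H.nW htV Z
    have h2 := H.zn1 (V ⊗ Z) =≫ o21 v Z
    simp at h1 h2 ⊢
    rw [h1, h2]
  have h1 := congrArg (fun t => A ◁ A ◁ o21 v Z ≫ t ≫ L ◁ o21 v Z ≫ sg μ ε tV Z) (H.pT hT (V ⊗ Z))
  have h2 := congrArg (fun t => o22 S.t5 _ ≫ A ◁ t ≫ o11 p _ ≫ sg μ ε tV Z) (S.zact v Z)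
  have h3 := (o22 S.t5 _ ≫ A ◁ o21 S.m _) ≫= k
  have h4 := S.zB15 (V ⊗ Z) =≫ (o22 S.e₁ _ ≫ o10 S.j _ ≫ o21 v Z)
  have h5 := S.dd1_e1 (V ⊗ Z) =≫ (o10 S.j _ ≫ o21 v Z)
  have h6 := S.ax8d (V ⊗ Z) =≫ (o21 v Z)
  have h7 := congrArg (fun t => A ◁ t ≫ o21 v Z) k
  have h8 := (A ◁ o22 S.e₁ _ ≫ A ◁ o10 S.j _) ≫= S.zact v Z
  simp [bz] at h1 h2 h3 h4 h5 h6 h7 h8 ⊢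
  rw [h1, h2, h3, ← h4, h5, h6, h7, h8]
theorem rhoM (hU : S.IsT w U) (htW : IsTaub τbar w tbW) (Z : C) [InY 𝒴 Z] :
    bz U (n₂ ≫ p) Z ≫ o12 tbW _ ≫ W ◁ o21 μ Z ≫ W ◁ o10 ε Z = A ◁ o12 tbW _ ≫ A ◁ W ◁ o21 μ Z ≫ A ◁ W ◁ o10 ε Z ≫ o21 w Z := by
  have hr := REpi.of_split (A ◁ A ◁ br A W Z) (A ◁ A ◁ bri W A Z) (by simp)
  rw [← cancel_epi (A ◁ W ◁ o11 p _), ← cancel_epi (A ◁ o21 w _), ← cancel_epi (A ◁ A ◁ br A W Z)]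
  have k : A ◁ br A W Z ≫ o21 w _ ≫ W ◁ o11 p _ ≫ o12 tbW _ ≫ W ◁ o21 μ Z ≫ W ◁ o10 ε Z = o22 S.e₁ _ ≫ A ◁ o10 S.j _ ≫ o21 w Z := by
    have h1 := congrArg (fun t => A ◁ br A W Z ≫ t ≫ W ◁ L ◁ o11 p _ ≫ W ◁ o21 μ Z ≫ W ◁ o10 ε Z) (htW (A ⊗ Z))
    have h2 := congrArg (fun t => A ◁ br A W Z ≫ o12 τbar _ ≫ A ◁ br L W _ ≫ o21 w _ ≫ W ◁ t ≫ W ◁ o10 ε Z) (H.zmu Z)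
    have h3 := congrArg (fun t => A ◁ br A W Z ≫ o12 τbar _ ≫ A ◁ br L W _ ≫ o21 w _ ≫ W ◁ o21 n₁ _ ≫ W ◁ t) (H.zeps Z)
    have h4 := congrArg (fun t => o12 τbar _ ≫ A ◁ t ≫ A ◁ W ◁ o10 S.j Z ≫ o21 w _) (sR21 n₁ W Z)
    have h5 := H.star (W ⊗ Z) =≫ (A ◁ br A W Z ≫ A ◁ W ◁ o10 S.j Z ≫ o21 w _)
    have h6 := congrArg (fun t => o22 S.e₁ _ ≫ A ◁ t ≫ o21 w _) (sR10 S.j W Z)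
    simp at h1 h2 h3 h4 h5 h6 ⊢
    rw [h1, h2, h3, ← h4, ← h5, h6]
  have h1 := congrArg (fun t => A ◁ A ◁ br A W Z ≫ A ◁ o21 w _ ≫ o22 U _ ≫ W ◁ t ≫ o12 tbW _ ≫ W ◁ o21 μ Z ≫ W ◁ o10 ε Z) (H.zLp Z)
  have h2 := hU.ap0 Z =≫ (W ◁ o11 p _ ≫ o12 tbW _ ≫ W ◁ o21 μ Z ≫ W ◁ o10 ε Z)
  have h3 := S.dd1 (W ⊗ Z) ≫= k
  have h5 := S.dd1_e1 (W ⊗ Z) =≫ (A ◁ o10 S.j _ ≫ o21 w Z)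
  have h6 := S.ax7d (W ⊗ Z) =≫ (o21 w Z)
  have h7 := congrArg (fun t => A ◁ t ≫ o21 w Z) k
  have h8 := (A ◁ o22 S.e₁ _ ≫ A ◁ A ◁ o10 S.j _) ≫= S.zact w Z
  simp [bz] at h1 h2 h3 h5 h6 h7 h8 ⊢
  rw [h1, h2, h3, h5, h6, h7, h8]
theorem tauL : IsTau τ (n₂ ≫ p) δ := by
  apply IsTau.mk
  have : (o21 (n₂ ≫ p) (𝟙_ C) ≫ o12 δ _ = o12 τ _ ≫ L ◁ o21 (n₂ ≫ p) (𝟙_ C)) := by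
    rw [← cancel_epi (A ◁ o11 p _)]
    have h1 := H.zLp (𝟙_ C) =≫ o12 δ _
    have h2 := o21 S.m (𝟙_ C) ≫= H.pd1 (𝟙_ C)
    have h3 := H.taum (𝟙_ C) =≫ L ◁ o11 p _
    have h4 := congrArg (fun t => o12 τ _ ≫ L ◁ t) (H.zLp (𝟙_ C))
    simp at h1 h2 h3 h4 ⊢
    rw [h1, h2, h3, h4]
  have h1 := (A ◁ (ρ_ L).inv) ≫= this =≫ (L ◁ (ρ_ L).hom)
  convert h1 using 1 <;> (simp only [o21, o12]; monoidal)
theorem tbm : IsTaub τbar S.m τbar := by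
  intro Z
  rw [← cancel_epi (o21 S.m (A ⊗ Z))]
  have h1 := S.massoc Z =≫ o12 τbar Z
  have h2 := A ◁ o21 S.m Z ≫= H.ztb Z
  have h3 := S.selfT Z =≫ A ◁ o11 p Z
  have h4 := H.ztb (A ⊗ Z) =≫ (A ◁ br L A Z ≫ o21 S.m _)
  have h5 := congrArg (fun t => o22 S.t5 _ ≫ A ◁ t ≫ o21 S.m _) (sR11 p A Z)
  simp at h1 h2 h3 h4 h5 ⊢
  rw [h1, h2, h3, h4, h5]
theorem taubL : IsTaub τbar (n₂ ≫ p) δ := by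
  intro Z
  rw [← cancel_epi (A ◁ o11 p _)]
  have h1 := H.zLp Z =≫ o12 δ _
  have h2 := o21 S.m Z ≫= H.pd2 Z
  have h3 := H.tbm Z =≫ o11 p _
  have h4 := congrArg (fun t => o12 τbar _ ≫ A ◁ t ≫ o21 (n₂ ≫ p) _) (sL11 p L Z)
  have h5 := congrArg (fun t => o12 τbar _ ≫ A ◁ br L A _ ≫ t) (H.zLp (L ⊗ Z))
  simp at h1 h2 h3 h4 h5 ⊢
  rw [h1, h2, h3, h4, h5]
theorem mlcoa (htV : IsTau τ v tV) : tV ≫ (L ◁ tV) = tV ≫ (δ ▷ V) ≫ (α_ L L V).hom := by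
  have : o12 tV (𝟙_ C) ≫ L ◁ o12 tV _ = o12 tV _ ≫ o12 δ _ := by
    rw [← cancel_epi (o21 v _)]
    have h1 := htV (𝟙_ C) =≫ L ◁ o12 tV _
    have h2 := congrArg (fun t => o12 τ _ ≫ L ◁ t) (htV (𝟙_ C))
    have h3 := H.tauco (V ⊗ 𝟙_ C) =≫ L ◁ L ◁ o21 v _
    have h4 := htV (𝟙_ C) =≫ o12 δ _
    simp at h1 h2 h3 h4 ⊢
    rw [h1, h2, h4, ← h3]
  have h1 := (ρ_ V).inv ≫= this =≫ (L ◁ L ◁ (ρ_ V).hom)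
  convert h1 using 1 <;> (simp only [o21, o12]; monoidal)
theorem mlcou (htV : IsTau τ v tV) : tV ≫ (ε ▷ V) ≫ (λ_ V).hom = 𝟙 V := by
  have : o12 tV (𝟙_ C) ≫ o10 ε _ = 𝟙 _ := by
    rw [← cancel_epi (o21 v _)]
    have h1 := htV (𝟙_ C) =≫ o10 ε _
    have h3 := H.tauc (V ⊗ 𝟙_ C) =≫ o21 v _
    simp at h1 h3 ⊢
    rw [h1, h3]
  have h1 := (ρ_ V).inv ≫= this =≫ (ρ_ V).hom
  convert h1 using 1 <;> ((try simp only [o10, o12]); monoidal)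
theorem mrcoa (htb : IsTaub τbar v tbV) : tbV ≫ (V ◁ δ) = tbV ≫ (tbV ▷ L) ≫ (α_ V L L).hom := by
  have : o12 tbV (𝟙_ C) ≫ V ◁ o12 δ _ = o12 tbV _ ≫ o12 tbV _ := by
    rw [← cancel_epi (o21 v _)]
    have h1 := htb (𝟙_ C) =≫ V ◁ o12 δ _
    have h2 := congrArg (fun t => o12 τbar _ ≫ A ◁ t ≫ o21 v _) (sR12 δ V (𝟙_ C))
    have h3 := H.tbco (V ⊗ 𝟙_ C) =≫ (A ◁ L ◁ br L V _ ≫ A ◁ br L V _ ≫ o21 v _)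
    have h4 := htb (𝟙_ C) =≫ o12 tbV _
    have h5 := (o12 τbar _ ≫ A ◁ br L V _) ≫= htb (L ⊗ 𝟙_ C)
    simp at h1 h2 h3 h4 h5 ⊢
    rw [h1, ← h2, h3, h4, h5]
  have h1 := (ρ_ V).inv ≫= this =≫ (V ◁ L ◁ (ρ_ L).hom)
  convert h1 using 1 <;> (simp only [o21, o12]; monoidal)
theorem mrcou (htb : IsTaub τbar v tbV) : tbV ≫ (V ◁ ε) ≫ (ρ_ V).hom = 𝟙 V := by
  have : o12 tbV (𝟙_ C) ≫ V ◁ o10 ε _ = 𝟙 _ := by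
    rw [← cancel_epi (o21 v _)]
    have h1 := htb (𝟙_ C) =≫ V ◁ o10 ε _
    have h2 := congrArg (fun t => o12 τbar _ ≫ A ◁ t ≫ o21 v _) (sR10 ε V (𝟙_ C))
    have h3 := H.tbc (V ⊗ 𝟙_ C) =≫ o21 v _
    simp at h1 h2 h3 ⊢
    rw [h1, ← h2, h3]
  have h1 := (ρ_ V).inv ≫= this =≫ (ρ_ V).hom
  convert h1 using 1 <;> ((try simp only [o10, o12]); monoidal)
theorem mbico (htV : IsTau τ v tV) (htb : IsTaub τbar v tbV) : tbV ≫ (tV ▷ L) ≫ (α_ L V L).hom = tV ≫ (L ◁ tbV) := by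
  have : o12 tbV (𝟙_ C) ≫ o12 tV _ = o12 tV _ ≫ L ◁ o12 tbV _ := by
    rw [← cancel_epi (o21 v _)]
    have h1 := htb (𝟙_ C) =≫ o12 tV _
    have h2 := (o12 τbar _ ≫ A ◁ br L V _) ≫= htV (L ⊗ 𝟙_ C)
    have hb : o12 τbar (V ⊗ 𝟙_ C) ≫ o12 τ _ = o12 τ _ ≫ L ◁ o12 τbar _ := by
      have h1 := congrArg (fun t => t ▷ (V ⊗ 𝟙_ C) ≫ (α_ _ _ _).hom ≫ L ◁ (α_ _ _ _).hom) H.bico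
      convert h1 using 1 <;> (simp only [o21, o12]; monoidal)
    have h3 := hb =≫ (L ◁ A ◁ br L V _ ≫ L ◁ o21 v _)
    have h4 := htV (𝟙_ C) =≫ L ◁ o12 tbV _
    have h5 := congrArg (fun t => o12 τ _ ≫ L ◁ t) (htb (𝟙_ C))
    simp at h1 h2 h3 h4 h5 ⊢
    rw [h1, h2, h3, h4, h5]
  have h1 := (ρ_ V).inv ≫= this =≫ (L ◁ V ◁ (ρ_ L).hom)
  convert h1 using 1 <;> (simp only [o21, o12]; monoidal)
end LH

end

section
/-- coseparable Frobenius comonoid data, with passive factors -/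
structure CS {L : C} (μ : L ⊗ L ⟶ L) (δ : L ⟶ L ⊗ L) (ε : L ⟶ 𝟙_ C) : Prop where
  md : ∀ Z, o12 δ Z ≫ o21 μ Z = 𝟙 _
  co : ∀ Z, o12 δ Z ≫ o12 δ (L ⊗ Z) = o12 δ Z ≫ L ◁ o12 δ Z
  c1 : ∀ Z, o12 δ Z ≫ o10 ε (L ⊗ Z) = 𝟙 _
  c2 : ∀ Z, o12 δ Z ≫ L ◁ o10 ε Z = 𝟙 _
  f1 : ∀ Z, o21 μ Z ≫ o12 δ Z = L ◁ o12 δ Z ≫ o21 μ (L ⊗ Z)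
  f2 : ∀ Z, L ◁ o12 δ Z ≫ o21 μ (L ⊗ Z) = o12 δ (L ⊗ Z) ≫ L ◁ o21 μ Z

namespace Bicomod
variable {L : C} {δ : L ⟶ L ⊗ L} {ε : L ⟶ 𝟙_ C} (X : Bicomod L δ ε)
theorem zlc (Z : C) : o12 X.lco Z ≫ L ◁ o12 X.lco Z = o12 X.lco Z ≫ o12 δ (X.V ⊗ Z) := by
  have h1 := congrArg (fun t => t ▷ Z ≫ (α_ _ _ _).hom ≫ L ◁ (α_ _ _ _).hom) X.lcoassoc
  convert h1 using 1 <;> (simp only [o21, o12]; monoidal)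
theorem zlu (Z : C) : o12 X.lco Z ≫ o10 ε (X.V ⊗ Z) = 𝟙 _ := by
  have h1 := congrArg (fun t => t ▷ Z) X.lcounit
  convert h1 using 1 <;> ((try simp only [o10, o12]); monoidal)
theorem zrc (Z : C) : o12 X.rco Z ≫ X.V ◁ o12 δ Z = o12 X.rco Z ≫ o12 X.rco (L ⊗ Z) := by
  have h1 := congrArg (fun t => t ▷ Z ≫ (α_ _ _ _).hom ≫ X.V ◁ (α_ _ _ _).hom) X.rcoassoc
  convert h1 using 1 <;> (simp only [o21, o12]; monoidal)
theorem zru (Z : C) : o12 X.rco Z ≫ X.V ◁ o10 ε Z = 𝟙 _ := by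
  have h1 := congrArg (fun t => t ▷ Z) X.rcounit
  convert h1 using 1 <;> ((try simp only [o10, o12]); monoidal)
theorem zbi (Z : C) : o12 X.rco Z ≫ o12 X.lco (L ⊗ Z) = o12 X.lco Z ≫ L ◁ o12 X.rco Z := by
  have h1 := congrArg (fun t => t ▷ Z ≫ (α_ _ _ _).hom ≫ L ◁ (α_ _ _ _).hom) X.bicomm
  convert h1 using 1 <;> (simp only [o21, o12]; monoidal)
theorem zhl {X Y : Bicomod L δ ε} (f : X ⟶ Y) (Z : C) : o12 X.lco Z ≫ L ◁ o11 f.1 Z = o11 f.1 Z ≫ o12 Y.lco Z := by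
  have h1 := congrArg (fun t => t ▷ Z ≫ (α_ _ _ _).hom) f.2.1
  convert h1 using 1 <;> (simp only [o11, o12]; monoidal)
theorem zhr {X Y : Bicomod L δ ε} (f : X ⟶ Y) (Z : C) : o12 X.rco Z ≫ o11 f.1 (L ⊗ Z) = o11 f.1 Z ≫ o12 Y.rco Z := by
  have h1 := congrArg (fun t => t ▷ Z ≫ (α_ _ _ _).hom) f.2.2
  convert h1 using 1 <;> (simp only [o11, o12]; monoidal)
end Bicomod

/-- the right pairing action of `L` -/
def sr {L V : C} (μ : L ⊗ L ⟶ L) (ε : L ⟶ 𝟙_ C) (tb : V ⟶ V ⊗ L) (Z : C) : V ⊗ (L ⊗ Z) ⟶ V ⊗ Z :=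
  o12 tb (L ⊗ Z) ≫ V ◁ o21 μ Z ≫ V ◁ o10 ε Z
theorem sIdem_o22 {L V W : C} (μ : L ⊗ L ⟶ L) (ε : L ⟶ 𝟙_ C) (tb : V ⟶ V ⊗ L) (tW : W ⟶ L ⊗ W) (Z : C) :
    o22 (sIdem μ ε tb tW) Z = sz μ ε tb tW Z := by
  simp only [o22, o21, o12, o10, sz, sg, sIdem]; monoidal
theorem sz_sr {L V W : C} (μ : L ⊗ L ⟶ L) (ε : L ⟶ 𝟙_ C) (tb : V ⟶ V ⊗ L) (tW : W ⟶ L ⊗ W) (Z : C) :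
    sz μ ε tb tW Z = V ◁ o12 tW Z ≫ sr μ ε tb (W ⊗ Z) := by
  simp [sz, sg, sr]
theorem ext22 {P Q R T : C} {f g : P ⊗ Q ⟶ R ⊗ T} (h : o22 f (𝟙_ C) = o22 g (𝟙_ C)) : f = g := by
  have h1 := (P ◁ (ρ_ Q).inv) ≫= h =≫ (R ◁ (ρ_ T).hom)
  convert h1 using 1 <;> (simp only [o22]; monoidal)
theorem ext11 {P Q : C} {f g : P ⟶ Q} (h : o11 f (𝟙_ C) = o11 g (𝟙_ C)) : f = g := by
  have h1 := (ρ_ P).inv ≫= h =≫ (ρ_ Q).hom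
  convert h1 using 1 <;> (simp only [o11]; monoidal)
theorem ext12 {P Q R : C} {f g : P ⟶ Q ⊗ R} (h : o12 f (𝟙_ C) = o12 g (𝟙_ C)) : f = g := by
  have h1 := (ρ_ P).inv ≫= h =≫ (Q ◁ (ρ_ R).hom)
  convert h1 using 1 <;> (simp only [o12]; monoidal)
namespace CS
variable {L : C} {μ : L ⊗ L ⟶ L} {δ : L ⟶ L ⊗ L} {ε : L ⟶ 𝟙_ C} (K : CS μ δ ε) (X Y W : Bicomod L δ ε) (Z : C)
include K
theorem g1 : o12 X.lco Z ≫ sg μ ε X.lco Z = 𝟙 _ := by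
  have h1 := X.zlc Z =≫ (o21 μ _ ≫ o10 ε _)
  have h2 := o12 X.lco Z ≫= K.md (X.V ⊗ Z) =≫ o10 ε _
  have h3 := X.zlu Z
  simp [sg] at h1 h2 h3 ⊢
  rw [h1, h2, h3]
theorem g2a : sg μ ε X.lco Z ≫ o12 X.lco Z = L ◁ o12 X.lco Z ≫ o21 μ _ := by
  have h1 := congrArg (fun t => L ◁ t ≫ o21 μ _ ≫ o10 ε _) (X.zlc Z)
  have h2 := L ◁ o12 X.lco Z ≫= K.f1 (X.V ⊗ Z) =≫ o10 ε _
  have h3 := (L ◁ o12 X.lco Z ≫ o21 μ _) ≫= K.c1 (X.V ⊗ Z)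
  simp [sg] at h1 h2 h3 ⊢
  rw [h1, ← h2, h3]
theorem g2 : sg μ ε X.lco Z ≫ o12 X.lco Z = o12 δ (X.V ⊗ Z) ≫ L ◁ sg μ ε X.lco Z := by
  rw [K.g2a]
  have h1 := L ◁ o12 X.lco Z ≫= K.f1 (X.V ⊗ Z) =≫ L ◁ o10 ε _
  have h2 := L ◁ o12 X.lco Z ≫= K.f2 (X.V ⊗ Z) =≫ L ◁ o10 ε _
  have h3 := (L ◁ o12 X.lco Z ≫ o21 μ _) ≫= K.c2 (X.V ⊗ Z)
  simp [sg] at h1 h2 h3 ⊢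
  rw [← h2, ← h1, h3]
theorem g3 : sg μ ε X.lco Z ≫ o12 X.rco Z = L ◁ o12 X.rco Z ≫ sg μ ε X.lco (L ⊗ Z) := by
  have h1 := congrArg (fun t => L ◁ t ≫ o21 μ _ ≫ o10 ε _) (X.zbi Z)
  simp [sg] at h1 ⊢
  rw [h1]
theorem r1 : o12 X.rco Z ≫ sr μ ε X.rco Z = 𝟙 _ := by
  have h1 := X.zrc Z =≫ (X.V ◁ o21 μ _ ≫ X.V ◁ o10 ε _)
  have h2 := congrArg (fun t => o12 X.rco Z ≫ X.V ◁ t ≫ X.V ◁ o10 ε _) (K.md Z)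
  have h3 := X.zru Z
  simp [sr] at h1 h2 h3 ⊢
  rw [← h1, h2, h3]
theorem r2a : sr μ ε X.rco Z ≫ o12 X.rco Z = o12 X.rco _ ≫ X.V ◁ o21 μ _ := by
  have h1 := X.zrc (L ⊗ Z) =≫ (X.V ◁ L ◁ o21 μ _ ≫ X.V ◁ L ◁ o10 ε _)
  have h2 := congrArg (fun t => o12 X.rco _ ≫ X.V ◁ t ≫ X.V ◁ L ◁ o10 ε _) (K.f2 Z)
  have h3 := congrArg (fun t => o12 X.rco _ ≫ X.V ◁ t ≫ X.V ◁ L ◁ o10 ε _) (K.f1 Z)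
  have h4 := congrArg (fun t => o12 X.rco _ ≫ X.V ◁ o21 μ Z ≫ X.V ◁ t) (K.c2 Z)
  simp [sr] at h1 h2 h3 h4 ⊢
  rw [← h1, ← h2, ← h3, h4]
theorem r2 : sr μ ε X.rco Z ≫ o12 X.rco Z = X.V ◁ o12 δ Z ≫ sr μ ε X.rco (L ⊗ Z) := by
  rw [K.r2a]
  have h3 := congrArg (fun t => o12 X.rco _ ≫ X.V ◁ t ≫ X.V ◁ o10 ε _) (K.f1 Z)
  have h4 := congrArg (fun t => o12 X.rco _ ≫ X.V ◁ o21 μ Z ≫ X.V ◁ t) (K.c1 Z)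
  simp [sr] at h3 h4 ⊢
  rw [← h3, h4]
theorem r3 : sr μ ε X.rco Z ≫ o12 X.lco Z = o12 X.lco _ ≫ L ◁ sr μ ε X.rco Z := by
  have h1 := X.zbi (L ⊗ Z) =≫ (L ◁ X.V ◁ o21 μ _ ≫ L ◁ X.V ◁ o10 ε _)
  simp [sr] at h1 ⊢
  rw [h1]
theorem sgnat {X Y : Bicomod L δ ε} (f : X ⟶ Y) : L ◁ o11 f.1 Z ≫ sg μ ε Y.lco Z = sg μ ε X.lco Z ≫ o11 f.1 Z := by
  have h1 := congrArg (fun t => L ◁ t ≫ o21 μ _ ≫ o10 ε _) (Bicomod.zhl f Z)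
  simp [sg] at h1 ⊢
  rw [h1]
theorem srnat {X Y : Bicomod L δ ε} (f : X ⟶ Y) : o11 f.1 (L ⊗ Z) ≫ sr μ ε Y.rco Z = sr μ ε X.rco Z ≫ o11 f.1 Z := by
  have h1 := (Bicomod.zhr f (L ⊗ Z)) =≫ (Y.V ◁ o21 μ _ ≫ Y.V ◁ o10 ε _)
  simp [sr] at h1 ⊢
  rw [← h1]
theorem ss : sz μ ε X.rco Y.lco Z ≫ sz μ ε X.rco Y.lco Z = sz μ ε X.rco Y.lco Z := by
  have h1 := X.zrc (Y.V ⊗ Z) =≫ (X.V ◁ L ◁ sg μ ε Y.lco Z ≫ X.V ◁ sg μ ε Y.lco Z)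
  have h2 := congrArg (fun t => o12 X.rco _ ≫ X.V ◁ t ≫ X.V ◁ sg μ ε Y.lco Z) (K.g2 Y Z)
  have h3 := congrArg (fun t => o12 X.rco _ ≫ X.V ◁ sg μ ε Y.lco Z ≫ X.V ◁ t) (K.g1 Y Z)
  simp [sz] at h1 h2 h3 ⊢
  rw [← h1, ← h2, h3]
theorem sssp : sIdem μ ε X.rco Y.lco ≫ sIdem μ ε X.rco Y.lco = sIdem μ ε X.rco Y.lco := by
  apply ext22
  rw [o22_comp, sIdem_o22, K.ss]
theorem s_rco : sz μ ε X.rco Y.lco Z ≫ X.V ◁ o12 Y.rco Z = X.V ◁ o12 Y.rco Z ≫ sz μ ε X.rco Y.lco (L ⊗ Z) := by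
  have h1 := congrArg (fun t => o12 X.rco _ ≫ X.V ◁ t) (K.g3 Y Z)
  simp [sz] at h1 ⊢
  rw [h1]
theorem s_lco : sz μ ε X.rco Y.lco Z ≫ o12 X.lco _ = o12 X.lco _ ≫ L ◁ sz μ ε X.rco Y.lco Z := by
  have h1 := X.V ◁ o12 Y.lco Z ≫= K.r3 X (Y.V ⊗ Z)
  simp [sz_sr] at h1 ⊢
  rw [h1]
end CS

end

section
namespace CS
variable {L : C} {μ : L ⊗ L ⟶ L} {δ : L ⟶ L ⊗ L} {ε : L ⟶ 𝟙_ C} (K : CS μ δ ε) [IsIdempotentComplete C]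
include K
theorem exq (X Y : Bicomod L δ ε) : ∃ (P : C) (i : P ⟶ X.V ⊗ Y.V) (q : X.V ⊗ Y.V ⟶ P), i ≫ q = 𝟙 _ ∧ q ≫ i = sIdem μ ε X.rco Y.lco :=
  IsIdempotentComplete.idempotents_split _ _ (K.sssp X Y)
/-- carrier of the tensor product -/
noncomputable def tV (X Y : Bicomod L δ ε) : C := (K.exq X Y).choose
/-- inclusion -/
noncomputable def ti (X Y : Bicomod L δ ε) : K.tV X Y ⟶ X.V ⊗ Y.V := (K.exq X Y).choose_spec.choose
/-- projection -/
noncomputable def tq (X Y : Bicomod L δ ε) : X.V ⊗ Y.V ⟶ K.tV X Y := (K.exq X Y).choose_spec.choose_spec.choose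
theorem piq (X Y : Bicomod L δ ε) : K.ti X Y ≫ K.tq X Y = 𝟙 _ := (K.exq X Y).choose_spec.choose_spec.choose_spec.1
theorem pqi (X Y : Bicomod L δ ε) : K.tq X Y ≫ K.ti X Y = sIdem μ ε X.rco Y.lco := (K.exq X Y).choose_spec.choose_spec.choose_spec.2
variable (X Y W : Bicomod L δ ε) (Z : C)
theorem iq : o12 (K.ti X Y) Z ≫ o21 (K.tq X Y) Z = 𝟙 _ := by
  have h : o12 (K.ti X Y) Z ≫ o21 (K.tq X Y) Z = (K.ti X Y ≫ K.tq X Y) ▷ Z := by simp [o12, o21]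
  rw [h, K.piq]; simp
theorem qi : o21 (K.tq X Y) Z ≫ o12 (K.ti X Y) Z = sz μ ε X.rco Y.lco Z := by
  rw [← sIdem_o22, ← K.pqi]; simp [o21, o12, o22]
theorem sq : sz μ ε X.rco Y.lco Z ≫ o21 (K.tq X Y) Z = o21 (K.tq X Y) Z := by
  rw [← K.qi, assoc, K.iq, comp_id]
theorem is : o12 (K.ti X Y) Z ≫ sz μ ε X.rco Y.lco Z = o12 (K.ti X Y) Z := by
  rw [← K.qi, ← assoc, K.iq, id_comp]
instance epq : IsSplitEpi (o21 (K.tq X Y) Z) := IsSplitEpi.mk' ⟨_, K.iq X Y Z⟩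
instance epqw {V : C} : IsSplitEpi (V ◁ o21 (K.tq X Y) Z) :=
  IsSplitEpi.mk' ⟨V ◁ o12 (K.ti X Y) Z, by rw [← whiskerLeft_comp, K.iq, whiskerLeft_id]⟩
instance epqw2 {V U : C} : IsSplitEpi (U ◁ V ◁ o21 (K.tq X Y) Z) :=
  IsSplitEpi.mk' ⟨U ◁ V ◁ o12 (K.ti X Y) Z, by rw [← whiskerLeft_comp, ← whiskerLeft_comp, K.iq, whiskerLeft_id, whiskerLeft_id]⟩
/-- left coaction on the tensor product -/
noncomputable def tl : K.tV X Y ⟶ L ⊗ K.tV X Y := K.ti X Y ≫ X.lco ▷ Y.V ≫ (α_ _ _ _).hom ≫ L ◁ K.tq X Y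
/-- right coaction on the tensor product -/
noncomputable def tr : K.tV X Y ⟶ K.tV X Y ⊗ L := K.ti X Y ≫ X.V ◁ Y.rco ≫ (α_ _ _ _).inv ≫ K.tq X Y ▷ L
theorem tl_o : o12 (K.tl X Y) Z = o12 (K.ti X Y) Z ≫ o12 X.lco _ ≫ L ◁ o21 (K.tq X Y) Z := by
  simp only [o12, o21, tl]; monoidal
theorem tr_o : o12 (K.tr X Y) Z = o12 (K.ti X Y) Z ≫ X.V ◁ o12 Y.rco _ ≫ o21 (K.tq X Y) (L ⊗ Z) := by
  simp only [o12, o21, tr]; monoidal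
theorem q_l : o21 (K.tq X Y) Z ≫ o12 (K.tl X Y) Z = o12 X.lco _ ≫ L ◁ o21 (K.tq X Y) Z := by
  rw [K.tl_o, reassoc_of% K.qi, reassoc_of% K.s_lco, ← whiskerLeft_comp, K.sq]
theorem q_r : o21 (K.tq X Y) Z ≫ o12 (K.tr X Y) Z = X.V ◁ o12 Y.rco _ ≫ o21 (K.tq X Y) (L ⊗ Z) := by
  rw [K.tr_o, reassoc_of% K.qi, reassoc_of% K.s_rco, K.sq]
/-- the tensor product of bicomodules -/
noncomputable def tens : Bicomod L δ ε where
  V := K.tV X Y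
  lco := K.tl X Y
  rco := K.tr X Y
  lcoassoc := by
    have : o12 (K.tl X Y) (𝟙_ C) ≫ L ◁ o12 (K.tl X Y) _ = o12 (K.tl X Y) _ ≫ o12 δ _ := by
      rw [← cancel_epi (o21 (K.tq X Y) _)]
      have h1 := K.q_l X Y (𝟙_ C)
      have h2 := congrArg (fun t => o12 X.lco _ ≫ L ◁ t) (K.q_l X Y (𝟙_ C))
      have h3 := X.zlc (Y.V ⊗ 𝟙_ C) =≫ L ◁ L ◁ o21 (K.tq X Y) _
      simp at h2 h3 ⊢
      rw [reassoc_of% h1, h2, h3, reassoc_of% h1]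
    have h1 := (ρ_ _).inv ≫= this =≫ (L ◁ L ◁ (ρ_ _).hom)
    convert h1 using 1 <;> (simp only [o21, o12]; monoidal)
  lcounit := by
    have : o12 (K.tl X Y) (𝟙_ C) ≫ o10 ε _ = 𝟙 _ := by
      rw [← cancel_epi (o21 (K.tq X Y) _)]
      have h1 := K.q_l X Y (𝟙_ C)
      have h3 := X.zlu (Y.V ⊗ 𝟙_ C) =≫ o21 (K.tq X Y) _
      simp at h3 ⊢
      rw [reassoc_of% h1]; simp [h3]
    have h1 := (ρ_ _).inv ≫= this =≫ ((ρ_ _).hom)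
    convert h1 using 1 <;> ((try simp only [o10, o12]); monoidal)
  rcoassoc := by
    have : o12 (K.tr X Y) (𝟙_ C) ≫ K.tV X Y ◁ o12 δ _ = o12 (K.tr X Y) _ ≫ o12 (K.tr X Y) _ := by
      rw [← cancel_epi (o21 (K.tq X Y) _)]
      have h1 := K.q_r X Y (𝟙_ C)
      have h2 := K.q_r X Y (L ⊗ 𝟙_ C)
      have h3 := congrArg (fun t => X.V ◁ t ≫ o21 (K.tq X Y) _) (Y.zrc (𝟙_ C))
      simp at h3 ⊢
      rw [reassoc_of% h1, reassoc_of% h1, h2]; simp [h3]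
    have h1 := (ρ_ _).inv ≫= this =≫ (K.tV X Y ◁ L ◁ (ρ_ _).hom)
    convert h1 using 1 <;> (simp only [o21, o12]; monoidal)
  rcounit := by
    have : o12 (K.tr X Y) (𝟙_ C) ≫ K.tV X Y ◁ o10 ε _ = 𝟙 _ := by
      rw [← cancel_epi (o21 (K.tq X Y) _)]
      have h1 := K.q_r X Y (𝟙_ C)
      have h3 := congrArg (fun t => X.V ◁ t ≫ o21 (K.tq X Y) _) (Y.zru (𝟙_ C))
      simp at h3 ⊢
      rw [reassoc_of% h1]; simp [h3]
    have h1 := (ρ_ _).inv ≫= this =≫ ((ρ_ _).hom)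
    convert h1 using 1 <;> ((try simp only [o10, o12]); monoidal)
  bicomm := by
    have : o12 (K.tr X Y) (𝟙_ C) ≫ o12 (K.tl X Y) _ = o12 (K.tl X Y) _ ≫ L ◁ o12 (K.tr X Y) _ := by
      rw [← cancel_epi (o21 (K.tq X Y) _)]
      have h1 := K.q_r X Y (𝟙_ C)
      have h2 := K.q_l X Y (L ⊗ 𝟙_ C)
      have h3 := K.q_l X Y (𝟙_ C)
      have h4 := congrArg (fun t => o12 X.lco _ ≫ L ◁ t) (K.q_r X Y (𝟙_ C))
      simp at h4 ⊢
      rw [reassoc_of% h1, h2, reassoc_of% h3, h4]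
    have h1 := (ρ_ _).inv ≫= this =≫ (L ◁ K.tV X Y ◁ (ρ_ _).hom)
    convert h1 using 1 <;> (simp only [o21, o12]; monoidal)

theorem qsg : L ◁ o21 (K.tq X Y) Z ≫ sg μ ε (K.tl X Y) Z = sg μ ε X.lco _ ≫ o21 (K.tq X Y) Z := by
  have h4 := congrArg (fun t => L ◁ t ≫ o21 μ _ ≫ o10 ε _) (K.q_l X Y Z)
  simp [sg] at h4 ⊢
  rw [h4]
theorem qsr : o21 (K.tq X Y) _ ≫ sr μ ε (K.tr X Y) Z = X.V ◁ sr μ ε Y.rco _ ≫ o21 (K.tq X Y) Z := by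
  have h4 := (K.q_r X Y (L ⊗ Z)) =≫ (K.tV X Y ◁ o21 μ _ ≫ K.tV X Y ◁ o10 ε _)
  simp [sr] at h4 ⊢
  rw [h4]
theorem qsz : o21 (K.tq X Y) (W.V ⊗ Z) ≫ sz μ ε (K.tr X Y) W.lco Z = X.V ◁ sz μ ε Y.rco W.lco Z ≫ o21 (K.tq X Y) (W.V ⊗ Z) := by
  have h4 := (X.V ◁ Y.V ◁ o12 W.lco Z) ≫= K.qsr X Y (W.V ⊗ Z)
  simp [sz_sr] at h4 ⊢
  rw [h4]
theorem qsz' : X.V ◁ o21 (K.tq Y W) Z ≫ sz μ ε X.rco (K.tl Y W) Z = sz μ ε X.rco Y.lco _ ≫ X.V ◁ o21 (K.tq Y W) Z := by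
  have h4 := congrArg (fun t => o12 X.rco _ ≫ X.V ◁ t) (K.qsg Y W Z)
  simp [sz] at h4 ⊢
  rw [h4]
end CS

end

section
namespace CS
variable {L : C} {μ : L ⊗ L ⟶ L} {δ : L ⟶ L ⊗ L} {ε : L ⟶ 𝟙_ C} (K : CS μ δ ε) [IsIdempotentComplete C]
include K
variable (X Y W U : Bicomod L δ ε) (Z : C)
/-- projection onto the tensor product -/
noncomputable def q : X.V ⊗ Y.V ⟶ (K.tens X Y).V := K.tq X Y
/-- inclusion of the tensor product -/
noncomputable def i : (K.tens X Y).V ⟶ X.V ⊗ Y.V := K.ti X Y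
theorem Piq : K.i X Y ≫ K.q X Y = 𝟙 _ := K.piq X Y
theorem Pqi : K.q X Y ≫ K.i X Y = sIdem μ ε X.rco Y.lco := K.pqi X Y
theorem Iq : o12 (K.i X Y) Z ≫ o21 (K.q X Y) Z = 𝟙 _ := K.iq X Y Z
theorem Qi : o21 (K.q X Y) Z ≫ o12 (K.i X Y) Z = sz μ ε X.rco Y.lco Z := K.qi X Y Z
theorem Sq : sz μ ε X.rco Y.lco Z ≫ o21 (K.q X Y) Z = o21 (K.q X Y) Z := K.sq X Y Z
theorem Is : o12 (K.i X Y) Z ≫ sz μ ε X.rco Y.lco Z = o12 (K.i X Y) Z := K.is X Y Z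
instance Epq : Epi (o21 (K.q X Y) Z) := inferInstanceAs (Epi (o21 (K.tq X Y) Z))
instance Epqw {V : C} : Epi (V ◁ o21 (K.q X Y) Z) := inferInstanceAs (Epi (V ◁ o21 (K.tq X Y) Z))
instance Epqw2 {V U : C} : Epi (U ◁ V ◁ o21 (K.q X Y) Z) := inferInstanceAs (Epi (U ◁ V ◁ o21 (K.tq X Y) Z))
theorem Ql : o21 (K.q X Y) Z ≫ o12 (K.tens X Y).lco Z = o12 X.lco _ ≫ L ◁ o21 (K.q X Y) Z := K.q_l X Y Z
theorem Qr : o21 (K.q X Y) Z ≫ o12 (K.tens X Y).rco Z = X.V ◁ o12 Y.rco _ ≫ o21 (K.q X Y) (L ⊗ Z) := K.q_r X Y Z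
theorem Qsz : o21 (K.q X Y) (W.V ⊗ Z) ≫ sz μ ε (K.tens X Y).rco W.lco Z = X.V ◁ sz μ ε Y.rco W.lco Z ≫ o21 (K.q X Y) (W.V ⊗ Z) :=
  K.qsz X Y W Z
theorem Qsz' : X.V ◁ o21 (K.q Y W) Z ≫ sz μ ε X.rco (K.tens Y W).lco Z = sz μ ε X.rco Y.lco _ ≫ X.V ◁ o21 (K.q Y W) Z :=
  K.qsz' X Y W Z
omit K [IsIdempotentComplete C] in
theorem mkl {X Y : Bicomod L δ ε} {g : X.V ⟶ Y.V} (hl : o12 X.lco (𝟙_ C) ≫ L ◁ o11 g _ = o11 g _ ≫ o12 Y.lco _)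
    (hr : o12 X.rco (𝟙_ C) ≫ o11 g _ = o11 g _ ≫ o12 Y.rco _) :
    X.lco ≫ L ◁ g = g ≫ Y.lco ∧ X.rco ≫ g ▷ L = g ≫ Y.rco := by
  constructor
  · apply ext12; convert hl using 1 <;> (simp only [o11, o12]; monoidal)
  · apply ext12; convert hr using 1 <;> (simp only [o11, o12]; monoidal)
/-- whiskering on the right -/
noncomputable def wrg {X X' : Bicomod L δ ε} (f : X ⟶ X') (Y : Bicomod L δ ε) : (K.tens X Y).V ⟶ (K.tens X' Y).V :=
  K.i X Y ≫ f.1 ▷ Y.V ≫ K.q X' Y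
/-- whiskering on the left -/
noncomputable def wlg (X : Bicomod L δ ε) {Y Y' : Bicomod L δ ε} (f : Y ⟶ Y') : (K.tens X Y).V ⟶ (K.tens X Y').V :=
  K.i X Y ≫ X.V ◁ f.1 ≫ K.q X Y'
theorem wrg_o {X X' : Bicomod L δ ε} (f : X ⟶ X') (Y : Bicomod L δ ε) (Z : C) :
    o21 (K.q X Y) Z ≫ o11 (K.wrg f Y) Z = o11 f.1 (Y.V ⊗ Z) ≫ o21 (K.q X' Y) Z := by
  have h1 : o11 (K.wrg f Y) Z = o12 (K.i X Y) Z ≫ o11 f.1 _ ≫ o21 (K.q X' Y) Z := by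
    simp only [o11, o12, o21, wrg]; monoidal
  have h2 := (X.V ◁ o12 Y.lco Z) ≫= K.srnat (Y.V ⊗ Z) f
  have h3 := o11 f.1 _ ≫= K.Sq X' Y Z
  simp only [sz_sr] at h3
  rw [h1, reassoc_of% (K.Qi X Y Z), sz_sr]
  simp at h2 h3 ⊢
  rw [← reassoc_of% h2, h3]
theorem wlg_o (X : Bicomod L δ ε) {Y Y' : Bicomod L δ ε} (f : Y ⟶ Y') (Z : C) :
    o21 (K.q X Y) Z ≫ o11 (K.wlg X f) Z = X.V ◁ o11 f.1 Z ≫ o21 (K.q X Y') Z := by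
  have h1 : o11 (K.wlg X f) Z = o12 (K.i X Y) Z ≫ X.V ◁ o11 f.1 _ ≫ o21 (K.q X Y') Z := by
    simp only [o11, o12, o21, wlg]; monoidal
  have h2 := congrArg (fun t => o12 X.rco _ ≫ X.V ◁ t ≫ o21 (K.q X Y') Z) (K.sgnat Z f)
  have h3 := X.V ◁ o11 f.1 _ ≫= K.Sq X Y' Z
  rw [h1, reassoc_of% (K.Qi X Y Z)]
  simp [sz] at h2 h3 ⊢
  rw [← h2, h3]
/-- whiskering on the right -/
noncomputable def wr {X X' : Bicomod L δ ε} (f : X ⟶ X') (Y : Bicomod L δ ε) : K.tens X Y ⟶ K.tens X' Y :=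
  ⟨K.wrg f Y, by
    apply mkl
    · rw [← cancel_epi (o21 (K.q X Y) _)]
      have h1 := o12 X.lco _ ≫= congrArg (fun t => L ◁ t) (K.wrg_o f Y (𝟙_ C))
      have h2 := Bicomod.zhl f (Y.V ⊗ 𝟙_ C) =≫ L ◁ o21 (K.q X' Y) _
      rw [reassoc_of% (K.Ql X Y), reassoc_of% (K.wrg_o f Y), K.Ql X' Y]
      simp at h1 h2 ⊢
      rw [h1, h2]
    · rw [← cancel_epi (o21 (K.q X Y) _)]
      rw [reassoc_of% (K.Qr X Y), reassoc_of% (K.wrg_o f Y), K.Qr X' Y, K.wrg_o]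
      simp⟩
/-- whiskering on the left -/
noncomputable def wl (X : Bicomod L δ ε) {Y Y' : Bicomod L δ ε} (f : Y ⟶ Y') : K.tens X Y ⟶ K.tens X Y' :=
  ⟨K.wlg X f, by
    apply mkl
    · rw [← cancel_epi (o21 (K.q X Y) _)]
      have h1 := o12 X.lco _ ≫= congrArg (fun t => L ◁ t) (K.wlg_o X f (𝟙_ C))
      rw [reassoc_of% (K.Ql X Y), reassoc_of% (K.wlg_o X f), K.Ql X Y']
      simp at h1 ⊢
      rw [h1]
    · rw [← cancel_epi (o21 (K.q X Y) _)]
      have h1 := congrArg (fun t => X.V ◁ t ≫ o21 (K.q X Y') _) (Bicomod.zhr f (𝟙_ C))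
      rw [reassoc_of% (K.Qr X Y), reassoc_of% (K.wlg_o X f), K.Qr X Y', K.wlg_o]
      simp at h1 ⊢
      rw [h1]⟩
/-- associator -/
noncomputable def ga : (K.tens (K.tens X Y) W).V ⟶ (K.tens X (K.tens Y W)).V :=
  K.i _ _ ≫ K.i _ _ ▷ _ ≫ (α_ _ _ _).hom ≫ _ ◁ K.q _ _ ≫ K.q _ _
/-- inverse associator -/
noncomputable def gb : (K.tens X (K.tens Y W)).V ⟶ (K.tens (K.tens X Y) W).V :=
  K.i _ _ ≫ _ ◁ K.i _ _ ≫ (α_ _ _ _).inv ≫ K.q _ _ ▷ _ ≫ K.q _ _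
theorem ga_o : o21 (K.q X Y) (W.V ⊗ Z) ≫ o21 (K.q (K.tens X Y) W) Z ≫ o11 (K.ga X Y W) Z =
    X.V ◁ o21 (K.q Y W) Z ≫ o21 (K.q X (K.tens Y W)) Z := by
  have h1 : o11 (K.ga X Y W) Z = o12 (K.i _ _) Z ≫ o12 (K.i _ _) _ ≫ X.V ◁ o21 (K.q _ _) Z ≫ o21 (K.q _ _) Z := by
    simp only [o11, o12, o21, ga]; monoidal
  rw [h1, reassoc_of% (K.Qi (K.tens X Y) W), reassoc_of% (K.Qsz X Y W), reassoc_of% (K.Qi X Y)]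
  rw [← reassoc_of% (K.Qsz' X Y W), K.Sq, ← whiskerLeft_comp_assoc, K.Sq]
theorem gb_o : X.V ◁ o21 (K.q Y W) Z ≫ o21 (K.q X (K.tens Y W)) Z ≫ o11 (K.gb X Y W) Z =
    o21 (K.q X Y) (W.V ⊗ Z) ≫ o21 (K.q (K.tens X Y) W) Z := by
  have h1 : o11 (K.gb X Y W) Z = o12 (K.i _ _) Z ≫ X.V ◁ o12 (K.i _ _) _ ≫ o21 (K.q _ _) _ ≫ o21 (K.q _ _) Z := by
    simp only [o11, o12, o21, gb]; monoidal
  rw [h1, reassoc_of% (K.Qi X (K.tens Y W)), reassoc_of% (K.Qsz' X Y W), ← whiskerLeft_comp_assoc, K.Qi Y W]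
  rw [← reassoc_of% (K.Qsz X Y W), K.Sq, reassoc_of% (K.Sq X Y)]
end CS

end

section
namespace CS
variable {L : C} {μ : L ⊗ L ⟶ L} {δ : L ⟶ L ⊗ L} {ε : L ⟶ 𝟙_ C} (K : CS μ δ ε) [IsIdempotentComplete C]
include K
variable (X Y W U : Bicomod L δ ε) (Z : C)
theorem ga_l : o12 (K.tens (K.tens X Y) W).lco Z ≫ L ◁ o11 (K.ga X Y W) Z = o11 (K.ga X Y W) Z ≫ o12 (K.tens X (K.tens Y W)).lco Z := by
  rw [← cancel_epi (o21 (K.q (K.tens X Y) W) _), ← cancel_epi (o21 (K.q X Y) _)]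
  rw [reassoc_of% (K.Ql (K.tens X Y) W), reassoc_of% (K.Ql X Y), reassoc_of% (K.ga_o X Y W), K.Ql]
  have h1 := o12 X.lco _ ≫= congrArg (fun t => L ◁ t) (K.ga_o X Y W Z)
  simp at h1 ⊢
  rw [h1]
theorem ga_r : o12 (K.tens (K.tens X Y) W).rco Z ≫ o11 (K.ga X Y W) _ = o11 (K.ga X Y W) Z ≫ o12 (K.tens X (K.tens Y W)).rco Z := by
  rw [← cancel_epi (o21 (K.q (K.tens X Y) W) _), ← cancel_epi (o21 (K.q X Y) _)]
  rw [reassoc_of% (K.Qr (K.tens X Y) W), reassoc_of% (K.ga_o X Y W), K.Qr]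
  have h1 := congrArg (fun t => X.V ◁ t ≫ o21 (K.q X (K.tens Y W)) _) (K.Qr Y W Z)
  have h2 := X.V ◁ Y.V ◁ o12 W.rco Z ≫= K.ga_o X Y W (L ⊗ Z)
  simp at h1 h2 ⊢
  rw [h1, h2]
theorem ga_b : K.ga X Y W ≫ K.gb X Y W = 𝟙 _ := by
  apply ext11
  rw [← cancel_epi (o21 (K.q (K.tens X Y) W) _), ← cancel_epi (o21 (K.q X Y) _), o11_comp, reassoc_of% (K.ga_o X Y W), K.gb_o]
  simp [o11]
theorem gb_a : K.gb X Y W ≫ K.ga X Y W = 𝟙 _ := by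
  apply ext11
  rw [← cancel_epi (o21 (K.q X (K.tens Y W)) _), ← cancel_epi (X.V ◁ o21 (K.q Y W) _), o11_comp, reassoc_of% (K.gb_o X Y W), K.ga_o]
  simp [o11]
/-- the associator -/
noncomputable def as : K.tens (K.tens X Y) W ≅ K.tens X (K.tens Y W) where
  hom := ⟨K.ga X Y W, mkl (K.ga_l X Y W _) (K.ga_r X Y W _)⟩
  inv := ⟨K.gb X Y W, by
    have h := mkl (K.ga_l X Y W _) (K.ga_r X Y W _)
    have e1 := K.ga_b X Y W
    have e2 := K.gb_a X Y W
    have : IsIso (K.ga X Y W) := ⟨_, e1, e2⟩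
    constructor
    · rw [← cancel_epi (K.ga X Y W), ← reassoc_of% h.1, ← whiskerLeft_comp, e1, reassoc_of% e1]; simp
    · rw [← cancel_epi (K.ga X Y W), ← reassoc_of% h.2, ← comp_whiskerRight, e1, reassoc_of% e1]; simp⟩
  hom_inv_id := Subtype.ext (K.ga_b X Y W)
  inv_hom_id := Subtype.ext (K.gb_a X Y W)
omit [IsIdempotentComplete C] in
/-- the unit bicomodule -/
def un : Bicomod L δ ε where
  V := L
  lco := δ
  rco := δ
  lcoassoc := by
    have h1 := (ρ_ _).inv ≫= K.co (𝟙_ C) =≫ (L ◁ L ◁ (ρ_ _).hom)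
    symm
    convert h1 using 1 <;> (simp only [o21, o12]; monoidal)
  lcounit := by
    have h1 := (ρ_ _).inv ≫= K.c1 (𝟙_ C) =≫ ((ρ_ _).hom)
    convert h1 using 1 <;> ((try simp only [o10, o12]); monoidal)
  rcoassoc := by
    have h1 := (ρ_ _).inv ≫= K.co (𝟙_ C) =≫ (L ◁ L ◁ (ρ_ _).hom)
    symm
    convert h1 using 1 <;> (simp only [o21, o12]; monoidal)
  rcounit := by
    have h1 := (ρ_ _).inv ≫= K.c2 (𝟙_ C) =≫ ((ρ_ _).hom)
    convert h1 using 1 <;> ((try simp only [o10, o12]); monoidal)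
  bicomm := by
    have h1 := (ρ_ _).inv ≫= K.co (𝟙_ C) =≫ (L ◁ L ◁ (ρ_ _).hom)
    convert h1 using 1 <;> (simp only [o21, o12]; monoidal)
/-- projection, unit on the left -/
noncomputable def ql : L ⊗ X.V ⟶ (K.tens K.un X).V := K.q K.un X
/-- inclusion, unit on the left -/
noncomputable def il : (K.tens K.un X).V ⟶ L ⊗ X.V := K.i K.un X
/-- projection, unit on the right -/
noncomputable def qr : X.V ⊗ L ⟶ (K.tens X K.un).V := K.q X K.un
/-- inclusion, unit on the right -/
noncomputable def ir : (K.tens X K.un).V ⟶ X.V ⊗ L := K.i X K.un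
instance Epql : Epi (o21 (K.ql X) Z) := K.Epq K.un X Z
instance Epqr : Epi (o21 (K.qr X) Z) := K.Epq X K.un Z
instance Epqlw {V : C} : Epi (V ◁ o21 (K.ql X) Z) := K.Epqw K.un X Z
instance Epqrw {V : C} : Epi (V ◁ o21 (K.qr X) Z) := K.Epqw X K.un Z
theorem Qil : o21 (K.ql X) Z ≫ o12 (K.il X) Z = o12 δ _ ≫ L ◁ sg μ ε X.lco Z := K.Qi K.un X Z
theorem Qir : o21 (K.qr X) Z ≫ o12 (K.ir X) Z = X.V ◁ o12 δ _ ≫ sr μ ε X.rco (L ⊗ Z) := (K.Qi X K.un Z).trans (sz_sr ..)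
theorem Sql : o12 δ _ ≫ L ◁ sg μ ε X.lco Z ≫ o21 (K.ql X) Z = o21 (K.ql X) Z := by
  have := K.Sq K.un X Z
  rw [← assoc]; exact this
theorem Sqr : X.V ◁ o12 δ _ ≫ sr μ ε X.rco (L ⊗ Z) ≫ o21 (K.qr X) Z = o21 (K.qr X) Z := by
  have := K.Sq X K.un Z
  rw [sz_sr] at this
  rw [← assoc]; exact this
theorem Qll : o21 (K.ql X) Z ≫ o12 (K.tens K.un X).lco Z = o12 δ _ ≫ L ◁ o21 (K.ql X) Z := K.Ql K.un X Z
theorem Qlr : o21 (K.ql X) Z ≫ o12 (K.tens K.un X).rco Z = L ◁ o12 X.rco _ ≫ o21 (K.ql X) (L ⊗ Z) := K.Qr K.un X Z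
theorem Qrl : o21 (K.qr X) Z ≫ o12 (K.tens X K.un).lco Z = o12 X.lco _ ≫ L ◁ o21 (K.qr X) Z := K.Ql X K.un Z
theorem Qrr : o21 (K.qr X) Z ≫ o12 (K.tens X K.un).rco Z = X.V ◁ o12 δ _ ≫ o21 (K.qr X) (L ⊗ Z) := K.Qr X K.un Z
/-- left unitor -/
noncomputable def gl : (K.tens K.un X).V ⟶ X.V :=
  K.il X ≫ L ◁ X.lco ≫ (α_ _ _ _).inv ≫ μ ▷ _ ≫ ε ▷ _ ≫ (λ_ _).hom
/-- right unitor -/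
noncomputable def gr : (K.tens X K.un).V ⟶ X.V :=
  K.ir X ≫ X.rco ▷ L ≫ (α_ _ _ _).hom ≫ X.V ◁ μ ≫ X.V ◁ ε ≫ (ρ_ _).hom
theorem gl_o : o21 (K.ql X) Z ≫ o11 (K.gl X) Z = sg μ ε X.lco Z := by
  have h1 : o11 (K.gl X) Z = o12 (K.il X) Z ≫ sg μ ε X.lco Z := by
    simp only [o11, o12, o21, o10, sg, gl]; monoidal
  rw [h1, reassoc_of% (K.Qil X Z), ← reassoc_of% (K.g2 X Z), K.g1, comp_id]
theorem gr_o : o21 (K.qr X) Z ≫ o11 (K.gr X) Z = sr μ ε X.rco Z := by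
  have h1 : o11 (K.gr X) Z = o12 (K.ir X) Z ≫ sr μ ε X.rco Z := by
    simp only [o11, o12, o21, o10, sr, gr]; monoidal
  rw [h1, reassoc_of% (K.Qir X Z), ← reassoc_of% (K.r2 X Z), K.r1, comp_id]
/-- inverse left unitor -/
noncomputable def gli : X.V ⟶ (K.tens K.un X).V := X.lco ≫ K.ql X
/-- inverse right unitor -/
noncomputable def gri : X.V ⟶ (K.tens X K.un).V := X.rco ≫ K.qr X
theorem gli_o : o11 (K.gli X) Z = o12 X.lco Z ≫ o21 (K.ql X) Z := by
  simp only [o11, o12, o21, gli]; monoidal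
theorem gri_o : o11 (K.gri X) Z = o12 X.rco Z ≫ o21 (K.qr X) Z := by
  simp only [o11, o12, o21, gri]; monoidal
theorem gli_gl : K.gli X ≫ K.gl X = 𝟙 _ := by
  apply ext11
  rw [o11_comp, gli_o, assoc, K.gl_o, K.g1]; simp [o11]
theorem gri_gr : K.gri X ≫ K.gr X = 𝟙 _ := by
  apply ext11
  rw [o11_comp, gri_o, assoc, K.gr_o, K.r1]; simp [o11]
theorem gl_gli : K.gl X ≫ K.gli X = 𝟙 _ := by
  apply ext11
  rw [← cancel_epi (o21 (K.ql X) _), o11_comp, reassoc_of% (K.gl_o X (𝟙_ C)), gli_o, reassoc_of% (K.g2 X), K.Sql]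
  simp [o11]
theorem gr_gri : K.gr X ≫ K.gri X = 𝟙 _ := by
  apply ext11
  rw [← cancel_epi (o21 (K.qr X) _), o11_comp, reassoc_of% (K.gr_o X (𝟙_ C)), gri_o, reassoc_of% (K.r2 X), K.Sqr]
  simp [o11]
theorem gl_l : o12 (K.tens K.un X).lco Z ≫ L ◁ o11 (K.gl X) Z = o11 (K.gl X) Z ≫ o12 X.lco Z := by
  rw [← cancel_epi (o21 (K.ql X) _), reassoc_of% (K.gl_o X Z), reassoc_of% (K.Qll X Z), ← whiskerLeft_comp, K.gl_o, K.g2]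
theorem gl_r : o12 (K.tens K.un X).rco Z ≫ o11 (K.gl X) _ = o11 (K.gl X) Z ≫ o12 X.rco Z := by
  rw [← cancel_epi (o21 (K.ql X) _), reassoc_of% (K.gl_o X Z), reassoc_of% (K.Qlr X Z), K.gl_o, K.g3]
theorem gr_l : o12 (K.tens X K.un).lco Z ≫ L ◁ o11 (K.gr X) Z = o11 (K.gr X) Z ≫ o12 X.lco Z := by
  rw [← cancel_epi (o21 (K.qr X) _), reassoc_of% (K.gr_o X Z), reassoc_of% (K.Qrl X Z), ← whiskerLeft_comp, K.gr_o, K.r3]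
theorem gr_r : o12 (K.tens X K.un).rco Z ≫ o11 (K.gr X) _ = o11 (K.gr X) Z ≫ o12 X.rco Z := by
  rw [← cancel_epi (o21 (K.qr X) _), reassoc_of% (K.gr_o X Z), reassoc_of% (K.Qrr X Z), K.gr_o, K.r2]
/-- left unitor -/
noncomputable def lu : K.tens K.un X ≅ X where
  hom := ⟨K.gl X, mkl (K.gl_l X _) (K.gl_r X _)⟩
  inv := ⟨K.gli X, by
    have h := mkl (K.gl_l X _) (K.gl_r X _)
    have e1 := K.gl_gli X
    have e2 := K.gli_gl X
    have : IsIso (K.gl X) := ⟨_, e1, e2⟩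
    constructor
    · rw [← cancel_epi (K.gl X), ← reassoc_of% h.1, ← whiskerLeft_comp, e1, reassoc_of% e1]; simp
    · rw [← cancel_epi (K.gl X), ← reassoc_of% h.2, ← comp_whiskerRight, e1, reassoc_of% e1]; simp⟩
  hom_inv_id := Subtype.ext (K.gl_gli X)
  inv_hom_id := Subtype.ext (K.gli_gl X)
/-- right unitor -/
noncomputable def ru : K.tens X K.un ≅ X where
  hom := ⟨K.gr X, mkl (K.gr_l X _) (K.gr_r X _)⟩
  inv := ⟨K.gri X, by
    have h := mkl (K.gr_l X _) (K.gr_r X _)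
    have e1 := K.gr_gri X
    have e2 := K.gri_gr X
    have : IsIso (K.gr X) := ⟨_, e1, e2⟩
    constructor
    · rw [← cancel_epi (K.gr X), ← reassoc_of% h.1, ← whiskerLeft_comp, e1, reassoc_of% e1]; simp
    · rw [← cancel_epi (K.gr X), ← reassoc_of% h.2, ← comp_whiskerRight, e1, reassoc_of% e1]; simp⟩
  hom_inv_id := Subtype.ext (K.gr_gri X)
  inv_hom_id := Subtype.ext (K.gri_gr X)
end CS

end

section
namespace CS
variable {L : C} {μ : L ⊗ L ⟶ L} {δ : L ⟶ L ⊗ L} {ε : L ⟶ 𝟙_ C} (K : CS μ δ ε) [IsIdempotentComplete C]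
omit [IsIdempotentComplete C] in
theorem o11c {X Y W : Bicomod L δ ε} (f : X ⟶ Y) (g : Y ⟶ W) (Z : C) : o11 (f ≫ g).1 Z = o11 f.1 Z ≫ o11 g.1 Z :=
  o11_comp f.1 g.1 Z
omit [IsIdempotentComplete C] in
theorem o11i (X : Bicomod L δ ε) (Z : C) : o11 (Subtype.val (𝟙 X : X ⟶ X)) Z = 𝟙 _ :=
  id_whiskerRight _ _
include K
theorem wr_o {X X' : Bicomod L δ ε} (f : X ⟶ X') (Y : Bicomod L δ ε) (Z : C) :
    o21 (K.q X Y) Z ≫ o11 (K.wr f Y).1 Z = o11 f.1 (Y.V ⊗ Z) ≫ o21 (K.q X' Y) Z := K.wrg_o f Y Z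
theorem wl_o (X : Bicomod L δ ε) {Y Y' : Bicomod L δ ε} (f : Y ⟶ Y') (Z : C) :
    o21 (K.q X Y) Z ≫ o11 (K.wl X f).1 Z = X.V ◁ o11 f.1 Z ≫ o21 (K.q X Y') Z := K.wlg_o X f Z
theorem as_o (X Y W : Bicomod L δ ε) (Z : C) : o21 (K.q X Y) (W.V ⊗ Z) ≫ o21 (K.q (K.tens X Y) W) Z ≫ o11 (K.as X Y W).hom.1 Z =
    X.V ◁ o21 (K.q Y W) Z ≫ o21 (K.q X (K.tens Y W)) Z := K.ga_o X Y W Z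
theorem lu_o (X : Bicomod L δ ε) (Z : C) : o21 (K.ql X) Z ≫ o11 (K.lu X).hom.1 Z = sg μ ε X.lco Z := K.gl_o X Z
theorem ru_o (X : Bicomod L δ ε) (Z : C) : o21 (K.qr X) Z ≫ o11 (K.ru X).hom.1 Z = sr μ ε X.rco Z := K.gr_o X Z
theorem wl_l {Y Y' : Bicomod L δ ε} (f : Y ⟶ Y') (Z : C) :
    o21 (K.ql Y) Z ≫ o11 (K.wl K.un f).1 Z = L ◁ o11 f.1 Z ≫ o21 (K.ql Y') Z := K.wlg_o K.un f Z
theorem wr_r {Y Y' : Bicomod L δ ε} (f : Y ⟶ Y') (Z : C) :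
    o21 (K.qr Y) Z ≫ o11 (K.wr f K.un).1 Z = o11 f.1 (L ⊗ Z) ≫ o21 (K.qr Y') Z := K.wrg_o f K.un Z
theorem as_t (X W : Bicomod L δ ε) (Z : C) : o21 (K.qr X) (W.V ⊗ Z) ≫ o21 (K.q (K.tens X K.un) W) Z ≫ o11 (K.as X K.un W).hom.1 Z =
    X.V ◁ o21 (K.ql W) Z ≫ o21 (K.q X (K.tens K.un W)) Z := K.ga_o X K.un W Z
theorem bext {X Y : Bicomod L δ ε} {f g : X ⟶ Y} (h : o11 f.1 (𝟙_ C) = o11 g.1 (𝟙_ C)) : f = g := Subtype.ext (ext11 h)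
theorem bext2 {X Y B : Bicomod L δ ε} {f g : K.tens X Y ⟶ B} (h : o21 (K.q X Y) (𝟙_ C) ≫ o11 f.1 (𝟙_ C) = o21 (K.q X Y) (𝟙_ C) ≫ o11 g.1 (𝟙_ C)) : f = g :=
  K.bext ((cancel_epi _).1 h)
theorem w_ex {X X' Y Y' : Bicomod L δ ε} (f : X ⟶ X') (g : Y ⟶ Y') : K.wr f Y ≫ K.wl X' g = K.wl X g ≫ K.wr f Y' := by
  apply K.bext2
  rw [o11c, o11c, reassoc_of% (K.wr_o f Y), K.wl_o, reassoc_of% (K.wl_o X g), K.wr_o]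
  simp
/-- the monoidal structure on bicomodules, data -/
@[reducible] noncomputable def mst : MonoidalCategoryStruct (Bicomod L δ ε) where
  tensorObj := K.tens
  whiskerLeft X _ _ f := K.wl X f
  whiskerRight f Y := K.wr f Y
  tensorHom {X₁ Y₁ X₂ Y₂} f g := K.wr f X₂ ≫ K.wl Y₁ g
  tensorUnit := K.un
  associator := K.as
  leftUnitor := K.lu
  rightUnitor := K.ru
theorem wl_id (X Y : Bicomod L δ ε) : K.wl X (𝟙 Y) = 𝟙 _ := by
  apply K.bext2
  rw [K.wl_o, o11i, o11i]; simp
theorem wr_id (X Y : Bicomod L δ ε) : K.wr (𝟙 X) Y = 𝟙 _ := by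
  apply K.bext2
  rw [K.wr_o, o11i, o11i]; simp
theorem wl_comp (X : Bicomod L δ ε) {Y Y' Y'' : Bicomod L δ ε} (f : Y ⟶ Y') (g : Y' ⟶ Y'') : K.wl X (f ≫ g) = K.wl X f ≫ K.wl X g := by
  apply K.bext2
  rw [K.wl_o, o11c, o11c, reassoc_of% (K.wl_o X f), K.wl_o]; simp
theorem wr_comp (X : Bicomod L δ ε) {Y Y' Y'' : Bicomod L δ ε} (f : Y ⟶ Y') (g : Y' ⟶ Y'') : K.wr (f ≫ g) X = K.wr f X ≫ K.wr g X := by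
  apply K.bext2
  rw [K.wr_o, o11c, o11c, reassoc_of% (K.wr_o f X), K.wr_o]; simp
theorem as_nat {X X' Y Y' W W' : Bicomod L δ ε} (f : X ⟶ X') (g : Y ⟶ Y') (h : W ⟶ W') :
    (K.wr (K.wr f Y ≫ K.wl X' g) W ≫ K.wl (K.tens X' Y') h) ≫ (K.as X' Y' W').hom =
    (K.as X Y W).hom ≫ K.wr f (K.tens Y W) ≫ K.wl X' (K.wr g W ≫ K.wl Y' h) := by
  apply K.bext
  rw [← cancel_epi (o21 (K.q (K.tens X Y) W) _), ← cancel_epi (o21 (K.q X Y) _)]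
  simp only [o11c]
  have a1 := congrArg (fun t => X.V ◁ t ≫ X.V ◁ o11 (K.wl Y' h).1 _ ≫ o11 f.1 _ ≫ o21 (K.q X' (K.tens Y' W')) (𝟙_ C)) (K.wr_o g W (𝟙_ C))
  have a2 := congrArg (fun t => X.V ◁ o11 g.1 _ ≫ X.V ◁ t ≫ o11 f.1 _ ≫ o21 (K.q X' (K.tens Y' W')) (𝟙_ C)) (K.wl_o Y' h (𝟙_ C))
  have b1 := K.wr_o (K.wr f Y ≫ K.wl X' g) W (𝟙_ C)
  have b2 := K.wl_o (K.tens X' Y') h (𝟙_ C)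
  have b3 := K.wr_o f Y (W.V ⊗ 𝟙_ C)
  have b4 := K.wl_o X' g (W.V ⊗ 𝟙_ C)
  simp only [o11c] at b1 b2
  simp only [assoc]
  rw [reassoc_of% (K.as_o X Y W), reassoc_of% b1, reassoc_of% b2]
  rw [reassoc_of% b3, reassoc_of% b4, reassoc_of% (K.wr_o f (K.tens Y W)), K.wl_o]
  simp only [o11c]
  have h5 := K.as_o X' Y' W' (𝟙_ C)
  simp at a1 a2 ⊢
  rw [h5]
  simp
  rw [a1, a2]
theorem pent (W X Y U : Bicomod L δ ε) : K.wr (K.as W X Y).hom U ≫ (K.as W (K.tens X Y) U).hom ≫ K.wl W (K.as X Y U).hom =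
    (K.as (K.tens W X) Y U).hom ≫ (K.as W X (K.tens Y U)).hom := by
  apply K.bext
  rw [← cancel_epi (o21 (K.q (K.tens (K.tens W X) Y) U) _), ← cancel_epi (o21 (K.q (K.tens W X) Y) _), ← cancel_epi (o21 (K.q W X) _)]
  simp only [o11c]
  have h1 := congrArg (fun t => W.V ◁ t ≫ o21 (K.q W (K.tens X (K.tens Y U))) (𝟙_ C)) (K.as_o X Y U (𝟙_ C))
  have h2 := K.as_o W X (K.tens Y U) (𝟙_ C)
  rw [reassoc_of% (K.wr_o _ U), reassoc_of% (K.as_o W X Y), reassoc_of% (K.as_o W (K.tens X Y) U), K.wl_o]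
  rw [reassoc_of% (K.as_o (K.tens W X) Y U)]
  simp at h1 ⊢
  rw [h1, h2]
omit [IsIdempotentComplete C] in
theorem m1 (Z : C) : o21 μ Z = o12 δ _ ≫ L ◁ o21 μ Z ≫ L ◁ o10 ε Z := by
  rw [← reassoc_of% (K.f2 Z), ← reassoc_of% (K.f1 Z), K.c2, comp_id]
omit [IsIdempotentComplete C] in
theorem m2 (Z : C) : o21 μ Z = L ◁ o12 δ _ ≫ o21 μ _ ≫ o10 ε _ := by
  rw [← reassoc_of% (K.f1 Z), K.c1, comp_id]
omit [IsIdempotentComplete C] in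
theorem mas (Z : C) : L ◁ o21 μ Z ≫ o21 μ Z ≫ o10 ε Z = o21 μ _ ≫ o21 μ Z ≫ o10 ε Z := by
  have h1 := congrArg (fun t => L ◁ t ≫ o21 μ Z ≫ o10 ε Z) (K.m1 Z)
  have h2 := K.m2 (L ⊗ Z) =≫ (o21 μ Z ≫ o10 ε Z)
  simp at h1 h2 ⊢
  rw [h1, h2]
omit [IsIdempotentComplete C] in
theorem sgas (X : Bicomod L δ ε) (Z : C) : L ◁ sg μ ε X.lco Z ≫ sg μ ε X.lco Z = o21 μ _ ≫ sg μ ε X.lco Z := by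
  have h1 := congrArg (fun t => L ◁ t ≫ o21 μ _ ≫ o10 ε _) (K.g2a X Z)
  have h2 := L ◁ L ◁ o12 X.lco Z ≫= K.mas (X.V ⊗ Z)
  simp [sg] at h1 h2 ⊢
  rw [h1, h2]
theorem bal (X Y : Bicomod L δ ε) (Z : C) : X.V ◁ sg μ ε Y.lco Z ≫ o21 (K.q X Y) Z = sr μ ε X.rco (Y.V ⊗ Z) ≫ o21 (K.q X Y) Z := by
  have h1 := X.V ◁ sg μ ε Y.lco Z ≫= K.Sq X Y Z
  have h2 := sr μ ε X.rco (Y.V ⊗ Z) ≫= K.Sq X Y Z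
  have h3 := congrArg (fun t => o12 X.rco _ ≫ X.V ◁ t ≫ o21 (K.q X Y) Z) (K.sgas Y Z)
  have h4 := K.r2a X (Y.V ⊗ Z) =≫ (X.V ◁ sg μ ε Y.lco Z ≫ o21 (K.q X Y) Z)
  simp [sz] at h1 h2 h3 h4 ⊢
  rw [← h1, ← h2, h3, h4]
theorem tri (X Y : Bicomod L δ ε) : (K.as X K.un Y).hom ≫ K.wl X (K.lu Y).hom = K.wr (K.ru X).hom Y := by
  apply K.bext
  rw [← cancel_epi (o21 (K.q (K.tens X K.un) Y) _), ← cancel_epi (o21 (K.qr X) _)]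
  simp only [o11c]
  have h1 := congrArg (fun t => X.V ◁ t ≫ o21 (K.q X Y) (𝟙_ C)) (K.lu_o Y (𝟙_ C))
  rw [reassoc_of% (K.as_t X Y), K.wl_o, K.wr_o, reassoc_of% (K.ru_o X)]
  simp at h1
  rw [h1, K.bal]
/-- the monoidal structure on bicomodules -/
@[reducible] noncomputable def mon : MonoidalCategory (Bicomod L δ ε) :=
  { K.mst with
    tensorHom_def := fun _ _ => rfl
    id_tensorHom_id := fun X Y => by
      change K.wr _ _ ≫ K.wl _ _ = 𝟙 (K.tens X Y)
      rw [K.wr_id, K.wl_id, comp_id]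
    tensorHom_comp_tensorHom := fun {X₁ Y₁ Z₁ X₂ Y₂ Z₂} f₁ f₂ g₁ g₂ => by
      change (K.wr f₁ X₂ ≫ K.wl Y₁ f₂) ≫ (K.wr g₁ _ ≫ K.wl _ g₂) = K.wr (f₁ ≫ g₁) _ ≫ K.wl _ (f₂ ≫ g₂)
      rw [K.wr_comp, K.wl_comp]
      simp only [assoc]
      rw [← reassoc_of% (K.w_ex g₁ f₂)]
    whiskerLeft_id := K.wl_id
    id_whiskerRight := K.wr_id
    associator_naturality := fun f g h => K.as_nat f g h
    leftUnitor_naturality := fun {X Y} f => by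
      change K.wl K.un f ≫ (K.lu Y).hom = (K.lu X).hom ≫ f
      apply K.bext
      rw [← cancel_epi (o21 (K.ql X) _)]
      simp only [o11c]
      rw [reassoc_of% (K.wl_l f), K.lu_o, reassoc_of% (K.lu_o X), K.sgnat]
    rightUnitor_naturality := fun {X Y} f => by
      change K.wr f K.un ≫ (K.ru Y).hom = (K.ru X).hom ≫ f
      apply K.bext
      rw [← cancel_epi (o21 (K.qr X) _)]
      simp only [o11c]
      rw [reassoc_of% (K.wr_r f), K.ru_o, reassoc_of% (K.ru_o X), K.srnat]
    pentagon := fun W X Y Z => K.pent W X Y Z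
    triangle := fun X Y => K.tri X Y }
end CS

end

section
theorem REpi.of_comp {X Y T : C} (f : X ⟶ Y) (g : Y ⟶ T) [Epi f] (h : REpi (f ≫ g)) : REpi g := by
  obtain ⟨r⟩ := h.re
  refine ⟨⟨⟨r.W, r.left ≫ f, r.right ≫ f, by simpa using r.w, ?_⟩⟩⟩
  refine Cofork.IsColimit.mk' _ fun s => ?_
  have hs : r.left ≫ f ≫ s.π = r.right ≫ f ≫ s.π := by simpa using s.condition
  obtain ⟨l, hl⟩ := RegularEpi.desc' r (f ≫ s.π) hs
  have hl' : g ≫ l = s.π := by rw [← cancel_epi f, ← hl, assoc]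
  refine ⟨l, hl', fun {m} hm => ?_⟩
  have : Epi (f ≫ g) := r.epi
  rw [← cancel_epi (f ≫ g), assoc, assoc, hl']
  congr 1
/-- bicomodules underlying modules -/
class BM {A : C} {𝒴 : Set C} (S : RWMB A 𝒴) {L : C} {δ : L ⟶ L ⊗ L} {ε : L ⟶ 𝟙_ C} (τ : A ⟶ L ⊗ A) (τbar : A ⟶ A ⊗ L)
    (X : Bicomod L δ ε) (v : A ⊗ X.V ⟶ X.V) : Prop where
  mdl : Mdl S v
  mem : InY 𝒴 X.V
  re : REpi v
  ta : IsTau τ v X.lco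
  tb : IsTaub τbar v X.rco
namespace LH
variable {A : C} {𝒴 : Set C} {S : RWMB A 𝒴} {L : C} {p : A ⟶ L} {n₁ : L ⊗ A ⟶ A} {n₂ : A ⊗ L ⟶ A}
    {μ : L ⊗ L ⟶ L} {δ : L ⟶ L ⊗ L} {ε : L ⟶ 𝟙_ C} {τ : A ⟶ L ⊗ A} {τbar : A ⟶ A ⊗ L}
    (H : LH S p n₁ n₂ μ δ ε τ τbar)
include H
variable [YCl 𝒴] [InY 𝒴 A] [InY 𝒴 L] [PresRE C] [REpi S.m] [REpi p]
theorem cs : CS μ δ ε where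
  md := H.zmd
  co := H.delco
  c1 := H.delc1
  c2 := H.delc2
  f1 := by
    intro Z
    have h := (L ◁ (ρ_ L).inv ≫= H.F1 (𝟙_ C)) =≫ L ◁ (ρ_ L).hom
    have h' : μ ≫ δ = L ◁ δ ≫ (α_ _ _ _).inv ≫ μ ▷ L := by
      convert h using 1 <;> (simp only [o12, o21]; monoidal)
    convert zl22 h' Z using 1 <;> (simp only [o21, o12, o22]; monoidal)
  f2 := by
    intro Z
    have h := (L ◁ (ρ_ L).inv ≫= H.F2 (𝟙_ C)) =≫ L ◁ (ρ_ L).hom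
    have h' : L ◁ δ ≫ (α_ _ _ _).inv ≫ μ ▷ L = δ ▷ L ≫ (α_ _ _ _).hom ≫ L ◁ μ := by
      convert h using 1 <;> (simp only [o12, o21]; monoidal)
    convert zl22 h' Z using 1 <;> (simp only [o21, o12, o22]; monoidal)
end LH
/-- the action on two strands -/
def bp {A V W : C} (T : A ⊗ V ⟶ V ⊗ A) (w : A ⊗ W ⟶ W) : A ⊗ (V ⊗ W) ⟶ V ⊗ W :=
  (α_ _ _ _).inv ≫ T ▷ W ≫ (α_ _ _ _).hom ≫ V ◁ w
theorem bp_o {A V W : C} (T : A ⊗ V ⟶ V ⊗ A) (w : A ⊗ W ⟶ W) (Z : C) : o32 (bp T w) Z = bz T w Z := by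
  simp only [bp, bz, o32, o21, o22]; monoidal
theorem bp_o1 {A V W : C} (T : A ⊗ V ⟶ V ⊗ A) (w : A ⊗ W ⟶ W) : A ◁ V ◁ (ρ_ W).inv ≫ bz T w (𝟙_ C) ≫ V ◁ (ρ_ W).hom = bp T w := by
  simp only [bp, bz, o21, o22]; monoidal
theorem sIdem_o1 {L V W : C} (μ : L ⊗ L ⟶ L) (ε : L ⟶ 𝟙_ C) (tb : V ⟶ V ⊗ L) (tW : W ⟶ L ⊗ W) :
    sIdem μ ε tb tW ≫ V ◁ (ρ_ W).inv = V ◁ (ρ_ W).inv ≫ sz μ ε tb tW (𝟙_ C) := by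
  rw [← sIdem_o22]; simp only [o22]; monoidal
namespace CS
variable {L : C} {μ : L ⊗ L ⟶ L} {δ : L ⟶ L ⊗ L} {ε : L ⟶ 𝟙_ C} (K : CS μ δ ε) [IsIdempotentComplete C]
variable {A : C} (X Y : Bicomod L δ ε) (T : A ⊗ X.V ⟶ X.V ⊗ A) (U : A ⊗ Y.V ⟶ Y.V ⊗ A) (w : A ⊗ Y.V ⟶ Y.V)
/-- the action on the tensor product -/
noncomputable def b : A ⊗ (K.tens X Y).V ⟶ (K.tens X Y).V := A ◁ K.i X Y ≫ bp T w ≫ K.q X Y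
theorem b_o0 (Z : C) : o21 (K.b X Y T w) Z = A ◁ o12 (K.i X Y) Z ≫ bz T w Z ≫ o21 (K.q X Y) Z := by
  rw [← bp_o]; simp only [b, o32, o21, o12]; monoidal
/-- the twist on the tensor product -/
noncomputable def TT : A ⊗ (K.tens X Y).V ⟶ (K.tens X Y).V ⊗ A :=
  A ◁ K.i X Y ≫ (α_ _ _ _).inv ≫ T ▷ _ ≫ (α_ _ _ _).hom ≫ X.V ◁ U ≫ (α_ _ _ _).inv ≫ K.q X Y ▷ A
theorem TT_o0 (Z : C) : o22 (K.TT X Y T U) Z = A ◁ o12 (K.i X Y) Z ≫ o22 T _ ≫ X.V ◁ o22 U Z ≫ o21 (K.q X Y) (A ⊗ Z) := by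
  simp only [TT, o22, o21, o12]; monoidal
end CS
namespace LH
variable {A : C} {𝒴 : Set C} {S : RWMB A 𝒴} {L : C} {p : A ⟶ L} {n₁ : L ⊗ A ⟶ A} {n₂ : A ⊗ L ⟶ A}
    {μ : L ⊗ L ⟶ L} {δ : L ⟶ L ⊗ L} {ε : L ⟶ 𝟙_ C} {τ : A ⟶ L ⊗ A} {τbar : A ⟶ A ⊗ L}
    (H : LH S p n₁ n₂ μ δ ε τ τbar) (K : CS μ δ ε) [IsIdempotentComplete C]
include H
variable [YCl 𝒴] [InY 𝒴 A] [InY 𝒴 L] [PresRE C] [REpi S.m] [REpi p]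
variable {X Y : Bicomod L δ ε} {v : A ⊗ X.V ⟶ X.V} [hX : BM S τ τbar X v] {w : A ⊗ Y.V ⟶ Y.V} [hY : BM S τ τbar Y w]
variable {T : A ⊗ X.V ⟶ X.V ⊗ A} {U : A ⊗ Y.V ⟶ Y.V ⊗ A}
theorem z4 (hT : S.IsT v T) (Z : C) : bz T w Z ≫ sz μ ε X.rco Y.lco Z = bz T w Z := by
  have := hX.mdl; have := hX.mem; have := hX.re; have := hY.mdl; have := hY.mem; have := hY.re
  have h : bp T w ≫ sIdem μ ε X.rco Y.lco = bp T w := by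
    rw [← bp_o1 T w, ← cancel_mono (_ ◁ (ρ_ _).inv)]
    simp only [assoc, sIdem_o1]
    have h := H.S4 (w := w) hT hX.tb hY.ta (𝟙_ C)
    simp [h]
  have h2 := zl32 h Z
  simp only [← bp_o, ← sIdem_o22]
  convert h2 using 1 <;> (simp only [o32, o22]; try monoidal)
theorem z5 (hT : S.IsT v T) (Z : C) : A ◁ sz μ ε X.rco Y.lco Z ≫ bz T w Z = bz T w Z := by
  have := hX.mdl; have := hX.mem; have := hX.re; have := hY.mdl; have := hY.mem; have := hY.re
  have h : A ◁ sIdem μ ε X.rco Y.lco ≫ bp T w = bp T w := by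
    rw [← bp_o1 T w, ← whiskerLeft_comp_assoc, sIdem_o1]
    have h := H.S5 (w := w) hT hX.tb hY.ta (𝟙_ C)
    simp [reassoc_of% h]
  have h2 := zl32 h Z
  simp only [← bp_o, ← sIdem_o22]
  convert h2 using 1 <;> (simp only [o32, o22]; try monoidal)
theorem b_o (hT : S.IsT v T) (Z : C) : A ◁ o21 (K.q X Y) Z ≫ o21 (K.b X Y T w) Z = bz T w Z ≫ o21 (K.q X Y) Z := by
  rw [K.b_o0, ← whiskerLeft_comp_assoc, K.Qi, ← reassoc_of% (H.z5 (w := w) hT Z)]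
  simp only [reassoc_of% (H.z5 (w := w) hT Z)]
theorem b_assoc (hT : S.IsT v T) (Z : C) : A ◁ o21 (K.b X Y T w) Z ≫ o21 (K.b X Y T w) Z = o21 S.m _ ≫ o21 (K.b X Y T w) Z := by
  have := hX.mdl; have := hX.mem; have := hX.re; have := hY.mdl; have := hY.mem; have := hY.re
  rw [← cancel_epi (A ◁ A ◁ o21 (K.q X Y) Z)]
  have h1 := congrArg (fun t => A ◁ t ≫ o21 (K.b X Y T w) Z) (H.b_o K (w := w) hT Z)
  have h2 := o21 S.m _ ≫= (H.b_o K (w := w) hT Z)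
  have h3 := A ◁ bz T w Z ≫= (H.b_o K (w := w) hT Z)
  have h4 := hT.bassoc (w := w) Z =≫ o21 (K.q X Y) Z
  simp [-whiskerLeft_comp] at h2
  simp [bz] at h1 h2 h3 h4 ⊢
  rw [h1, h3, h4, h2]
end LH

end

section
/-- splitting one operation through an intermediate object -/
theorem o32_split {P Q Q' R T E : C} (f : P ⊗ (Q ⊗ Q') ⟶ R ⊗ T) (h : R ⊗ T ⟶ E) (k : E ⟶ R ⊗ T) (Z : C) :
    o32 f Z ≫ o22 (h ≫ k) Z = (P ◁ (α_ Q Q' Z).inv ≫ (α_ _ _ _).inv ≫ (f ≫ h) ▷ Z) ≫ k ▷ Z ≫ (α_ _ _ _).hom := by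
  simp only [o32, o22]; monoidal
theorem o22_split {R T E : C} (h : R ⊗ T ⟶ E) (k : E ⟶ R ⊗ T) (Z : C) :
    o22 (h ≫ k) Z = ((α_ _ _ _).inv ≫ h ▷ Z) ≫ k ▷ Z ≫ (α_ _ _ _).hom := by
  simp only [o22]; monoidal
namespace LH
variable {A : C} {𝒴 : Set C} {S : RWMB A 𝒴} {L : C} {p : A ⟶ L} {n₁ : L ⊗ A ⟶ A} {n₂ : A ⊗ L ⟶ A}
    {μ : L ⊗ L ⟶ L} {δ : L ⟶ L ⊗ L} {ε : L ⟶ 𝟙_ C} {τ : A ⟶ L ⊗ A} {τbar : A ⟶ A ⊗ L}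
    (H : LH S p n₁ n₂ μ δ ε τ τbar) (K : CS μ δ ε) [IsIdempotentComplete C]
include H
variable [YCl 𝒴] [InY 𝒴 A] [InY 𝒴 L] [PresRE C] [REpi S.m] [REpi p]
variable {X Y : Bicomod L δ ε} {v : A ⊗ X.V ⟶ X.V} [hX : BM S τ τbar X v] {w : A ⊗ Y.V ⟶ Y.V} [hY : BM S τ τbar Y w]
variable {T : A ⊗ X.V ⟶ X.V ⊗ A} {U : A ⊗ Y.V ⟶ Y.V ⊗ A}
theorem b_re {E₁ : C} {eHat₁ : A ⊗ A ⟶ E₁} {eCheck₁ : E₁ ⟶ A ⊗ A}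
    (he₁ : eHat₁ ≫ eCheck₁ = S.e₁) (he₁' : eCheck₁ ≫ eHat₁ = 𝟙 E₁) [REpi (dOne S.m S.t₁ ≫ eHat₁)]
    (hT : S.IsT v T) : REpi (K.b X Y T w) := by
  have := hX.mdl; have := hX.mem; have := hX.re; have := hY.mdl; have := hY.mem; have := hY.re
  have := RWMB.repiAp (v := v) (w := w) (𝟙_ C)
  have hq : REpi (o21 (K.q X Y) (𝟙_ C)) := REpi.of_split _ _ (K.Iq X Y _)
  have hs1 : ap v w (𝟙_ C) ≫ o21 (K.q X Y) (𝟙_ C) = o22 S.e₁ _ ≫ ap v w (𝟙_ C) ≫ o21 (K.q X Y) (𝟙_ C) := by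
    have h := H.S1 (v := v) (w := w) hX.tb hY.ta (𝟙_ C) =≫ o21 (K.q X Y) (𝟙_ C)
    simpa only [assoc, K.Sq] using h
  rw [← he₁] at hs1
  have hs2 := hs1
  rw [o22_split, assoc] at hs2
  have hr2 : REpi ((eCheck₁ ▷ _ ≫ (α_ _ _ _).hom) ≫ ap v w (𝟙_ C) ≫ o21 (K.q X Y) (𝟙_ C)) := by
    have : Epi ((α_ A A (X.V ⊗ Y.V ⊗ 𝟙_ C)).inv ≫ eHat₁ ▷ (X.V ⊗ Y.V ⊗ 𝟙_ C)) := by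
      have : REpi eHat₁ := REpi.of_split _ _ he₁'
      have := repiWr eHat₁ (X.V ⊗ Y.V ⊗ 𝟙_ C)
      infer_instance
    apply REpi.of_comp ((α_ _ _ _).inv ≫ eHat₁ ▷ _)
    rw [assoc]
    rw [assoc] at hs2 
    rw [← hs2]
    exact repiComp _ _
  have h3 := A ◁ ap v w (𝟙_ C) ≫= H.b_o K (w := w) hT (𝟙_ C)
  rw [reassoc_of% (hT.ap_bz (w := w) (𝟙_ C)), hs1, S.dd1_eq32, reassoc_of% (o32_split (dOne S.m S.t₁) eHat₁ eCheck₁)] at h3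
  have h4 : REpi (o21 (K.b X Y T w) (𝟙_ C)) := by
    apply REpi.of_comp (A ◁ o21 (K.q X Y) (𝟙_ C))
    apply REpi.of_comp (A ◁ ap v w (𝟙_ C))
    rw [h3]
    have := repiWr (dOne S.m S.t₁ ≫ eHat₁) (X.V ⊗ Y.V ⊗ 𝟙_ C)
    have := repiIso (A ◁ (α_ A A (X.V ⊗ Y.V ⊗ 𝟙_ C)).inv ≫ (α_ _ _ _).inv)
    have := repiComp (A ◁ (α_ A A (X.V ⊗ Y.V ⊗ 𝟙_ C)).inv ≫ (α_ _ _ _).inv) ((dOne S.m S.t₁ ≫ eHat₁) ▷ (X.V ⊗ Y.V ⊗ 𝟙_ C))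
    have := repiComp (A ◁ (α_ A A (X.V ⊗ Y.V ⊗ 𝟙_ C)).inv ≫ (α_ _ _ _).inv ≫ ((dOne S.m S.t₁ ≫ eHat₁) ▷ (X.V ⊗ Y.V ⊗ 𝟙_ C))) ((eCheck₁ ▷ _ ≫ (α_ _ _ _).hom) ≫ ap v w (𝟙_ C) ≫ o21 (K.q X Y) (𝟙_ C)) (h := by simpa only [assoc] using this)
    simpa only [assoc] using this
  have h5 : K.b X Y T w = (A ◁ (ρ_ _).inv ≫ o21 (K.b X Y T w) (𝟙_ C)) ≫ (ρ_ _).hom := by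
    simp only [o21]; monoidal
  rw [h5]
  have := repiIso (A ◁ (ρ_ (K.tens X Y).V).inv)
  have := repiIso (ρ_ (K.tens X Y).V).hom
  have := repiComp (A ◁ (ρ_ (K.tens X Y).V).inv) (o21 (K.b X Y T w) (𝟙_ C))
  exact repiComp _ _
theorem b_nd {E₂ : C} {eHat₂ : A ⊗ A ⟶ E₂} {eCheck₂ : E₂ ⟶ A ⊗ A}
    (he₂ : eHat₂ ≫ eCheck₂ = S.e₂) (he₂' : eCheck₂ ≫ eHat₂ = 𝟙 E₂) [REpi (dTwo S.m S.t₂ ≫ eHat₂)]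
    (hT : S.IsT v T) : NdLeftOn (K.b X Y T w) 𝒴 := by
  have := hX.mdl; have := hX.mem; have := hX.re; have := hY.mdl; have := hY.mem; have := hY.re
  intro B Z hZ f g hfg
  have : InY 𝒴 Z := ⟨hZ⟩
  change A ◁ f ≫ o21 (K.b X Y T w) Z = A ◁ g ≫ o21 (K.b X Y T w) Z at hfg
  have e1 : ∀ f : B ⟶ (K.tens X Y).V ⊗ Z, (A ◁ f ≫ o21 (K.b X Y T w) Z) ≫ o12 (K.i X Y) Z =
      A ◁ (f ≫ o12 (K.i X Y) Z) ≫ bz T w Z := by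
    intro f
    rw [K.b_o0]
    simp only [assoc, K.Qi, H.z4 (w := w) hT, whiskerLeft_comp]
  have e2 : A ◁ (f ≫ o12 (K.i X Y) Z) ≫ bz T w Z = A ◁ (g ≫ o12 (K.i X Y) Z) ≫ bz T w Z := by
    rw [← e1, ← e1, hfg]
  have e3 : ∀ f : B ⟶ (K.tens X Y).V ⊗ Z, A ◁ A ◁ (A ◁ (f ≫ o12 (K.i X Y) Z) ≫ bz T w Z) ≫ ap v w Z =
      S.dd2 _ ≫ (A ◁ A ◁ (f ≫ o12 (K.i X Y) Z) ≫ ap v w Z) := by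
    intro f
    have h := A ◁ A ◁ A ◁ (f ≫ o12 (K.i X Y) Z) ≫= hT.S3 (w := w) Z
    simp [RWMB.dd2] at h ⊢
    rw [h]
  have e4 : ∀ f : B ⟶ (K.tens X Y).V ⊗ Z, A ◁ A ◁ (f ≫ o12 (K.i X Y) Z) ≫ ap v w Z =
      o22 (eHat₂ ≫ eCheck₂) _ ≫ A ◁ A ◁ (f ≫ o12 (K.i X Y) Z) ≫ ap v w Z := by
    intro f
    have h := A ◁ A ◁ (f ≫ o12 (K.i X Y) Z) ≫= H.S2 (v := v) (w := w) hX.tb hY.ta Z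
    have h2 := congrArg (fun t => A ◁ A ◁ (f ≫ t) ≫ ap v w Z) (K.Is X Y Z)
    rw [he₂]
    simp at h h2 ⊢
    rw [← h2, h]
  have e5 := congrArg (fun t => A ◁ A ◁ t ≫ ap v w Z) e2
  beta_reduce at e5
  rw [e3, e3, e4 f, e4 g, S.dd2_eq, reassoc_of% (o32_split (dTwo S.m S.t₂) eHat₂ eCheck₂), reassoc_of% (o32_split (dTwo S.m S.t₂) eHat₂ eCheck₂)] at e5
  have := repiWr (dTwo S.m S.t₂ ≫ eHat₂) B
  have e6 := (cancel_epi (A ◁ (α_ A A B).inv ≫ (α_ _ _ _).inv ≫ ((dTwo S.m S.t₂ ≫ eHat₂) ▷ B))).1 (by simpa only [assoc] using e5)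
  have e7 : A ◁ A ◁ (f ≫ o12 (K.i X Y) Z) ≫ ap v w Z = A ◁ A ◁ (g ≫ o12 (K.i X Y) Z) ≫ ap v w Z := by
    rw [e4 f, e4 g, o22_split]; simp only [assoc]; rw [e6]
  have e8 := S.apND v w e7 =≫ o21 (K.q X Y) Z
  simpa only [assoc, K.Iq, comp_id] using e8
theorem b_tau (hT : S.IsT v T) : IsTau τ (K.b X Y T w) (K.tens X Y).lco := by
  have := hX.mdl; have := hX.mem; have := hX.re; have := hY.mdl; have := hY.mem; have := hY.re
  have h : ∀ Z [InY 𝒴 Z], o21 (K.b X Y T w) Z ≫ o12 (K.tens X Y).lco Z = o12 τ _ ≫ L ◁ o21 (K.b X Y T w) Z := by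
    intro Z _
    rw [← cancel_epi (A ◁ o21 (K.q X Y) Z)]
    have h1 := H.b_o K (w := w) hT Z =≫ o12 (K.tens X Y).lco Z
    have h2 := bz T w Z ≫= K.Ql X Y Z
    have h3 := H.lcoT (w := w) hT hX.ta Z =≫ L ◁ o21 (K.q X Y) Z
    have h4 := congrArg (fun t => o12 τ _ ≫ L ◁ t) (H.b_o K (w := w) hT Z)
    simp [bz] at h1 h2 h3 h4 ⊢
    rw [h1, h2, h3, h4]
  apply IsTau.mk
  have h1 := (A ◁ (ρ_ _).inv ≫= h (𝟙_ C)) =≫ (L ◁ (ρ_ _).hom)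
  convert h1 using 1 <;> (simp only [o12, o21]; monoidal)
theorem b_taub (hT : S.IsT v T) : IsTaub τbar (K.b X Y T w) (K.tens X Y).rco := by
  have := hX.mdl; have := hX.mem; have := hX.re; have := hY.mdl; have := hY.mem; have := hY.re
  have h : ∀ Z [InY 𝒴 Z], o21 (K.b X Y T w) Z ≫ o12 (K.tens X Y).rco Z = o12 τbar _ ≫ A ◁ br L _ Z ≫ o21 (K.b X Y T w) (L ⊗ Z) := by
    intro Z _
    rw [← cancel_epi (A ◁ o21 (K.q X Y) Z)]
    have h1 := H.b_o K (w := w) hT Z =≫ o12 (K.tens X Y).rco Z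
    have h2 := bz T w Z ≫= K.Qr X Y Z
    have h3 := H.rcoT (w := w) hT hY.tb Z =≫ o21 (K.q X Y) (L ⊗ Z)
    have h4 := congrArg (fun t => o12 τbar _ ≫ A ◁ br L X.V _ ≫ A ◁ X.V ◁ br L Y.V _ ≫ t) (H.b_o K (w := w) hT (L ⊗ Z))
    have h5 := congrArg (fun t => o12 τbar _ ≫ A ◁ t ≫ o21 (K.b X Y T w) (L ⊗ Z)) (sL21 (K.q X Y) L Z)
    simp [bz] at h1 h2 h3 h4 h5 ⊢
    rw [h1, h2, h3, h5, h4]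
  apply IsTaub.mk
  have h1 := (A ◁ (ρ_ _).inv ≫= h (𝟙_ C)) =≫ (_ ◁ (ρ_ _).hom)
  convert h1 using 1 <;> (simp only [o12, o21, br, o22]; monoidal)
theorem b_T (hT : S.IsT v T) (hU : S.IsT w U) : S.IsT (K.b X Y T w) (K.TT X Y T U) := by
  have := hX.mdl; have := hX.mem; have := hX.re; have := hY.mdl; have := hY.mem; have := hY.re
  intro Z
  rw [← cancel_epi (A ◁ A ◁ o21 (K.q X Y) Z), K.TT_o0]
  have h1 := congrArg (fun t => A ◁ t ≫ A ◁ o12 (K.i X Y) Z ≫ o22 T _ ≫ X.V ◁ o22 U Z ≫ o21 (K.q X Y) (A ⊗ Z)) (H.b_o K (w := w) hT Z)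
  have h2 := congrArg (fun t => A ◁ bz T w Z ≫ A ◁ t ≫ o22 T _ ≫ X.V ◁ o22 U Z ≫ o21 (K.q X Y) (A ⊗ Z)) (K.Qi X Y Z)
  have h3 := congrArg (fun t => A ◁ t ≫ o22 T _ ≫ X.V ◁ o22 U Z ≫ o21 (K.q X Y) (A ⊗ Z)) (H.z4 (w := w) hT Z)
  have h4 := hT.TTb hU Z =≫ o21 (K.q X Y) (A ⊗ Z)
  have h5 := congrArg (fun t => o22 S.t5 _ ≫ A ◁ t ≫ o21 (K.b X Y T w) (A ⊗ Z)) (sL21 (K.q X Y) A Z)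
  have h6 := congrArg (fun t => o22 S.t5 _ ≫ A ◁ br A X.V _ ≫ A ◁ X.V ◁ br A Y.V _ ≫ t) (H.b_o K (w := w) hT (A ⊗ Z))
  simp [bz] at h1 h2 h3 h4 h5 h6 ⊢
  rw [h1, h2, h3, h4, h5, h6]
end LH

end

section
/-- the additional hypotheses on the idempotents and the class of objects -/
class DH {A : C} {𝒴 : Set C} (S : RWMB A 𝒴) : Prop where
  ret : ∀ (X Y : C), Y ∈ 𝒴 → ∀ (i : X ⟶ Y) (r : Y ⟶ X), i ≫ r = 𝟙 X → X ∈ 𝒴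
  d1 : ∃ (E : C) (h : A ⊗ A ⟶ E) (k : E ⟶ A ⊗ A), h ≫ k = S.e₁ ∧ k ≫ h = 𝟙 E ∧ REpi (dOne S.m S.t₁ ≫ h)
  d2 : ∃ (E : C) (h : A ⊗ A ⟶ E) (k : E ⟶ A ⊗ A), h ≫ k = S.e₂ ∧ k ≫ h = 𝟙 E ∧ REpi (dTwo S.m S.t₂ ≫ h)
theorem RWMB.IsT.uniq {A : C} {𝒴 : Set C} {S : RWMB A 𝒴} [PresRE C] {V V' : C} {v : A ⊗ V ⟶ V} {v' : A ⊗ V' ⟶ V'}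
    {T : A ⊗ V ⟶ V ⊗ A} {T' : A ⊗ V' ⟶ V' ⊗ A} [REpi v] (hT : S.IsT v T) (hT' : S.IsT v' T') (f : V ⟶ V') (hf : v ≫ f = A ◁ f ≫ v') (Z : C) :
    o22 T Z ≫ o11 f (A ⊗ Z) = A ◁ o11 f Z ≫ o22 T' Z := by
  have hf' : ∀ Z, o21 v Z ≫ o11 f Z = A ◁ o11 f Z ≫ o21 v' Z := by
    intro Z
    have := congrArg (fun t => (α_ _ _ _).inv ≫ t ▷ Z) hf
    convert this using 1 <;> (simp only [o21, o11]; monoidal)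
  rw [← cancel_epi (A ◁ o21 v Z)]
  have h1 := hT Z =≫ o11 f (A ⊗ Z)
  have h2 := A ◁ A ◁ o11 f Z ≫= hT' Z
  have h3 := congrArg (fun t => A ◁ t ≫ o22 T' Z) (hf' Z)
  have h4 := (o22 S.t5 _ ≫ A ◁ br A V Z) ≫= hf' (A ⊗ Z)
  have h5 := congrArg (fun t => o22 S.t5 _ ≫ A ◁ t ≫ o21 v' _) (sL11 f A Z)
  simp at h1 h2 h3 h4 h5 ⊢
  rw [h1, h3, h2, h4, h5]
theorem mdlA {A V : C} {m : A ⊗ A ⟶ A} {v : A ⊗ V ⟶ V} (h : A ◁ o21 v (𝟙_ C) ≫ o21 v (𝟙_ C) = o21 m _ ≫ o21 v (𝟙_ C)) :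
    A ◁ v ≫ v = o21 m V ≫ v := by
  have h1 := (A ◁ A ◁ (ρ_ _).inv ≫= h) =≫ (ρ_ _).hom
  convert h1 using 1 <;> (simp only [o21]; monoidal)
namespace LH
variable {A : C} {𝒴 : Set C} {S : RWMB A 𝒴} {L : C} {p : A ⟶ L} {n₁ : L ⊗ A ⟶ A} {n₂ : A ⊗ L ⟶ A}
    {μ : L ⊗ L ⟶ L} {δ : L ⟶ L ⊗ L} {ε : L ⟶ 𝟙_ C} {τ : A ⟶ L ⊗ A} {τbar : A ⟶ A ⊗ L}
    (H : LH S p n₁ n₂ μ δ ε τ τbar) (K : CS μ δ ε) [IsIdempotentComplete C]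
include H
variable [YCl 𝒴] [InY 𝒴 A] [InY 𝒴 L] [PresRE C] [REpi S.m] [REpi p]
/-- the bicomodule underlying a module -/
def bic {V : C} (v : A ⊗ V ⟶ V) [Mdl S v] [InY 𝒴 V] [REpi v] {tV : V ⟶ L ⊗ V} {tbV : V ⟶ V ⊗ L}
    (htV : IsTau τ v tV) (htb : IsTaub τbar v tbV) : Bicomod L δ ε where
  V := V
  lco := tV
  rco := tbV
  lcoassoc := H.mlcoa htV
  lcounit := H.mlcou htV
  rcoassoc := H.mrcoa htb
  rcounit := H.mrcou htb
  bicomm := H.mbico htV htb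
theorem bicM {V : C} (v : A ⊗ V ⟶ V) [Mdl S v] [InY 𝒴 V] [REpi v] {tV : V ⟶ L ⊗ V} {tbV : V ⟶ V ⊗ L}
    (htV : IsTau τ v tV) (htb : IsTaub τbar v tbV) : BM S τ τbar (H.bic v htV htb) v :=
  ⟨‹Mdl S v›, ‹InY 𝒴 V›, ‹REpi v›, htV, htb⟩
theorem tam : IsTau τ S.m τ := by
  apply IsTau.mk
  have h1 := (A ◁ (ρ_ _).inv ≫= H.taum (𝟙_ C)) =≫ (_ ◁ (ρ_ _).hom)
  convert h1 using 1 <;> (simp only [o12, o21, br, o22]; monoidal)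
theorem unMdl : Mdl S (n₂ ≫ p) where
  assoc := by
    apply mdlA
    rw [← cancel_epi (A ◁ A ◁ o11 p (𝟙_ C))]
    have h1 := congrArg (fun t => A ◁ t ≫ o21 (n₂ ≫ p) (𝟙_ C)) (H.zLp (𝟙_ C))
    have h2 := A ◁ o21 S.m (𝟙_ C) ≫= H.zLp (𝟙_ C)
    have h3 := o21 S.m _ ≫= H.zLp (𝟙_ C)
    have h4 := S.massoc (𝟙_ C) =≫ o11 p (𝟙_ C)
    generalize n₂ ≫ p = r at *
    simp [-whiskerLeft_comp] at h2 h3 h4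
    simp at h1 ⊢
    rw [h1, h2, ← h4, h3]
  nd := by
    intro B Z hZ f g hfg
    have : InY 𝒴 Z := ⟨hZ⟩
    apply H.NDe
    have h := hfg =≫ o10 ε Z
    have hh : o21 (n₂ ≫ p) Z ≫ o10 ε Z = o21 n₂ Z ≫ o10 S.j Z := by
      rw [← H.hε]; simp only [o21, o10]; monoidal
    change (A ◁ f ≫ o21 (n₂ ≫ p) Z) ≫ o10 ε Z = (A ◁ g ≫ o21 (n₂ ≫ p) Z) ≫ o10 ε Z at h
    simpa only [assoc, hh] using h
theorem unRe : REpi (n₂ ≫ p) := by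
  have h := (A ◁ (ρ_ _).inv ≫= H.zLp (𝟙_ C)) =≫ (ρ_ _).hom
  have h' : A ◁ p ≫ n₂ ≫ p = S.m ≫ p := by
    convert h using 1 <;> (simp only [o11, o21]; monoidal)
  apply REpi.of_comp (A ◁ p)
  rw [h']
  exact repiComp _ _
theorem unBM : BM S τ τbar (K.un : Bicomod L δ ε) (n₂ ≫ p) :=
  ⟨H.unMdl, ‹_›, H.unRe, H.tauL, H.taubL⟩
variable {X Y : Bicomod L δ ε} {v : A ⊗ X.V ⟶ X.V} [hX : BM S τ τbar X v] {w : A ⊗ Y.V ⟶ Y.V} [hY : BM S τ τbar Y w]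
variable {T : A ⊗ X.V ⟶ X.V ⊗ A} {U : A ⊗ Y.V ⟶ Y.V ⊗ A} [hD : DH S]
theorem tensBM (hT : S.IsT v T) : BM S τ τbar (K.tens X Y) (K.b X Y T w) where
  mdl := {
    assoc := by
      apply mdlA
      exact H.b_assoc K (w := w) hT (𝟙_ C)
    nd := by
      obtain ⟨E, h, k, h1, h2, h3⟩ := hD.d2
      exact H.b_nd K h1 h2 hT }
  mem := by
    have := hX.mem; have := hY.mem
    exact ⟨hD.ret _ (X.V ⊗ Y.V) InY.mem (K.i X Y) (K.q X Y) (K.Piq X Y)⟩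
  re := by
    obtain ⟨E, h, k, h1, h2, h3⟩ := hD.d1
    exact H.b_re K h1 h2 hT
  ta := H.b_tau K hT
  tb := H.b_taub K hT
theorem z6a (hT : S.IsT v T) (hU : S.IsT w U) {W : Bicomod L δ ε} {r : A ⊗ W.V ⟶ W.V} [hW : BM S τ τbar W r] (Z : C) :
    A ◁ sz μ ε X.rco Y.lco _ ≫ o22 T _ ≫ X.V ◁ bz U r Z = o22 T _ ≫ X.V ◁ bz U r Z := by
  have K := H.cs
  have hP := H.tensBM K (v := w) (w := r) hU
  have h5 := A ◁ X.V ◁ o21 (K.q Y W) Z ≫= H.z5 (Y := K.tens Y W) (w := K.b Y W U r) hT Z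
  have h6 : A ◁ X.V ◁ o21 (K.q Y W) Z ≫ bz T (K.b Y W U r) Z = o22 T _ ≫ X.V ◁ bz U r Z ≫ X.V ◁ o21 (K.q Y W) Z := by
    have h7 := congrArg (fun t => o22 T _ ≫ X.V ◁ t) (H.b_o K (w := r) hU Z)
    simp [bz] at h7 ⊢
    rw [h7]
  rw [← whiskerLeft_comp_assoc, K.Qsz', whiskerLeft_comp, assoc, h6] at h5
  have h8 := h5 =≫ X.V ◁ o12 (K.i Y W) Z
  simpa only [assoc, ← whiskerLeft_comp, K.Qi, H.z4 (w := r) hU] using h8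
theorem z6 (hT : S.IsT v T) (hU : S.IsT w U) (Z : C) : A ◁ sz μ ε X.rco Y.lco _ ≫ o22 T _ ≫ X.V ◁ o22 U Z = o22 T _ ≫ X.V ◁ o22 U Z := by
  have := hX.mem; have := hY.mem
  have hA := H.bicM S.m H.tam H.tbm
  have h1 : A ◁ sz μ ε X.rco Y.lco (A ⊗ 𝟙_ C) ≫ o22 T _ ≫ X.V ◁ bz U S.m (𝟙_ C) = o22 T _ ≫ X.V ◁ bz U S.m (𝟙_ C) :=
    H.z6a (w := w) hT hU (W := H.bic S.m H.tam H.tbm) (r := S.m) (𝟙_ C)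
  have h2 : A ◁ sIdem μ ε X.rco Y.lco ≫ (α_ _ _ _).inv ≫ T ▷ _ ≫ (α_ _ _ _).hom ≫ X.V ◁ U ≫ (α_ _ _ _).inv =
      (α_ _ _ _).inv ≫ T ▷ _ ≫ (α_ _ _ _).hom ≫ X.V ◁ U ≫ (α_ _ _ _).inv := by
    apply S.NDR32
    have h3 := h1 =≫ (α_ _ _ _).inv
    rw [← sIdem_o22] at h3
    convert h3 using 1 <;> (simp only [o32, o22, bz, o21]; monoidal)
  have h3 := congrArg (fun t => o32 (t ≫ (α_ _ _ _).hom) Z ≫ X.V ◁ (α_ _ _ _).hom) h2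
  rw [← sIdem_o22]
  convert h3 using 1 <;> (simp only [o32, o22]; monoidal)
theorem TT_q (hT : S.IsT v T) (hU : S.IsT w U) (Z : C) :
    A ◁ o21 (K.q X Y) Z ≫ o22 (K.TT X Y T U) Z = o22 T _ ≫ X.V ◁ o22 U Z ≫ o21 (K.q X Y) (A ⊗ Z) := by
  have h := H.z6 (w := w) hT hU Z =≫ o21 (K.q X Y) (A ⊗ Z)
  rw [K.TT_o0, ← whiskerLeft_comp_assoc, K.Qi]
  simpa only [assoc] using h
end LH

end

section
theorem mext {A V W : C} {v : A ⊗ V ⟶ V} {w : A ⊗ W ⟶ W} {f : V ⟶ W}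
    (h : o21 v (𝟙_ C) ≫ o11 f (𝟙_ C) = A ◁ o11 f (𝟙_ C) ≫ o21 w (𝟙_ C)) : v ≫ f = A ◁ f ≫ w := by
  have h1 := (A ◁ (ρ_ _).inv ≫= h) =≫ (ρ_ _).hom
  convert h1 using 1 <;> (simp only [o21, o11]; monoidal)
theorem mextz {A V W : C} {v : A ⊗ V ⟶ V} {w : A ⊗ W ⟶ W} {f : V ⟶ W}
    (h : v ≫ f = A ◁ f ≫ w) (Z : C) : o21 v Z ≫ o11 f Z = A ◁ o11 f Z ≫ o21 w Z := by
  have := congrArg (fun t => (α_ _ _ _).inv ≫ t ▷ Z) h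
  convert this using 1 <;> (simp only [o21, o11]; monoidal)
namespace LH
variable {A : C} {𝒴 : Set C} {S : RWMB A 𝒴} {L : C} {p : A ⟶ L} {n₁ : L ⊗ A ⟶ A} {n₂ : A ⊗ L ⟶ A}
    {μ : L ⊗ L ⟶ L} {δ : L ⟶ L ⊗ L} {ε : L ⟶ 𝟙_ C} {τ : A ⟶ L ⊗ A} {τbar : A ⟶ A ⊗ L}
    (H : LH S p n₁ n₂ μ δ ε τ τbar) (K : CS μ δ ε) [IsIdempotentComplete C]
include H
variable [YCl 𝒴] [InY 𝒴 A] [InY 𝒴 L] [PresRE C] [REpi S.m] [REpi p]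
variable {X Y W X' Y' : Bicomod L δ ε} {v : A ⊗ X.V ⟶ X.V} [hX : BM S τ τbar X v] {w : A ⊗ Y.V ⟶ Y.V} [hY : BM S τ τbar Y w]
variable {r : A ⊗ W.V ⟶ W.V} [hW : BM S τ τbar W r]
variable {v' : A ⊗ X'.V ⟶ X'.V} [hX' : BM S τ τbar X' v'] {w' : A ⊗ Y'.V ⟶ Y'.V} [hY' : BM S τ τbar Y' w']
variable {T : A ⊗ X.V ⟶ X.V ⊗ A} {U : A ⊗ Y.V ⟶ Y.V ⊗ A} {T' : A ⊗ X'.V ⟶ X'.V ⊗ A} [hD : DH S]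
theorem wrM (hT : S.IsT v T) (hT' : S.IsT v' T') (f : X ⟶ X') (hf : v ≫ f.1 = A ◁ f.1 ≫ v') :
    K.b X Y T w ≫ (K.wr f Y).1 = A ◁ (K.wr f Y).1 ≫ K.b X' Y T' w := by
  have := hX.re
  apply mext
  rw [← cancel_epi (A ◁ o21 (K.q X Y) (𝟙_ C))]
  have h1 := H.b_o K (w := w) hT (𝟙_ C) =≫ o11 (K.wr f Y).1 (𝟙_ C)
  have h2 := bz T w (𝟙_ C) ≫= K.wr_o f Y (𝟙_ C)
  have h3 := congrArg (fun t => A ◁ t ≫ o21 (K.b X' Y T' w) (𝟙_ C)) (K.wr_o f Y (𝟙_ C))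
  have h4 := A ◁ o11 f.1 _ ≫= H.b_o K (w := w) hT' (𝟙_ C)
  have h5 := hT.uniq hT' f.1 hf (Y.V ⊗ 𝟙_ C) =≫ (X'.V ◁ o21 w (𝟙_ C) ≫ o21 (K.q X' Y) (𝟙_ C))
  simp [bz] at h1 h2 h3 h4 h5 ⊢
  rw [h1, h2, h3, h4, h5]
theorem wlM (hT : S.IsT v T) (f : Y ⟶ Y') (hf : w ≫ f.1 = A ◁ f.1 ≫ w') :
    K.b X Y T w ≫ (K.wl X f).1 = A ◁ (K.wl X f).1 ≫ K.b X Y' T w' := by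
  apply mext
  rw [← cancel_epi (A ◁ o21 (K.q X Y) (𝟙_ C))]
  have h1 := H.b_o K (w := w) hT (𝟙_ C) =≫ o11 (K.wl X f).1 (𝟙_ C)
  have h2 := bz T w (𝟙_ C) ≫= K.wl_o X f (𝟙_ C)
  have h3 := congrArg (fun t => A ◁ t ≫ o21 (K.b X Y' T w') (𝟙_ C)) (K.wl_o X f (𝟙_ C))
  have h4 := A ◁ X.V ◁ o11 f.1 _ ≫= H.b_o K (w := w') hT (𝟙_ C)
  have h5 := congrArg (fun t => o22 T _ ≫ X.V ◁ t ≫ o21 (K.q X Y') (𝟙_ C)) (mextz hf (𝟙_ C))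
  simp [bz] at h1 h2 h3 h4 h5 ⊢
  rw [h1, h2, h3, h4, h5]
theorem luM {T : A ⊗ L ⟶ L ⊗ A} (hT : S.IsT (n₂ ≫ p) T) :
    K.b K.un X T v ≫ (K.lu X).hom.1 = A ◁ (K.lu X).hom.1 ≫ v := by
  have := hX.mdl; have := hX.mem; have := hX.re; have := H.unBM K
  apply mext
  rw [← cancel_epi (A ◁ o21 (K.ql X) (𝟙_ C))]
  have h0 : A ◁ o21 (K.ql X) (𝟙_ C) ≫ o21 (K.b K.un X T v) (𝟙_ C) = bz T v (𝟙_ C) ≫ o21 (K.ql X) (𝟙_ C) :=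
    H.b_o K (X := K.un) (v := n₂ ≫ p) (w := v) hT (𝟙_ C)
  rw [reassoc_of% h0, K.lu_o, ← whiskerLeft_comp_assoc, K.lu_o]
  exact H.lamM hT hX.ta (𝟙_ C)
theorem ruM (hT : S.IsT v T) : K.b X K.un T (n₂ ≫ p) ≫ (K.ru X).hom.1 = A ◁ (K.ru X).hom.1 ≫ v := by
  have := hX.mdl; have := hX.mem; have := hX.re; have := H.unBM K
  apply mext
  rw [← cancel_epi (A ◁ o21 (K.qr X) (𝟙_ C))]
  have h0 : A ◁ o21 (K.qr X) (𝟙_ C) ≫ o21 (K.b X K.un T (n₂ ≫ p)) (𝟙_ C) = bz T (n₂ ≫ p) (𝟙_ C) ≫ o21 (K.qr X) (𝟙_ C) :=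
    H.b_o K (Y := K.un) (w := n₂ ≫ p) hT (𝟙_ C)
  rw [reassoc_of% h0, K.ru_o, ← whiskerLeft_comp_assoc, K.ru_o]
  simpa only [sr, whiskerLeft_comp, assoc] using H.rhoM hT hX.tb (𝟙_ C)
theorem asM (hT : S.IsT v T) (hU : S.IsT w U) {T1 : A ⊗ (K.tens X Y).V ⟶ (K.tens X Y).V ⊗ A} (hT1 : S.IsT (K.b X Y T w) T1) :
    K.b (K.tens X Y) W T1 r ≫ (K.as X Y W).hom.1 = A ◁ (K.as X Y W).hom.1 ≫ K.b X (K.tens Y W) T (K.b Y W U r) := by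
  have h1 := H.tensBM K (X := X) (Y := Y) (v := v) (w := w) hT
  have h2 := H.tensBM K (X := Y) (Y := W) (v := w) (w := r) hU
  have hre := h1.re
  have e1 : ∀ Z, o22 T1 Z = o22 (K.TT X Y T U) Z := by
    intro Z
    have := hT1.uniq (H.b_T K (w := w) hT hU) (𝟙 _) (by simp) Z
    simpa [o11] using this
  apply mext
  have : Epi (A ◁ o21 (K.q X Y) (W.V ⊗ 𝟙_ C) ≫ A ◁ o21 (K.q (K.tens X Y) W) (𝟙_ C)) := inferInstance
  rw [← cancel_epi (A ◁ o21 (K.q X Y) (W.V ⊗ 𝟙_ C) ≫ A ◁ o21 (K.q (K.tens X Y) W) (𝟙_ C))]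
  have k1 := A ◁ o21 (K.q X Y) (W.V ⊗ 𝟙_ C) ≫= H.b_o K (X := K.tens X Y) (Y := W) (w := r) hT1 (𝟙_ C) =≫ o11 (K.as X Y W).hom.1 (𝟙_ C)
  have k2 := H.TT_q K (w := w) hT hU (W.V ⊗ 𝟙_ C) =≫ ((K.tens X Y).V ◁ o21 r (𝟙_ C) ≫ o21 (K.q (K.tens X Y) W) (𝟙_ C) ≫ o11 (K.as X Y W).hom.1 (𝟙_ C))
  have k3 := (o22 T _ ≫ X.V ◁ bz U r (𝟙_ C)) ≫= K.as_o X Y W (𝟙_ C)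
  have k4 := congrArg (fun t => A ◁ t ≫ o21 (K.b X (K.tens Y W) T (K.b Y W U r)) (𝟙_ C)) (K.as_o X Y W (𝟙_ C))
  have k5 := A ◁ X.V ◁ o21 (K.q Y W) (𝟙_ C) ≫= H.b_o K (X := X) (Y := K.tens Y W) (w := K.b Y W U r) hT (𝟙_ C)
  have k6 := congrArg (fun t => o22 T _ ≫ X.V ◁ t ≫ o21 (K.q X (K.tens Y W)) (𝟙_ C)) (H.b_o K (w := r) hU (𝟙_ C))
  simp [bz, e1] at k1 k2 k3 k4 k5 k6 ⊢
  rw [k1, k2, k3, k4, k5, k6]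
end LH

end

section
theorem IsTau.pl {A L V : C} {τ : A ⟶ L ⊗ A} {v : A ⊗ V ⟶ V} {t : V ⟶ L ⊗ V} (h : IsTau τ v t) :
    v ≫ t = (τ ▷ V) ≫ (α_ L A V).hom ≫ (L ◁ v) := by
  have h1 := (A ◁ (ρ_ _).inv ≫= h (𝟙_ C)) =≫ (_ ◁ (ρ_ _).hom)
  convert h1 using 1 <;> (simp only [o12, o21]; monoidal)
theorem IsTaub.pl {A L V : C} {τbar : A ⟶ A ⊗ L} {v : A ⊗ V ⟶ V} {t : V ⟶ V ⊗ L} (h : IsTaub τbar v t) :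
    v ≫ t = (τbar ▷ V) ≫ (α_ A L V).hom ≫ (A ◁ (β_ L V).hom) ≫ (α_ A V L).inv ≫ (v ▷ L) := by
  have h1 := (A ◁ (ρ_ _).inv ≫= h (𝟙_ C)) =≫ (_ ◁ (ρ_ _).hom)
  convert h1 using 1 <;> (simp only [o12, o21, br, o22]; monoidal)
theorem IsTau.hom {A L V V' : C} {τ : A ⟶ L ⊗ A} {v : A ⊗ V ⟶ V} {t : V ⟶ L ⊗ V} {v' : A ⊗ V' ⟶ V'} {t' : V' ⟶ L ⊗ V'}
    [Epi v] (h : IsTau τ v t) (h' : IsTau τ v' t') (f : V ⟶ V') (hf : v ≫ f = A ◁ f ≫ v') : t ≫ L ◁ f = f ≫ t' := by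
  rw [← cancel_epi v, reassoc_of% h.pl, reassoc_of% hf, h'.pl, ← whiskerLeft_comp, hf]
  simp [whisker_exchange_assoc]
theorem IsTaub.hom {A L V V' : C} {τbar : A ⟶ A ⊗ L} {v : A ⊗ V ⟶ V} {t : V ⟶ V ⊗ L} {v' : A ⊗ V' ⟶ V'} {t' : V' ⟶ V' ⊗ L}
    [Epi v] (h : IsTaub τbar v t) (h' : IsTaub τbar v' t') (f : V ⟶ V') (hf : v ≫ f = A ◁ f ≫ v') : t ≫ f ▷ L = f ≫ t' := by
  rw [← cancel_epi v, reassoc_of% h.pl, reassoc_of% hf, h'.pl, ← comp_whiskerRight, hf]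
  have hn : (β_ L V).hom ≫ f ▷ L = L ◁ f ≫ (β_ L V').hom := by simp
  have hn' : A ◁ (β_ L V).hom ≫ A ◁ (f ▷ L) = A ◁ (L ◁ f) ≫ A ◁ (β_ L V').hom := by
    rw [← whiskerLeft_comp, hn, whiskerLeft_comp]
  rw [comp_whiskerRight, ← associator_inv_naturality_middle_assoc, reassoc_of% hn', ← associator_naturality_right_assoc, whisker_exchange_assoc]
theorem IsTau.uq {A L V : C} {τ : A ⟶ L ⊗ A} {v : A ⊗ V ⟶ V} {t t' : V ⟶ L ⊗ V} [Epi v]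
    (h : IsTau τ v t) (h' : IsTau τ v t') : t = t' := by
  simpa using h.hom h' (𝟙 _) (by simp)
theorem IsTaub.uq {A L V : C} {τbar : A ⟶ A ⊗ L} {v : A ⊗ V ⟶ V} {t t' : V ⟶ V ⊗ L} [Epi v]
    (h : IsTaub τbar v t) (h' : IsTaub τbar v t') : t = t' := by
  simpa using h.hom h' (𝟙 _) (by simp)
theorem bico_ext {L : C} {δ : L ⟶ L ⊗ L} {ε : L ⟶ 𝟙_ C} {V : C} {a a' : V ⟶ L ⊗ V} {b b' : V ⟶ V ⊗ L} (h : a = a') (h' : b = b')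
    (h1 h2 h3 h4 h5 h1' h2' h3' h4' h5') : (⟨V, a, b, h1, h2, h3, h4, h5⟩ : Bicomod L δ ε) = ⟨V, a', b', h1', h2', h3', h4', h5'⟩ := by
  subst h; subst h'; rfl
theorem bico_eqToHom {L : C} {δ : L ⟶ L ⊗ L} {ε : L ⟶ 𝟙_ C} {X Y : Bicomod L δ ε} (h : X = Y) :
    (eqToHom h).1 = eqToHom (congrArg Bicomod.V h) := by
  subst h; rfl
/-- isomorphisms of modules from isomorphisms of bicomodules -/
def mkIso {A : C} {m : A ⊗ A ⟶ A} {𝒴 : Set C} {M N : AModule A m 𝒴} {f : M.V ⟶ N.V} {g : N.V ⟶ M.V} (hf : M.act ≫ f = A ◁ f ≫ N.act)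
    (h1 : f ≫ g = 𝟙 _) (h2 : g ≫ f = 𝟙 _) : M ≅ N where
  hom := ⟨f, hf⟩
  inv := ⟨g, by
    have h3 := (A ◁ g ≫= hf) =≫ g
    rw [← whiskerLeft_comp_assoc, h2] at h3
    simpa [h1, assoc] using h3.symm⟩
  hom_inv_id := Subtype.ext h1
  inv_hom_id := Subtype.ext h2
namespace LH
variable {A : C} {𝒴 : Set C} {S : RWMB A 𝒴} {L : C} {p : A ⟶ L} {n₁ : L ⊗ A ⟶ A} {n₂ : A ⊗ L ⟶ A}
    {μ : L ⊗ L ⟶ L} {δ : L ⟶ L ⊗ L} {ε : L ⟶ 𝟙_ C} {τ : A ⟶ L ⊗ A} {τbar : A ⟶ A ⊗ L}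
    (H : LH S p n₁ n₂ μ δ ε τ τbar) (K : CS μ δ ε) [IsIdempotentComplete C]
instance aRe (M : AModule A S.m 𝒴) : REpi M.act := ⟨M.regEpi⟩
instance aY (M : AModule A S.m 𝒴) : InY 𝒴 M.V := ⟨M.mem⟩
instance aM (M : AModule A S.m 𝒴) : Mdl S M.act where
  assoc := by rw [M.assoc]; simp [o21]
  nd := M.nd
include H
variable [YCl 𝒴] [InY 𝒴 A] [InY 𝒴 L] [PresRE C] [REpi S.m] [REpi p] [hD : DH S]
theorem eTau (M : AModule A S.m 𝒴) : ∃ t, IsTau τ M.act t := by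
  obtain ⟨E, h, k, h1, h2, h3⟩ := hD.d2
  obtain ⟨t, ht⟩ := H.exTau M.act h1 h2
  exact ⟨t, IsTau.mk (by simpa [o12] using ht)⟩
theorem eTaub (M : AModule A S.m 𝒴) : ∃ t, IsTaub τbar M.act t := by
  obtain ⟨t, ht⟩ := H.exTaub M.act
  exact ⟨t, IsTaub.mk ht⟩
/-- the underlying bicomodule -/
noncomputable def fo (M : AModule A S.m 𝒴) : Bicomod L δ ε :=
  H.bic M.act (H.eTau M).choose_spec (H.eTaub M).choose_spec
theorem foM (M : AModule A S.m 𝒴) : BM S τ τbar (H.fo M) M.act :=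
  H.bicM M.act (H.eTau M).choose_spec (H.eTaub M).choose_spec
theorem foE (M : AModule A S.m 𝒴) : @Epi C _ (A ⊗ (H.fo M).V) (H.fo M).V M.act := @repiEpi _ _ _ _ M.act (aRe M)
/-- the forgetful functor -/
noncomputable def fu : AModule A S.m 𝒴 ⥤ Bicomod L δ ε where
  obj M := H.fo M
  map {M N} f := have := H.foE M; ⟨f.1, (H.foM M).ta.hom (H.foM N).ta f.1 f.2, (H.foM M).tb.hom (H.foM N).tb f.1 f.2⟩
  map_id _ := rfl
  map_comp _ _ := rfl
theorem fuF : H.fu.Faithful where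
  map_injective {_ _ f g} h := Subtype.ext (congrArg (fun t => t.1) h)
omit H in
/-- modules from bicomodules -/
@[reducible] def ofBM (X : Bicomod L δ ε) (v : A ⊗ X.V ⟶ X.V) (h : BM S τ τbar X v) : AModule A S.m 𝒴 where
  V := X.V
  mem := h.mem.mem
  act := v
  assoc := by rw [h.mdl.assoc]; simp [o21]
  regEpi := h.re.re
  nd := h.mdl.nd
theorem fo_of (X : Bicomod L δ ε) (v : A ⊗ X.V ⟶ X.V) (h : BM S τ τbar X v) : H.fo (ofBM X v h) = X := by
  have h' := H.foM (ofBM X v h)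
  have hE := H.foE (ofBM X v h)
  cases X
  exact bico_ext (h'.ta.uq h.ta) (h'.tb.uq h.tb) _ _ _ _ _ _ _ _ _ _
theorem iT (M : AModule A S.m 𝒴) : ∃ T, S.IsT M.act T := S.exT M.act
/-- the braiding-like map of a module -/
noncomputable def mT (M : AModule A S.m 𝒴) : A ⊗ M.V ⟶ M.V ⊗ A := (H.iT M).choose
theorem mT_s (M : AModule A S.m 𝒴) : S.IsT M.act (H.mT M) := (H.iT M).choose_spec
/-- the tensor product of modules -/
@[reducible] noncomputable def mt (M N : AModule A S.m 𝒴) : AModule A S.m 𝒴 :=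
  ofBM (K.tens (H.fo M) (H.fo N)) (K.b (H.fo M) (H.fo N) (H.mT M) N.act)
    (H.tensBM K (hX := H.foM M) (hY := H.foM N) (H.mT_s M))
/-- the unit module -/
@[reducible] noncomputable def mu : AModule A S.m 𝒴 := ofBM K.un (n₂ ≫ p) (H.unBM K)
theorem e2 (M N : AModule A S.m 𝒴) : H.fo (H.mt K M N) = K.tens (H.fo M) (H.fo N) := H.fo_of _ _ _
theorem e0 : H.fo (H.mu K) = K.un := H.fo_of _ _ _
theorem e2h (M N : AModule A S.m 𝒴) : (eqToHom (H.e2 K M N)).1 = 𝟙 (K.tens (H.fo M) (H.fo N)).V := (bico_eqToHom _).trans rfl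
theorem e2i (M N : AModule A S.m 𝒴) : (eqToHom (H.e2 K M N).symm).1 = 𝟙 (K.tens (H.fo M) (H.fo N)).V := (bico_eqToHom _).trans rfl
theorem e0h : (eqToHom (H.e0 K)).1 = 𝟙 L := (bico_eqToHom _).trans rfl
end LH

end

section
namespace LH
variable {A : C} {𝒴 : Set C} {S : RWMB A 𝒴} {L : C} {p : A ⟶ L} {n₁ : L ⊗ A ⟶ A} {n₂ : A ⊗ L ⟶ A}
    {μ : L ⊗ L ⟶ L} {δ : L ⟶ L ⊗ L} {ε : L ⟶ 𝟙_ C} {τ : A ⟶ L ⊗ A} {τbar : A ⟶ A ⊗ L}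
    (H : LH S p n₁ n₂ μ δ ε τ τbar) (K : CS μ δ ε) [IsIdempotentComplete C]
include H
variable [YCl 𝒴] [InY 𝒴 A] [InY 𝒴 L] [PresRE C] [REpi S.m] [REpi p] [hD : DH S]
/-- the associator on underlying bicomodules -/
noncomputable def asB (M N P : AModule A S.m 𝒴) :
    K.tens (H.fo (H.mt K M N)) (H.fo P) ≅ K.tens (H.fo M) (H.fo (H.mt K N P)) :=
  letI := K.mon
  whiskerRightIso (eqToIso (H.e2 K M N)) (H.fo P) ≪≫ (α_ (H.fo M) (H.fo N) (H.fo P)) ≪≫ whiskerLeftIso (H.fo M) (eqToIso (H.e2 K N P).symm)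
/-- the left unitor on underlying bicomodules -/
noncomputable def luB (M : AModule A S.m 𝒴) : K.tens (H.fo (H.mu K)) (H.fo M) ≅ H.fo M :=
  letI := K.mon
  whiskerRightIso (eqToIso (H.e0 K)) (H.fo M) ≪≫ (λ_ (H.fo M))
/-- the right unitor on underlying bicomodules -/
noncomputable def ruB (M : AModule A S.m 𝒴) : K.tens (H.fo M) (H.fo (H.mu K)) ≅ H.fo M :=
  letI := K.mon
  whiskerLeftIso (H.fo M) (eqToIso (H.e0 K)) ≪≫ (ρ_ (H.fo M))
omit H in
theorem mcomp {V W X : C} {v : A ⊗ V ⟶ V} {w : A ⊗ W ⟶ W} {x : A ⊗ X ⟶ X} {f : V ⟶ W} {g : W ⟶ X}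
    (hf : v ≫ f = A ◁ f ≫ w) (hg : w ≫ g = A ◁ g ≫ x) : v ≫ f ≫ g = A ◁ (f ≫ g) ≫ x := by
  rw [reassoc_of% hf, hg, whiskerLeft_comp, assoc]
omit H in
theorem actid {V : C} (v : A ⊗ V ⟶ V) : v ≫ 𝟙 V = A ◁ 𝟙 V ≫ v := by simp
theorem e2M (M N : AModule A S.m 𝒴) : (H.mt K M N).act ≫ (eqToHom (H.e2 K M N)).1 = A ◁ (eqToHom (H.e2 K M N)).1 ≫ K.b (H.fo M) (H.fo N) (H.mT M) N.act := by
  rw [H.e2h]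
  exact actid _
theorem e2Mi (M N : AModule A S.m 𝒴) : K.b (H.fo M) (H.fo N) (H.mT M) N.act ≫ (eqToHom (H.e2 K M N).symm).1 = A ◁ (eqToHom (H.e2 K M N).symm).1 ≫ (H.mt K M N).act := by
  rw [H.e2i]
  exact actid _
theorem e0M : (H.mu K).act ≫ (eqToHom (H.e0 K)).1 = A ◁ (eqToHom (H.e0 K)).1 ≫ n₂ ≫ p := by
  rw [H.e0h]
  exact actid _
theorem asBM (M N P : AModule A S.m 𝒴) : (H.mt K (H.mt K M N) P).act ≫ (H.asB K M N P).hom.1 = A ◁ (H.asB K M N P).hom.1 ≫ (H.mt K M (H.mt K N P)).act := by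
  have hMN := H.tensBM K (hX := H.foM M) (hY := H.foM N) (H.mT_s M)
  have hNP := H.tensBM K (hX := H.foM N) (hY := H.foM P) (H.mT_s N)
  have h1 := H.wrM K (hX := H.foM (H.mt K M N)) (hX' := hMN) (hY := H.foM P) (H.mT_s (H.mt K M N)) (H.mT_s (H.mt K M N))
    (eqToHom (H.e2 K M N)) (H.e2M K M N)
  have h2 := H.asM K (hX := H.foM M) (hY := H.foM N) (hW := H.foM P) (H.mT_s M) (H.mT_s N) (H.mT_s (H.mt K M N))
  have h3 := H.wlM K (hX := H.foM M) (hY := hNP) (hY' := H.foM (H.mt K N P)) (H.mT_s M)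
    (eqToHom (H.e2 K N P).symm) (H.e2Mi K N P)
  exact mcomp h1 (mcomp h2 h3)
theorem luBM (M : AModule A S.m 𝒴) : (H.mt K (H.mu K) M).act ≫ (H.luB K M).hom.1 = A ◁ (H.luB K M).hom.1 ≫ M.act := by
  have hu := H.unBM K
  have h1 := H.wrM K (hX := H.foM (H.mu K)) (hX' := hu) (hY := H.foM M) (H.mT_s (H.mu K)) (H.mT_s (H.mu K))
    (eqToHom (H.e0 K)) (H.e0M K)
  exact mcomp h1 (H.luM K (hX := H.foM M) (H.mT_s (H.mu K)))
theorem ruBM (M : AModule A S.m 𝒴) : (H.mt K M (H.mu K)).act ≫ (H.ruB K M).hom.1 = A ◁ (H.ruB K M).hom.1 ≫ M.act := by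
  have hu := H.unBM K
  have h1 := H.wlM K (hX := H.foM M) (hY := H.foM (H.mu K)) (hY' := hu) (H.mT_s M) (eqToHom (H.e0 K)) (H.e0M K)
  exact mcomp h1 (H.ruM K (hX := H.foM M) (H.mT_s M))
/-- whiskering on the right -/
noncomputable def mwr {M M' : AModule A S.m 𝒴} (f : M ⟶ M') (N : AModule A S.m 𝒴) : H.mt K M N ⟶ H.mt K M' N :=
  ⟨(K.wr (H.fu.map f) (H.fo N)).1, H.wrM K (hX := H.foM M) (hX' := H.foM M') (hY := H.foM N) (H.mT_s M) (H.mT_s M') (H.fu.map f) f.2⟩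
/-- whiskering on the left -/
noncomputable def mwl (M : AModule A S.m 𝒴) {N N' : AModule A S.m 𝒴} (f : N ⟶ N') : H.mt K M N ⟶ H.mt K M N' :=
  ⟨(K.wl (H.fo M) (H.fu.map f)).1, H.wlM K (hX := H.foM M) (hY := H.foM N) (hY' := H.foM N') (H.mT_s M) (H.fu.map f) f.2⟩
/-- the monoidal operations on modules -/
@[reducible] noncomputable def mst : MonoidalCategoryStruct (AModule A S.m 𝒴) where
  tensorObj := H.mt K
  whiskerLeft M _ _ f := H.mwl K M f
  whiskerRight f N := H.mwr K f N
  tensorHom {M M' N N'} f g := H.mwr K f N ≫ H.mwl K M' g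
  tensorUnit := H.mu K
  associator M N P := mkIso (H.asBM K M N P) (congrArg (fun t => t.1) (H.asB K M N P).hom_inv_id) (congrArg (fun t => t.1) (H.asB K M N P).inv_hom_id)
  leftUnitor M := mkIso (H.luBM K M) (congrArg (fun t => t.1) (H.luB K M).hom_inv_id) (congrArg (fun t => t.1) (H.luB K M).inv_hom_id)
  rightUnitor M := mkIso (H.ruBM K M) (congrArg (fun t => t.1) (H.ruB K M).hom_inv_id) (congrArg (fun t => t.1) (H.ruB K M).inv_hom_id)
theorem cj {M N M' N' : AModule A S.m 𝒴} (g : K.tens (H.fo M) (H.fo N) ⟶ K.tens (H.fo M') (H.fo N')) :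
    (eqToHom (H.e2 K M N) ≫ g ≫ eqToHom (H.e2 K M' N').symm).1 = g.1 := by
  refine (congrArg₂ (fun a b => a ≫ g.1 ≫ b) (H.e2h K M N) (H.e2i K M' N')).trans ?_
  exact (id_comp _).trans (comp_id _)
theorem cj1 {M N : AModule A S.m 𝒴} {X : Bicomod L δ ε} (g : K.tens (H.fo M) (H.fo N) ⟶ X) :
    (eqToHom (H.e2 K M N) ≫ g).1 = g.1 := by
  refine (congrArg (fun a => a ≫ g.1) (H.e2h K M N)).trans ?_
  exact id_comp _
/-- the comparison of the monoidal operations -/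
noncomputable def ifd : letI := K.mon; letI := H.mst K; Monoidal.InducingFunctorData H.fu :=
  letI := K.mon
  letI := H.mst K
  { μIso := fun M N => eqToIso (H.e2 K M N).symm
    εIso := eqToIso (H.e0 K).symm
    whiskerLeft_eq := fun M _ _ f => Subtype.ext (H.cj K (K.wl (H.fo M) (H.fu.map f))).symm
    whiskerRight_eq := fun f N => Subtype.ext (H.cj K (K.wr (H.fu.map f) (H.fo N))).symm
    tensorHom_eq := fun {M M' N N'} f g => Subtype.ext (H.cj K (K.wr (H.fu.map f) (H.fo N) ≫ K.wl (H.fo M') (H.fu.map g))).symm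
    associator_eq := fun M N P => by
      refine Subtype.ext ((H.cj K (H.asB K M N P).hom).symm.trans (congrArg Subtype.val ?_))
      simp only [asB, Iso.trans_hom, tensorIso_hom, Iso.symm_hom, Iso.refl_hom, tensorHom_id, id_tensorHom, assoc]
      rfl
    leftUnitor_eq := fun M => by
      refine Subtype.ext ((H.cj1 K (H.luB K M).hom).symm.trans (congrArg Subtype.val ?_))
      simp only [luB, Iso.trans_hom, tensorIso_hom, Iso.symm_hom, Iso.refl_hom, tensorHom_id, id_tensorHom, assoc]
      rfl
    rightUnitor_eq := fun M => by
      refine Subtype.ext ((H.cj1 K (H.ruB K M).hom).symm.trans (congrArg Subtype.val ?_))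
      simp only [ruB, Iso.trans_hom, tensorIso_hom, Iso.symm_hom, Iso.refl_hom, tensorHom_id, id_tensorHom, assoc]
      rfl }
end LH

end

section
theorem apP {A V W : C} (v : A ⊗ V ⟶ V) (w : A ⊗ W ⟶ W) :
    actPair v w = (α_ _ _ _).hom ≫ A ◁ A ◁ V ◁ (ρ_ W).inv ≫ ap v w (𝟙_ C) ≫ V ◁ (ρ_ W).hom := by
  simp only [actPair, ap, br, o21, o22]; monoidal
theorem bqg {A V W X : C} {T : A ⊗ V ⟶ V ⊗ A} {w : A ⊗ W ⟶ W} {q : V ⊗ W ⟶ X} {b : A ⊗ X ⟶ X}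
    (h : A ◁ o21 q (𝟙_ C) ≫ o21 b (𝟙_ C) = bz T w (𝟙_ C) ≫ o21 q (𝟙_ C)) : A ◁ q ≫ b = bp T w ≫ q := by
  have h1 := (A ◁ _ ◁ (ρ_ _).inv) ≫= h =≫ (ρ_ _).hom
  rw [← bp_o] at h1
  convert h1 using 1 <;> (simp only [o21, o32]; monoidal)
namespace LH
variable {A : C} {𝒴 : Set C} {S : RWMB A 𝒴} {L : C} {p : A ⟶ L} {n₁ : L ⊗ A ⟶ A} {n₂ : A ⊗ L ⟶ A}
    {μ : L ⊗ L ⟶ L} {δ : L ⟶ L ⊗ L} {ε : L ⟶ 𝟙_ C} {τ : A ⟶ L ⊗ A} {τbar : A ⟶ A ⊗ L}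
    (H : LH S p n₁ n₂ μ δ ε τ τbar) (K : CS μ δ ε) [IsIdempotentComplete C]
include H
variable [YCl 𝒴] [InY 𝒴 A] [InY 𝒴 L] [PresRE C] [REpi S.m] [REpi p] [hD : DH S]
theorem b0u (M N : AModule A S.m 𝒴) (b0 : A ⊗ (M.V ⊗ N.V) ⟶ M.V ⊗ N.V)
    (h : (A ◁ actPair M.act N.act) ≫ b0 = (α_ A (A ⊗ A) (M.V ⊗ N.V)).inv ≫ (dOne S.m S.t₁ ▷ (M.V ⊗ N.V)) ≫ actPair M.act N.act) :
    b0 = bp (H.mT M) N.act := by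
  have hE : Epi (A ◁ actPair M.act N.act) := by
    have := RWMB.repiAp (v := M.act) (w := N.act) (𝟙_ C)
    rw [apP]
    simp only [whiskerLeft_comp]
    infer_instance
  rw [← cancel_epi (A ◁ actPair M.act N.act), h, ← bp_o1]
  have h1 := (H.mT_s M).ap_bz (w := N.act) (𝟙_ C)
  have h2 := (A ◁ (α_ A A _).hom ≫ A ◁ A ◁ A ◁ M.V ◁ (ρ_ N.V).inv) ≫= h1 =≫ M.V ◁ (ρ_ N.V).hom
  rw [S.dd1_eq32] at h2
  refine Eq.trans ?_ (h2.symm.trans ?_)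
  · rw [apP]
    generalize ap M.act N.act (𝟙_ C) = x
    generalize dOne S.m S.t₁ = y
    simp only [o32]
    monoidal
  · rw [apP]
    generalize ap M.act N.act (𝟙_ C) = x
    generalize bz (H.mT M) N.act (𝟙_ C) = y
    monoidal
theorem bqM (M N : AModule A S.m 𝒴) :
    A ◁ K.q (H.fo M) (H.fo N) ≫ K.b (H.fo M) (H.fo N) (H.mT M) N.act = bp (H.mT M) N.act ≫ K.q (H.fo M) (H.fo N) := by
  exact bqg (H.b_o K (hX := H.foM M) (hY := H.foM N) (H.mT_s M) (𝟙_ C))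
theorem main : ∃ (instMA : MonoidalCategory (AModule A S.m 𝒴)) (instMB : MonoidalCategory (Bicomod L δ ε))
      (F : AModule A S.m 𝒴 ⥤ Bicomod L δ ε),
      StrictMonoidalLift S L p n₂ μ δ ε τ τbar (instMA := instMA) (instMB := instMB) F := by
  have K : CS μ δ ε := H.cs
  let iB := K.mon
  let iS := H.mst K
  have := H.fuF
  let iA := Monoidal.induced H.fu (H.ifd K)
  refine ⟨iA, iB, H.fu, ⟨rfl, ?_⟩, ?_, ⟨rfl, ?_, ?_⟩, ?_, ?_, ?_, ?_⟩
  · change n₂ ≫ p = A ◁ 𝟙 L ≫ n₂ ≫ p ≫ 𝟙 L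
    simp
  · intro M N tb htb t ht
    have hE1 := H.foE M
    have hE2 := H.foE N
    refine ⟨K.q (H.fo M) (H.fo N), K.i (H.fo M) (H.fo N), ?_, K.Piq _ _, ?_⟩
    · have e1 : (H.fo M).rco = tb := (H.foM M).tb.uq (IsTaub.mk htb)
      have e2 : (H.fo N).lco = t := (H.foM N).ta.uq (IsTau.mk ht)
      subst e1; subst e2
      exact K.Pqi _ _
    · intro b0 hb0
      rw [H.b0u M N b0 hb0]
      exact H.bqM K M N
  · change δ = 𝟙 L ≫ δ ≫ L ◁ 𝟙 L
    simp
  · change δ = 𝟙 L ≫ δ ≫ 𝟙 L ▷ L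
    simp
  · intro X Y
    exact ⟨K.q X Y, K.i X Y, K.Pqi _ _, K.Piq _ _⟩
  · intro M
    have hE1 := H.foE M
    refine ⟨rfl, fun t ht => ?_, fun t ht => ?_⟩
    · have e : (H.fo M).lco = t := (H.foM M).ta.uq (IsTau.mk ht)
      refine e.trans ?_
      change t = 𝟙 M.V ≫ t ≫ L ◁ 𝟙 M.V
      simp
    · have e : (H.fo M).rco = t := (H.foM M).tb.uq (IsTaub.mk ht)
      refine e.trans ?_
      change t = 𝟙 M.V ≫ t ≫ 𝟙 M.V ▷ L
      simp
  · intro M N f hM hN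
    change f.1 = 𝟙 M.V ≫ f.1 ≫ 𝟙 N.V
    simp
  · exact ⟨Monoidal.fromInducedMonoidal H.fu (H.ifd K), H.e0 K, H.e2 K, rfl, fun _ _ => rfl⟩
end LH
theorem presRe {D : Type*} [Category D] (F : C ⥤ D) [PreservesColimitsOfShape WalkingParallelPair F] {X Y : C} (f : X ⟶ Y)
    (h : Nonempty (RegularEpi f)) : Nonempty (RegularEpi (F.map f)) := by
  obtain ⟨r⟩ := h
  exact ⟨⟨_, F.map r.left, F.map r.right, by rw [← F.map_comp, r.w, F.map_comp], isColimitCoforkMapOfIsColimit F _ r.isColimit⟩⟩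
theorem coeqRe {X Y Z : C} (f g : X ⟶ Y) (q : Y ⟶ Z) (h : f ≫ q = g ≫ q)
    (hu : ∀ {W : C} (k : Y ⟶ W), f ≫ k = g ≫ k → ∃! l : Z ⟶ W, q ≫ l = k) : REpi q := by
  refine ⟨⟨⟨X, f, g, h, Cofork.IsColimit.mk' _ fun s => ?_⟩⟩⟩
  have hs := hu s.π s.condition
  exact ⟨hs.choose, hs.choose_spec.1, fun {m} hm => hs.choose_spec.2 m hm⟩

end

end Development

/-- Theorem 4.9: under the standing assumptions, together with the
requirements that idempotents in `C` split and `d̂₁`, `d̂₂` are regular epimorphisms,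
the category of `A`-modules carries a monoidal structure, with monoidal product the
`A`-module `(V ∘ W, b)` of Proposition 4.8 and unit the `A`-module `(L, p ∘ n₂)` of
Proposition 4.4, such that the functor `U` of Theorem 4.3 to `L`-bicomodules is strict
monoidal for the monoidal structure on `L`-bicomodules whose tensor product is the
splitting of the canonical idempotent `s` and whose unit is `L`. -/
theorem theorem_monoidal_category_of_modules
    [HasCoequalizers C] [IsIdempotentComplete C]
    (presL : ∀ X : C, PreservesColimitsOfShape WalkingParallelPair (tensorLeft X))
    (presR : ∀ X : C, PreservesColimitsOfShape WalkingParallelPair (tensorRight X))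
    (regcomp : ∀ {X Y Z : C} (f : X ⟶ Y) (g : Y ⟶ Z),
      Nonempty (RegularEpi f) → Nonempty (RegularEpi g) → Nonempty (RegularEpi (f ≫ g)))
    {A : C} {𝒴 : Set C} (S : RWMB A 𝒴)
    (hmreg : Nonempty (RegularEpi S.m))
    (hclosed : ∀ Y Y' : C, Y ∈ 𝒴 → Y' ∈ 𝒴 → (Y ⊗ Y') ∈ 𝒴)
    (hretract : ∀ (X Y : C), Y ∈ 𝒴 → ∀ (i : X ⟶ Y) (r : Y ⟶ X), i ≫ r = 𝟙 X → X ∈ 𝒴)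
    (L : C) (p : A ⟶ L)
    (hpc : S.piL1 ≫ p = S.piBarR1c ≫ p)
    (hpu : ∀ {X : C} (h : A ⟶ X), S.piL1 ≫ h = S.piBarR1c ≫ h →
      ∃! k : L ⟶ X, p ≫ k = h)
    (memL : L ∈ 𝒴)
    (n₁ : L ⊗ A ⟶ A) (hn₁ : (p ▷ A) ≫ n₁ = S.piL1)
    (hndn₁ : NdRightOn n₁ 𝒴)
    (n₂ : A ⊗ L ⟶ A) (hn₂ : (A ◁ p) ≫ n₂ = S.piL2)
    (μ : L ⊗ L ⟶ L) (hμ : (L ◁ p) ≫ μ = n₁ ≫ p)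
    (δ : L ⟶ L ⊗ L) (hδ : S.m ≫ p ≫ δ = S.t₁ ≫ (p ▷ A) ≫ (L ◁ p))
    (ε : L ⟶ 𝟙_ C) (hε : p ≫ ε = S.j)
    (hμδ : δ ≫ μ = 𝟙 L)
    (τ : A ⟶ L ⊗ A) (hτ : S.m ≫ τ = S.t₁ ≫ (p ▷ A))
    (τbar : A ⟶ A ⊗ L) (hτbar : S.m ≫ τbar = (β_ A A).hom ≫ S.t₄ ≫ (A ◁ p))
    (E₁ : C) (eHat₁ : A ⊗ A ⟶ E₁) (eCheck₁ : E₁ ⟶ A ⊗ A)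
    (he₁ : eHat₁ ≫ eCheck₁ = S.e₁) (he₁' : eCheck₁ ≫ eHat₁ = 𝟙 E₁)
    (E₂ : C) (eHat₂ : A ⊗ A ⟶ E₂) (eCheck₂ : E₂ ⟶ A ⊗ A)
    (he₂ : eHat₂ ≫ eCheck₂ = S.e₂) (he₂' : eCheck₂ ≫ eHat₂ = 𝟙 E₂)
    (hd₁ : Nonempty (RegularEpi (dOne S.m S.t₁ ≫ eHat₁)))
    (hd₂ : Nonempty (RegularEpi (dTwo S.m S.t₂ ≫ eHat₂))) :
    ∃ (instMA : MonoidalCategory (AModule A S.m 𝒴))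
      (instMB : MonoidalCategory (Bicomod L δ ε))
      (F : AModule A S.m 𝒴 ⥤ Bicomod L δ ε),
      StrictMonoidalLift S L p n₂ μ δ ε τ τbar
        (instMA := instMA) (instMB := instMB) F := by
  have iP : PresRE C := ⟨fun W f hf => by have := presL W; exact presRe (tensorLeft W) f hf,
    fun W f hf => by have := presR W; exact presRe (tensorRight W) f hf, regcomp⟩
  have iY : YCl 𝒴 := ⟨S.memI, hclosed⟩
  have iA : InY 𝒴 A := ⟨S.memA⟩
  have iL : InY 𝒴 L := ⟨memL⟩
  have im : REpi S.m := ⟨hmreg⟩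
  have ip : REpi p := coeqRe _ _ p hpc hpu
  have iD : DH S := ⟨hretract, ⟨E₁, eHat₁, eCheck₁, he₁, he₁', ⟨hd₁⟩⟩, ⟨E₂, eHat₂, eCheck₂, he₂, he₂', ⟨hd₂⟩⟩⟩
  have H : LH S p n₁ n₂ μ δ ε τ τbar := ⟨hpc, hn₁, hndn₁, hn₂, hμ, hδ, hε, hμδ, hτ, hτbar⟩
  exact H.main


end WeakMultiplierBimonoid
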